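/- Let X be a real vector space with dim X = 3 and K ⊂ X a convex body with 0 in its interior. Let R : X* → Hom(X,X) be a linear map such that for every λ ∈ X* the operator R_λ = R(λ) satisfies tr R_λ = 0, and such that for every λ ∈ X* and every x ∈ ∂K with λ(x) = 0, the vector R_λ(x) is tangent to ∂K at x. Then for every λ ∈ X* and every x ∈ ∂K, the vector R_λ(x) is tangent to ∂K at x. -/

import Mathlib

open Filter Topology

/-- `v` is *forward tangent* to `∂B` at `x` if there are a sequence `p i ∈ ∂B` with `p i → x`
and positive reals `c i` with `c i • (p i - x) → v`. -/
def IsForwardTangent {X : Type*} [NormedAddCommGroup X] [NormedSpace ℝ X]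
    (B : Set X) (x v : X) : Prop :=
  ∃ (p : ℕ → X) (c : ℕ → ℝ), (∀ i, p i ∈ frontier B) ∧ (∀ i, 0 < c i) ∧
    Tendsto p atTop (𝓝 x) ∧ Tendsto (fun i => c i • (p i - x)) atTop (𝓝 v)

/-- `v` is *tangent* to `∂B` at `x` if both `v` and `-v` are forward tangent to `∂B` at `x`. -/
def IsTangentVec {X : Type*} [NormedAddCommGroup X] [NormedSpace ℝ X]
    (B : Set X) (x v : X) : Prop :=
  IsForwardTangent B x v ∧ IsForwardTangent B x (-v)

structure Nm {V : Type*} [NormedAddCommGroup V] [NormedSpace ℝ V] (F : V → ℝ) : Prop where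
  conv : ConvexOn ℝ Set.univ F
  hom : ∀ (c : ℝ) (x : V), 0 ≤ c → F (c • x) = c * F x
  pos : ∀ x, x ≠ 0 → 0 < F x

lemma ld_congr {V : Type*} [NormedAddCommGroup V] [NormedSpace ℝ V] {F : V → ℝ} {c : ℝ}
    {x y v w : V} (h : HasLineDerivAt ℝ F c x v) (hx : x = y) (hv : v = w) :
    HasLineDerivAt ℝ F c y w := by
  subst hx hv
  exact h

namespace Nm
variable {V : Type*} [NormedAddCommGroup V] [NormedSpace ℝ V] {F : V → ℝ}

lemma zero (h : Nm F) : F 0 = 0 := by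
  have := h.hom 0 0 le_rfl
  simpa using this

lemma nonneg (h : Nm F) (x : V) : 0 ≤ F x := by
  by_cases hx : x = 0
  · rw [hx, h.zero]
  · exact (h.pos x hx).le

lemma sub (h : Nm F) (x y : V) : F (x + y) ≤ F x + F y := by
  have := h.conv.2 (Set.mem_univ ((2:ℝ) • x)) (Set.mem_univ ((2:ℝ) • y))
    (show (0:ℝ) ≤ 1/2 by norm_num) (show (0:ℝ) ≤ 1/2 by norm_num) (by norm_num)
  rw [smul_smul, smul_smul, h.hom _ _ (by norm_num), h.hom _ _ (by norm_num)] at this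
  norm_num at this
  linarith

lemma continuous [FiniteDimensional ℝ V] (h : Nm F) : Continuous F := by
  have := h.conv.continuousOn isOpen_univ
  exact continuousOn_univ.1 this

lemma upper [FiniteDimensional ℝ V] (h : Nm F) : ∃ C : NNReal, ∀ x, F x ≤ C * ‖x‖ := by
  obtain ⟨M, hM⟩ := (isCompact_sphere (0:V) 1).bddAbove_image h.continuous.continuousOn
  refine ⟨(max M 0).toNNReal, fun x => ?_⟩
  by_cases hx : x = 0
  · simp [hx, h.zero]
  have hn : 0 < ‖x‖ := norm_pos_iff.2 hx
  have h1 : F (‖x‖⁻¹ • x) ≤ M := hM ⟨_, by simp [norm_smul, hn.ne'], rfl⟩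
  rw [h.hom _ _ (by positivity)] at h1
  have h2 : F x ≤ M * ‖x‖ := by
    have := mul_le_mul_of_nonneg_right h1 hn.le
    field_simp at this
    linarith
  rw [Real.coe_toNNReal _ (le_max_right _ _)]
  exact h2.trans (by gcongr; exact le_max_left _ _)

lemma lower [FiniteDimensional ℝ V] (h : Nm F) : ∃ m : ℝ, 0 < m ∧ ∀ x, m * ‖x‖ ≤ F x := by
  rcases (Metric.sphere (0:V) 1).eq_empty_or_nonempty with he | hne
  · refine ⟨1, one_pos, fun x => ?_⟩
    by_cases hx : x = 0
    · simp [hx, h.zero]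
    have hn : 0 < ‖x‖ := norm_pos_iff.2 hx
    have : ‖x‖⁻¹ • x ∈ Metric.sphere (0:V) 1 := by simp [norm_smul, hn.ne']
    rw [he] at this
    exact this.elim
  obtain ⟨z, hz, hmin⟩ := (isCompact_sphere (0:V) 1).exists_isMinOn hne h.continuous.continuousOn
  refine ⟨F z, h.pos z (by rintro rfl; simp at hz), fun x => ?_⟩
  by_cases hx : x = 0
  · simp [hx, h.zero]
  have hn : 0 < ‖x‖ := norm_pos_iff.2 hx
  have h1 : F z ≤ F (‖x‖⁻¹ • x) := hmin (show ‖x‖⁻¹ • x ∈ Metric.sphere (0:V) 1 by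
    simp [norm_smul, hn.ne'])
  rw [h.hom _ _ (by positivity)] at h1
  have := mul_le_mul_of_nonneg_right h1 hn.le
  field_simp at this
  linarith

lemma lipschitz [FiniteDimensional ℝ V] (h : Nm F) : ∃ C : NNReal, LipschitzWith C F := by
  obtain ⟨C, hC⟩ := h.upper
  refine ⟨C, LipschitzWith.of_le_add_mul C fun x y => ?_⟩
  have := h.sub y (x - y)
  rw [add_sub_cancel] at this
  rw [dist_eq_norm]
  linarith [hC (x - y)]

lemma comp_inj {W : Type*} [NormedAddCommGroup W] [NormedSpace ℝ W] (h : Nm F) (T : W →ₗ[ℝ] V)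
    (hT : ∀ x, T x = 0 → x = 0) : Nm (fun x => F (T x)) where
  conv := by
    have := h.conv.comp_linearMap T
    rw [Set.preimage_univ] at this
    exact this
  hom c x hc := by simp [h.hom _ _ hc]
  pos x hx := h.pos _ fun h' => hx (hT x h')

/-- sum of line derivatives -/
lemma ld_add (h : Nm F) {x v w : V} {a b : ℝ} (hv : HasLineDerivAt ℝ F a x v)
    (hw : HasLineDerivAt ℝ F b x w) : HasLineDerivAt ℝ F (a + b) x (v + w) := by
  rw [hasLineDerivAt_iff_isLittleO_nhds_zero] at *
  rw [Asymptotics.isLittleO_iff] at *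
  intro c hc
  have hv' := hv (show (0:ℝ) < c/2 by positivity)
  have hw' := hw (show (0:ℝ) < c/2 by positivity)
  have t2 : Tendsto (fun t : ℝ => 2 * t) (𝓝 0) (𝓝 0) := by
    have : Continuous (fun t : ℝ => 2 * t) := by fun_prop
    simpa using this.tendsto 0
  have t3 : Tendsto (fun t : ℝ => -2 * t) (𝓝 0) (𝓝 0) := by
    have : Continuous (fun t : ℝ => -2 * t) := by fun_prop
    simpa using this.tendsto 0
  filter_upwards [t2.eventually hv', t2.eventually hw', t3.eventually hv', t3.eventually hw']
    with t h1 h2 h3 h4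
  have cv : ∀ p q : V, F ((1/2:ℝ) • p + (1/2:ℝ) • q) ≤ 1/2 * F p + 1/2 * F q := fun p q => by
    have := h.conv.2 (Set.mem_univ p) (Set.mem_univ q)
      (show (0:ℝ) ≤ 1/2 by norm_num) (show (0:ℝ) ≤ 1/2 by norm_num) (by norm_num)
    simpa using this
  have e1 := cv (x + (2 * t) • v) (x + (2 * t) • w)
  have e2 := cv (x + (-2 * t) • v) (x + (-2 * t) • w)
  have e3 := cv (x + t • (v + w)) (x + (-t) • (v + w))
  rw [show (1/2:ℝ) • (x + (2 * t) • v) + (1/2:ℝ) • (x + (2 * t) • w) = x + t • (v + w) by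
    module] at e1
  rw [show (1/2:ℝ) • (x + (-2 * t) • v) + (1/2:ℝ) • (x + (-2 * t) • w) = x + (-t) • (v + w) by
    module] at e2
  rw [show (1/2:ℝ) • (x + t • (v + w)) + (1/2:ℝ) • (x + (-t) • (v + w)) = x by module] at e3
  simp only [smul_eq_mul, Real.norm_eq_abs] at h1 h2 h3 h4 ⊢
  rw [abs_mul (2:ℝ), abs_two] at h1 h2
  rw [abs_mul (-2:ℝ), abs_neg, abs_two] at h3 h4
  rw [abs_le] at h1 h2 h3 h4 ⊢
  constructor <;> linarith [h1.1, h1.2, h2.1, h2.2, h3.1, h3.2, h4.1, h4.2]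

lemma ld_smul {x v : V} {a : ℝ} (c : ℝ) (hv : HasLineDerivAt ℝ F a x v) :
    HasLineDerivAt ℝ F (c * a) x (c • v) := by
  simpa using hv.smul c

lemma ld_self (h : Nm F) (x : V) : HasLineDerivAt ℝ F (F x) x x := by
  unfold HasLineDerivAt
  have : (fun t : ℝ => F (x + t • x)) =ᶠ[𝓝 0] fun t => (1 + t) * F x := by
    filter_upwards [lt_mem_nhds (show (-1:ℝ) < 0 by norm_num)] with t ht
    rw [← h.hom _ _ (by linarith)]
    congr 1
    module
  refine HasDerivAt.congr_of_eventuallyEq ?_ this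
  simpa using ((hasDerivAt_id (0:ℝ)).const_add 1).mul_const (F x)

lemma add0 (h : Nm F) {x v w : V} (hv : HasLineDerivAt ℝ F 0 x v)
    (hw : HasLineDerivAt ℝ F 0 x w) : HasLineDerivAt ℝ F 0 x (v + w) := by
  simpa using h.ld_add hv hw

lemma smul0 {x v : V} (c : ℝ) (hv : HasLineDerivAt ℝ F 0 x v) :
    HasLineDerivAt ℝ F 0 x (c • v) := by
  simpa using ld_smul c hv

lemma zero0 (x : V) : HasLineDerivAt ℝ F 0 x 0 := by
  unfold HasLineDerivAt
  simpa using hasDerivAt_const (0:ℝ) (F x)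

lemma not_self (h : Nm F) {x : V} (hx : x ≠ 0) {c : ℝ} (hh : HasLineDerivAt ℝ F 0 x (c • x)) :
    c = 0 := by
  have := ld_smul c (h.ld_self x)
  have e := HasDerivAt.unique this hh
  have := (h.pos x hx).ne'
  aesop

/-- chain rule along a curve -/
lemma curve [FiniteDimensional ℝ V] (h : Nm F) {γ : ℝ → V} {v : V} {t : ℝ}
    (hγ : HasDerivAt γ v t) (hv : HasLineDerivAt ℝ F 0 (γ t) v) :
    HasDerivAt (fun s => F (γ s)) 0 t := by
  obtain ⟨C, hC⟩ := h.lipschitz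
  rw [hasDerivAt_iff_isLittleO_nhds_zero] at hγ ⊢
  rw [hasLineDerivAt_iff_isLittleO_nhds_zero] at hv
  have h1 : (fun s => F (γ (t + s)) - F (γ t + s • v)) =o[𝓝 0] fun s : ℝ => s := by
    refine Asymptotics.IsBigO.trans_isLittleO (g := fun s => γ (t + s) - γ t - s • v) ?_ hγ
    refine Asymptotics.IsBigO.of_bound C (Eventually.of_forall fun s => ?_)
    have := hC.dist_le_mul (γ (t + s)) (γ t + s • v)
    rw [dist_eq_norm, dist_eq_norm] at this
    rwa [sub_sub]
  have := h1.add hv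
  refine this.congr_left fun s => ?_
  simp

/-- if a continuous function has zero derivative off isolated points, it is constant -/
lemma const_of_isolated {g : ℝ → ℝ} (hg : Continuous g)
    (h : ∀ t, ∀ᶠ s in 𝓝[≠] t, HasDerivAt g 0 s) (s t : ℝ) : g s = g t := by
  have key : ∀ t, HasDerivAt g 0 t := by
    intro t
    have hr : ∀ᶠ s in 𝓝[>] t, HasDerivAt g 0 s := (h t).filter_mono (nhdsWithin_mono _ (by
      intro x hx; exact ne_of_gt hx))
    have hl : ∀ᶠ s in 𝓝[<] t, HasDerivAt g 0 s := (h t).filter_mono (nhdsWithin_mono _ (by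
      intro x hx; exact ne_of_lt hx))
    have A : HasDerivWithinAt g 0 (Set.Ici t) t := by
      refine hasDerivWithinAt_Ici_of_tendsto_deriv (s := {s | HasDerivAt g 0 s})
        (fun s hs => hs.differentiableAt.differentiableWithinAt) hg.continuousWithinAt hr ?_
      refine tendsto_const_nhds.congr' ?_
      filter_upwards [hr] with s hs using hs.deriv.symm
    have B : HasDerivWithinAt g 0 (Set.Iic t) t := by
      refine hasDerivWithinAt_Iic_of_tendsto_deriv (s := {s | HasDerivAt g 0 s})
        (fun s hs => hs.differentiableAt.differentiableWithinAt) hg.continuousWithinAt hl ?_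
      refine tendsto_const_nhds.congr' ?_
      filter_upwards [hl] with s hs using hs.deriv.symm
    have := B.union A
    rwa [Set.Iic_union_Ici, hasDerivWithinAt_univ] at this
  exact is_const_of_deriv_eq_zero (fun t => (key t).differentiableAt) (fun t => (key t).deriv) s t

lemma curve_const [FiniteDimensional ℝ V] (h : Nm F) {γ γ' : ℝ → V} {z : ℝ → ℝ}
    (hγ : ∀ t, HasDerivAt γ (γ' t) t) (hz : ∀ t, AnalyticAt ℝ z t) (t0 : ℝ) (hz0 : z t0 ≠ 0)
    (hv : ∀ t, z t ≠ 0 → HasLineDerivAt ℝ F 0 (γ t) (γ' t)) (s t : ℝ) : F (γ s) = F (γ t) := by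
  refine const_of_isolated (g := fun s => F (γ s))
    (h.continuous.comp (continuous_iff_continuousAt.2 fun t => (hγ t).continuousAt)) ?_ s t
  intro t
  have : ∀ᶠ s in 𝓝[≠] t, z s ≠ 0 := by
    rcases (hz t).eventually_eq_zero_or_eventually_ne_zero with h1 | h1
    · exfalso
      have : AnalyticOnNhd ℝ z Set.univ := fun t _ => hz t
      have := this.eqOn_zero_of_preconnected_of_eventuallyEq_zero isPreconnected_univ
        (Set.mem_univ t) h1
      exact hz0 (this (Set.mem_univ t0))
    · exact h1
  filter_upwards [this] with s hs using h.curve (hγ s) (hv s hs)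

/-- constant direction is impossible -/
lemma line_absurd [FiniteDimensional ℝ V] (h : Nm F) {x v : V} (hv0 : v ≠ 0) {z : ℝ → ℝ}
    (hz : ∀ t, AnalyticAt ℝ z t) (t0 : ℝ) (hz0 : z t0 ≠ 0)
    (hv : ∀ t, z t ≠ 0 → HasLineDerivAt ℝ F 0 (x + t • v) v) : False := by
  have hc := h.curve_const (γ := fun t => x + t • v) (γ' := fun _ => v)
    (fun t => by simpa using ((hasDerivAt_id t).smul_const v).const_add x) hz t0 hz0 hv
  obtain ⟨m, hm, hl⟩ := h.lower
  have hn : 0 < ‖v‖ := norm_pos_iff.2 hv0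
  set t : ℝ := (‖x‖ + F x / m + 1) / ‖v‖
  have h0 : 0 ≤ t := by have := h.nonneg x; positivity
  have h1 : F (x + t • v) = F x := by have := hc t 0; simpa using this
  have h2 := hl (x + t • v)
  have h3 : ‖t • v‖ ≤ ‖x + t • v‖ + ‖x‖ := by
    have := norm_sub_le (x + t • v) x
    simpa using this
  rw [norm_smul, Real.norm_of_nonneg h0] at h3
  have h4 : t * ‖v‖ = ‖x‖ + F x / m + 1 := by simp only [t]; field_simp
  rw [h1] at h2
  have h5 : F x / m + 1 ≤ ‖x + t • v‖ := by linarith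
  have h6 := mul_le_mul_of_nonneg_left h5 hm.le
  have h7 : m * (F x / m + 1) = F x + m := by field_simp
  linarith

end Nm

namespace Nm
variable {V : Type*} [NormedAddCommGroup V] [NormedSpace ℝ V] {F : V → ℝ}

lemma traj [FiniteDimensional ℝ V] (M : V →L[ℝ] V) : ∃ φ : ℝ → V →L[ℝ] V, φ 0 = 1 ∧
    (∀ x t, HasDerivAt (fun t => φ t x) (M (φ t x)) t) ∧
    (∀ x t, AnalyticAt ℝ (fun t => φ t x) t) := by
  have : CompleteSpace V := FiniteDimensional.complete ℝ V
  refine ⟨fun t => NormedSpace.exp (t • M), by simp, fun x t => ?_, fun x t => ?_⟩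
  · have := hasDerivAt_exp_smul_const' (𝕂 := ℝ) M t
    have h2 := ((ContinuousLinearMap.apply ℝ V x).hasFDerivAt
      (x := NormedSpace.exp (t • M))).comp_hasDerivAt t this
    exact h2
  · have h1 : AnalyticAt ℝ (fun y : V →L[ℝ] V => NormedSpace.exp y) (t • M) :=
      NormedSpace.exp_analytic (𝕂 := ℝ) _
    have h2 : AnalyticAt ℝ (fun t : ℝ => t • M) t := by fun_prop
    have h3 : AnalyticAt ℝ (fun t : ℝ => NormedSpace.exp (t • M)) t := AnalyticAt.comp (g := fun y : V →L[ℝ] V => NormedSpace.exp y) (f := fun t : ℝ => t • M) h1 h2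
    exact ((ContinuousLinearMap.apply ℝ V x).analyticAt _).fun_comp h3

lemma flow [FiniteDimensional ℝ V] (h : Nm F) (M : V →L[ℝ] V) {Z : V → ℝ}
    (hZ : ∀ x, AnalyticAt ℝ Z x) {x0 : V} (hZ0 : Z x0 ≠ 0)
    (hv : ∀ x, Z x ≠ 0 → HasLineDerivAt ℝ F 0 x (M x)) :
    ∃ φ : ℝ → V →L[ℝ] V, φ 0 = 1 ∧ (∀ x t, HasDerivAt (fun t => φ t x) (M (φ t x)) t) ∧
      ∀ x t, F (φ t x) = F x := by
  obtain ⟨φ, h0, hd, ha⟩ := traj M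
  refine ⟨φ, h0, hd, ?_⟩
  have key : ∀ x t, Z x ≠ 0 → F (φ t x) = F x := by
    intro x t hx
    have := h.curve_const (γ := fun t => φ t x) (γ' := fun t => M (φ t x))
      (z := fun t => Z (φ t x)) (fun t => hd x t)
      (fun t => (hZ _).fun_comp (ha x t)) 0 (by simpa [h0] using hx) (fun t ht => hv _ ht) t 0
    simpa [h0] using this
  intro x t
  have hz : ∀ s, AnalyticAt ℝ (fun s : ℝ => Z (x + s • (x0 - x))) s := fun s =>
    (hZ _).fun_comp (by fun_prop)
  have hne : ∀ᶠ s in 𝓝[≠] (0:ℝ), Z (x + s • (x0 - x)) ≠ 0 := by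
    rcases (hz 0).eventually_eq_zero_or_eventually_ne_zero with h1 | h1
    · exfalso
      have : AnalyticOnNhd ℝ (fun s : ℝ => Z (x + s • (x0 - x))) Set.univ := fun t _ => hz t
      have := this.eqOn_zero_of_preconnected_of_eventuallyEq_zero isPreconnected_univ
        (Set.mem_univ 0) h1
      exact hZ0 (by simpa using this (Set.mem_univ 1))
    · exact h1
  have hc : Continuous F := h.continuous
  have t1 : Tendsto (fun s : ℝ => F (φ t (x + s • (x0 - x)))) (𝓝[≠] 0) (𝓝 (F (φ t x))) := by
    have : Continuous (fun s : ℝ => F (φ t (x + s • (x0 - x)))) := by fun_prop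
    have := (this.tendsto 0).mono_left (nhdsWithin_le_nhds (s := {0}ᶜ))
    simpa using this
  have t2 : Tendsto (fun s : ℝ => F (x + s • (x0 - x))) (𝓝[≠] 0) (𝓝 (F x)) := by
    have : Continuous (fun s : ℝ => F (x + s • (x0 - x))) := by fun_prop
    have := (this.tendsto 0).mono_left (nhdsWithin_le_nhds (s := {0}ᶜ))
    simpa using this
  refine tendsto_nhds_unique t1 (t2.congr' ?_)
  filter_upwards [hne] with s hs using (key _ t hs).symm

/-- generic tangency of a linear field implies tangency everywhere -/
lemma everywhere [FiniteDimensional ℝ V] (h : Nm F) (M : V →L[ℝ] V) {Z : V → ℝ}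
    (hZ : ∀ x, AnalyticAt ℝ Z x) {x0 : V} (hZ0 : Z x0 ≠ 0)
    (hv : ∀ x, Z x ≠ 0 → HasLineDerivAt ℝ F 0 x (M x)) (x : V) :
    HasLineDerivAt ℝ F 0 x (M x) := by
  obtain ⟨φ, h0, hd, hc⟩ := h.flow M hZ hZ0 hv
  obtain ⟨C, hC⟩ := h.lipschitz
  have hγ := hd x 0
  rw [h0] at hγ
  rw [hasDerivAt_iff_isLittleO_nhds_zero] at hγ
  rw [hasLineDerivAt_iff_isLittleO_nhds_zero]
  refine Asymptotics.IsBigO.trans_isLittleO (g := fun s => φ (0 + s) x - φ 0 x - s • M x) ?_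
    (by simpa [h0] using hγ)
  refine Asymptotics.IsBigO.of_bound C (Eventually.of_forall fun s => ?_)
  have := hC.dist_le_mul (x + s • M x) (φ s x)
  rw [dist_eq_norm, dist_eq_norm, hc] at this
  simp only [zero_add, h0, smul_zero, sub_zero, one_apply_eq_self]
  refine this.trans (le_of_eq ?_)
  rw [norm_sub_rev (x + s • M x), sub_sub]

end Nm

/-- bounded exponential solution -/
lemma exp_bdd {W : ℝ → ℝ} {τ C : ℝ} (hW : ∀ t, HasDerivAt W (τ * W t) t) (h0 : W 0 ≠ 0)
    (hb : ∀ t, |W t| ≤ C) : τ = 0 := by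
  have hd : ∀ t, HasDerivAt (fun t => W t * Real.exp (-(τ * t))) 0 t := by
    intro t
    have h1 : HasDerivAt (fun t => Real.exp (-(τ * t))) (Real.exp (-(τ * t)) * (-(τ * 1))) t :=
      (((hasDerivAt_id t).const_mul τ).neg).exp
    refine ((hW t).mul h1).congr_deriv ?_
    ring
  have hcst : ∀ t, W t * Real.exp (-(τ * t)) = W 0 := by
    intro t
    have := is_const_of_deriv_eq_zero (fun t => (hd t).differentiableAt) (fun t => (hd t).deriv) t 0
    simpa using this
  by_contra hτ
  have hp : 0 < |W 0| := abs_pos.2 h0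
  have h1 := hcst ((C + 1) / |W 0| / τ)
  have h2 : τ * ((C + 1) / |W 0| / τ) = (C + 1) / |W 0| := by field_simp
  rw [h2] at h1
  have hC : 0 ≤ C := (abs_nonneg _).trans (hb 0)
  have h3 : |W 0| ≤ C * Real.exp (-((C + 1) / |W 0|)) := by
    calc |W 0| = |W ((C + 1) / |W 0| / τ)| * Real.exp (-((C + 1) / |W 0|)) := by
          rw [← Real.abs_exp (-((C + 1) / |W 0|)), ← abs_mul, h1]
      _ ≤ _ := by gcongr; exact hb _
  rw [Real.exp_neg] at h3
  have h4 : (C + 1) / |W 0| + 1 ≤ Real.exp ((C + 1) / |W 0|) := Real.add_one_le_exp _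
  have h5 : 0 < Real.exp ((C + 1) / |W 0|) := Real.exp_pos _
  have h6 : |W 0| * Real.exp ((C + 1) / |W 0|) ≤ C := by
    have := mul_le_mul_of_nonneg_right h3 h5.le
    rwa [mul_assoc, inv_mul_cancel₀ h5.ne', mul_one] at this
  have h7 : |W 0| * ((C + 1) / |W 0| + 1) = C + 1 + |W 0| := by field_simp
  nlinarith

/-- bound for trajectories -/
lemma Nm.bdd {V : Type*} [NormedAddCommGroup V] [NormedSpace ℝ V] [FiniteDimensional ℝ V]
    {F : V → ℝ} (h : Nm F) (c : ℝ) : ∃ B : ℝ, 0 ≤ B ∧ ∀ x, F x ≤ c → ‖x‖ ≤ B := by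
  obtain ⟨m, hm, hl⟩ := h.lower
  refine ⟨|c| / m, by positivity, fun x hx => ?_⟩
  rw [le_div_iff₀ hm]
  have := hl x
  have := le_abs_self c
  linarith

abbrev E3 := ℝ × ℝ × ℝ

lemma Nm.trace3 {F : E3 → ℝ} (h : Nm F) (M : E3 →L[ℝ] E3)
    (hv : ∀ x, HasLineDerivAt ℝ F 0 x (M x)) :
    (M (1,0,0)).1 + (M (0,1,0)).2.1 + (M (0,0,1)).2.2 = 0 := by
  obtain ⟨φ, h0, hd, hc⟩ := h.flow M (Z := fun _ => 1) (fun x => analyticAt_const) (x0 := 0)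
    one_ne_zero (fun x _ => hv x)
  have hM : ∀ a b c : ℝ, M (a, b, c) = a • M (1,0,0) + b • M (0,1,0) + c • M (0,0,1) := by
    intro a b c
    rw [← map_smul, ← map_smul, ← map_smul, ← map_add, ← map_add]
    simp
  have hcoord : ∀ x t, HasDerivAt (fun t => (φ t x).1) (M (φ t x)).1 t ∧
      HasDerivAt (fun t => (φ t x).2.1) (M (φ t x)).2.1 t ∧
      HasDerivAt (fun t => (φ t x).2.2) (M (φ t x)).2.2 t := by
    intro x t
    have := hd x t
    have h1 := (hasFDerivAt_fst (𝕜 := ℝ) (p := φ t x)).comp_hasDerivAt t this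
    have h2 := (hasFDerivAt_snd (𝕜 := ℝ) (p := φ t x)).comp_hasDerivAt t this
    have h3 := (hasFDerivAt_fst (𝕜 := ℝ) (p := (φ t x).2)).comp_hasDerivAt t h2
    have h4 := (hasFDerivAt_snd (𝕜 := ℝ) (p := (φ t x).2)).comp_hasDerivAt t h2
    exact ⟨h1, h3, h4⟩
  obtain ⟨B1, hB1, hb1⟩ := h.bdd (F (1,0,0))
  obtain ⟨B2, hB2, hb2⟩ := h.bdd (F (0,1,0))
  obtain ⟨B3, hB3, hb3⟩ := h.bdd (F (0,0,1))
  set u := fun t => φ t (1,0,0) with hu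
  set v := fun t => φ t (0,1,0) with hv'
  set w := fun t => φ t (0,0,1) with hw
  have nb : ∀ x : E3, |x.1| ≤ ‖x‖ ∧ |x.2.1| ≤ ‖x‖ ∧ |x.2.2| ≤ ‖x‖ := fun x =>
    ⟨norm_fst_le x, (norm_fst_le x.2).trans (norm_snd_le x), (norm_snd_le x.2).trans (norm_snd_le x)⟩
  refine exp_bdd (W := fun t => (u t).1 * ((v t).2.1 * (w t).2.2 - (v t).2.2 * (w t).2.1)
    - (u t).2.1 * ((v t).1 * (w t).2.2 - (v t).2.2 * (w t).1)
    + (u t).2.2 * ((v t).1 * (w t).2.1 - (v t).2.1 * (w t).1)) (C := 6 * (B1 * B2 * B3))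
    (fun t => ?_) (by simp [hu, hv', hw, h0]) (fun t => ?_)
  · obtain ⟨u1, u2, u3⟩ := hcoord (1,0,0) t
    obtain ⟨v1, v2, v3⟩ := hcoord (0,1,0) t
    obtain ⟨w1, w2, w3⟩ := hcoord (0,0,1) t
    have := ((u1.mul ((v2.mul w3).sub (v3.mul w2))).sub (u2.mul ((v1.mul w3).sub (v3.mul w1)))).add
      (u3.mul ((v1.mul w2).sub (v2.mul w1)))
    refine this.congr_deriv ?_
    have eu : M (φ t (1,0,0)) = _ := hM (φ t (1,0,0)).1 (φ t (1,0,0)).2.1 (φ t (1,0,0)).2.2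
    have ev : M (φ t (0,1,0)) = _ := hM (φ t (0,1,0)).1 (φ t (0,1,0)).2.1 (φ t (0,1,0)).2.2
    have ew : M (φ t (0,0,1)) = _ := hM (φ t (0,0,1)).1 (φ t (0,0,1)).2.1 (φ t (0,0,1)).2.2
    rw [eu, ev, ew]
    simp only [hu, hv', hw, Pi.mul_apply, Pi.sub_apply, Prod.fst_add, Prod.snd_add, Prod.smul_fst, Prod.smul_snd, smul_eq_mul]
    ring
  · obtain ⟨u1, u2, u3⟩ := nb (u t)
    obtain ⟨v1, v2, v3⟩ := nb (v t)
    obtain ⟨w1, w2, w3⟩ := nb (w t)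
    have hu' := hb1 (u t) (hc _ t).le
    have hv'' := hb2 (v t) (hc _ t).le
    have hw' := hb3 (w t) (hc _ t).le
    have p : ∀ a b c : ℝ, |a| ≤ B1 → |b| ≤ B2 → |c| ≤ B3 → |a * b * c| ≤ B1 * B2 * B3 := by
      intro a b c h1 h2 h3
      rw [abs_mul, abs_mul]
      gcongr
    have q1 := abs_le.1 (p _ _ _ (u1.trans hu') (v2.trans hv'') (w3.trans hw'))
    have q2 := abs_le.1 (p _ _ _ (u1.trans hu') (v3.trans hv'') (w2.trans hw'))
    have q3 := abs_le.1 (p _ _ _ (u2.trans hu') (v1.trans hv'') (w3.trans hw'))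
    have q4 := abs_le.1 (p _ _ _ (u2.trans hu') (v3.trans hv'') (w1.trans hw'))
    have q5 := abs_le.1 (p _ _ _ (u3.trans hu') (v1.trans hv'') (w2.trans hw'))
    have q6 := abs_le.1 (p _ _ _ (u3.trans hu') (v2.trans hv'') (w1.trans hw'))
    rw [abs_le]
    constructor <;> linarith [q1.1, q1.2, q2.1, q2.2, q3.1, q3.2, q4.1, q4.2, q5.1, q5.2, q6.1, q6.2]

abbrev E2 := ℝ × ℝ

def mat2 (α β γ δ : ℝ) : E2 →L[ℝ] E2 :=
  (α • ContinuousLinearMap.fst ℝ ℝ ℝ + γ • ContinuousLinearMap.snd ℝ ℝ ℝ).prod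
    (β • ContinuousLinearMap.fst ℝ ℝ ℝ + δ • ContinuousLinearMap.snd ℝ ℝ ℝ)

lemma mat2_apply (α β γ δ : ℝ) (x : E2) :
    mat2 α β γ δ x = (α * x.1 + γ * x.2, β * x.1 + δ * x.2) := by
  simp [mat2]

lemma Nm.planar {F : E2 → ℝ} (h : Nm F) {α β γ δ : ℝ}
    (hv : ∀ s t, HasLineDerivAt ℝ F 0 (s, t) (α * s + γ * t, β * s + δ * t)) :
    α + δ = 0 ∧ (0 < α * δ - β * γ ∨ (α = 0 ∧ β = 0 ∧ γ = 0 ∧ δ = 0)) := by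
  have htr : α + δ = 0 := by
    obtain ⟨φ, h0, hd, hc⟩ := h.flow (mat2 α β γ δ) (Z := fun _ => 1)
      (fun x => analyticAt_const) (x0 := 0)
      one_ne_zero (fun x _ => by rw [mat2_apply]; exact hv _ _)
    have hcoord : ∀ x t, HasDerivAt (fun t => (φ t x).1) (α * (φ t x).1 + γ * (φ t x).2) t ∧
        HasDerivAt (fun t => (φ t x).2) (β * (φ t x).1 + δ * (φ t x).2) t := by
      intro x t
      have := hd x t
      rw [mat2_apply] at this
      have h1 := (hasFDerivAt_fst (𝕜 := ℝ) (p := φ t x)).comp_hasDerivAt t this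
      have h2 := (hasFDerivAt_snd (𝕜 := ℝ) (p := φ t x)).comp_hasDerivAt t this
      exact ⟨h1, h2⟩
    obtain ⟨B1, hB1, hb1⟩ := h.bdd (F (1,0))
    obtain ⟨B2, hB2, hb2⟩ := h.bdd (F (0,1))
    set u := fun t => φ t (1,0) with hu
    set v := fun t => φ t (0,1) with hv'
    refine exp_bdd (W := fun t => (u t).1 * (v t).2 - (u t).2 * (v t).1) (C := 2 * (B1 * B2))
      (fun t => ?_) (by simp [hu, hv', h0]) (fun t => ?_)
    · obtain ⟨u1, u2⟩ := hcoord (1,0) t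
      obtain ⟨v1, v2⟩ := hcoord (0,1) t
      refine ((u1.mul v2).sub (u2.mul v1)).congr_deriv ?_
      simp only [hu, hv']
      ring
    · have hu' := hb1 (u t) (hc _ t).le
      have hv'' := hb2 (v t) (hc _ t).le
      have p : ∀ a b : ℝ, |a| ≤ B1 → |b| ≤ B2 → |a * b| ≤ B1 * B2 := by
        intro a b h1 h2
        rw [abs_mul]
        gcongr
      have q1 := abs_le.1 (p _ _ ((norm_fst_le (u t)).trans hu') ((norm_snd_le (v t)).trans hv''))
      have q2 := abs_le.1 (p _ _ ((norm_snd_le (u t)).trans hu') ((norm_fst_le (v t)).trans hv''))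
      rw [abs_le]
      constructor <;> linarith [q1.1, q1.2, q2.1, q2.2]
  refine ⟨htr, ?_⟩
  by_contra hcon
  push Not at hcon
  obtain ⟨hdet, hne⟩ := hcon
  obtain rfl : δ = -α := by linarith
  rcases hdet.lt_or_eq with hlt | heq
  · set r := Real.sqrt (α * α + β * γ) with hr
    have hr2 : r * r = α * α + β * γ := Real.mul_self_sqrt (by nlinarith)
    have hr0 : r ≠ 0 := by
      intro h0
      rw [h0] at hr2
      nlinarith
    have key : ∀ s t : ℝ, α * s + γ * t = r * s → β * s + -α * t = r * t → s = 0 ∧ t = 0 := by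
      intro s t h1 h2
      by_contra hst
      have := hv s t
      rw [h1, h2] at this
      apply hr0
      refine h.not_self (x := (s, t)) (fun h' => hst ?_) (c := r) (by simpa using this)
      simpa using h'
    by_cases hβ : β = 0
    · subst hβ
      rcases mul_self_eq_mul_self_iff.1 (show r * r = α * α by linarith) with h1 | h1
      · have := key 1 0 (by rw [h1]; ring) (by ring)
        simp at this
      · by_cases hγ : γ = 0
        · have := key 0 1 (by rw [hγ]; ring) (by rw [h1]; ring)
          simp at this
        · have := key γ (r - α) (by ring) (by rw [h1]; ring)
          exact hγ this.1
    · have := key (r + α) β (by linarith) (by ring)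
      exact hβ this.2
  · have key : ∀ s t : ℝ, α * s + γ * t = 0 ∧ β * s - α * t = 0 := by
      intro s t
      by_contra hst
      refine h.line_absurd (x := (s, t)) (v := (α * s + γ * t, β * s + -α * t)) ?_ (z := fun _ => 1)
        (fun _ => analyticAt_const) 0 one_ne_zero ?_
      · intro h'
        apply hst
        rw [Prod.mk_eq_zero] at h'
        exact ⟨h'.1, by linarith [h'.2]⟩
      · intro τ _
        have := hv (s + τ * (α * s + γ * t)) (t + τ * (β * s + -α * t))
        refine ld_congr this ?_ ?_
        · simp
        · ext
          · simp only
            linear_combination (-τ * s) * heq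
          · simp only
            linear_combination (-τ * t) * heq
    have k1 := key 1 0
    have k2 := key 0 1
    simp at k1 k2
    exact hne k1.1 k1.2 k2.1 (by linarith [k1.1])

lemma exp_const {g : ℝ → ℂ} (hg : Continuous g) (h : ∀ t, Complex.exp (g t) = Complex.exp (g 0))
    (t : ℝ) : g t = g 0 := by
  have h' : ∀ t, ∃ n : ℤ, g t = g 0 + n * (2 * Real.pi * Complex.I) := fun t =>
    Complex.exp_eq_exp_iff_exists_int.1 (h t)
  choose n hn using h'
  have him : ∀ t, (n t : ℝ) = (g t - g 0).im / (2 * Real.pi) := by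
    intro t
    rw [hn t]
    have := Real.pi_ne_zero
    simp
    try field_simp
  have hc : Continuous n := by
    rw [Int.isClosedEmbedding_coe_real.isEmbedding.continuous_iff]
    have : ((↑) : ℤ → ℝ) ∘ n = fun t => (g t - g 0).im / (2 * Real.pi) := funext him
    rw [this]
    have : Continuous fun t => (g t - g 0).im := Complex.continuous_im.comp (hg.sub continuous_const)
    fun_prop
  have e : n t = n 0 := PreconnectedSpace.constant inferInstance hc
  rw [hn t, e, ← hn 0]

lemma hairy (q1 q2 q3 : ℝ × ℝ × ℝ → ℝ) (c1 : Continuous q1) (c2 : Continuous q2)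
    (c3 : Continuous q3) (s1 : ∀ x, q1 (-x) = q1 x) (s2 : ∀ x, q2 (-x) = q2 x)
    (s3 : ∀ x, q3 (-x) = q3 x) :
    ∃ l : ℝ × ℝ × ℝ, l ≠ 0 ∧ ∃ c : ℝ, q1 l = c * l.1 ∧ q2 l = c * l.2.1 ∧ q3 l = c * l.2.2 := by
  by_contra hcon
  push Not at hcon
  let lam : ℝ × ℝ → ℝ × ℝ × ℝ := fun p =>
    (Real.cos p.1 * Real.cos p.2, Real.sin p.1 * Real.cos p.2, Real.sin p.2)
  have hlam : Continuous lam := by fun_prop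
  let vp : ℝ × ℝ → ℝ := fun p => -(Real.cos p.1 * Real.sin p.2) * q1 (lam p)
    - Real.sin p.1 * Real.sin p.2 * q2 (lam p) + Real.cos p.2 * q3 (lam p)
  let vt : ℝ × ℝ → ℝ := fun p => -Real.sin p.1 * q1 (lam p) + Real.cos p.1 * q2 (lam p)
  have hvp : Continuous vp := by fun_prop
  have hvt : Continuous vt := by fun_prop
  let U : ℝ × ℝ → ℂ := fun p => ⟨-vp p, vt p⟩
  have hU : Continuous U := by
    have : U = fun p => ((-vp p : ℝ) : ℂ) + (vt p : ℝ) * Complex.I := by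
      funext p
      exact Complex.mk_eq_add_mul_I _ _
    rw [this]
    fun_prop
  have hne : ∀ p, U p ≠ 0 := by
    intro p hp
    have h1 : -vp p = 0 := congrArg Complex.re hp
    have h2 : vt p = 0 := congrArg Complex.im hp
    have a1 := Real.sin_sq_add_cos_sq p.1
    have a2 := Real.sin_sq_add_cos_sq p.2
    refine hcon (lam p) ?_ (Real.cos p.1 * Real.cos p.2 * q1 (lam p)
      + Real.sin p.1 * Real.cos p.2 * q2 (lam p) + Real.sin p.2 * q3 (lam p)) ?_ ?_ ?_
    · intro h
      have e1 : Real.cos p.1 * Real.cos p.2 = 0 := congrArg Prod.fst h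
      have e2 : Real.sin p.1 * Real.cos p.2 = 0 := congrArg (fun x => x.2.1) h
      have e3 : Real.sin p.2 = 0 := congrArg (fun x => x.2.2) h
      nlinarith
    · simp only [vp, vt] at h1 h2
      change q1 (lam p) = _ * (Real.cos p.1 * Real.cos p.2)
      generalize q1 (lam p) = Q1 at *
      generalize q2 (lam p) = Q2 at *
      generalize q3 (lam p) = Q3 at *
      generalize Real.cos p.1 = x at *
      generalize Real.sin p.1 = y at *
      generalize Real.cos p.2 = z at *
      generalize Real.sin p.2 = w at *
      linear_combination (-y) * h2 + (x * w) * h1 - Q1 * a1 - (x * (x * Q1 + y * Q2)) * a2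
    · simp only [vp, vt] at h1 h2
      change q2 (lam p) = _ * (Real.sin p.1 * Real.cos p.2)
      generalize q1 (lam p) = Q1 at *
      generalize q2 (lam p) = Q2 at *
      generalize q3 (lam p) = Q3 at *
      generalize Real.cos p.1 = x at *
      generalize Real.sin p.1 = y at *
      generalize Real.cos p.2 = z at *
      generalize Real.sin p.2 = w at *
      linear_combination (x) * h2 + (y * w) * h1 - Q2 * a1 - (y * (x * Q1 + y * Q2)) * a2
    · simp only [vp, vt] at h1 h2
      change q3 (lam p) = _ * (Real.sin p.2)
      generalize q1 (lam p) = Q1 at *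
      generalize q2 (lam p) = Q2 at *
      generalize q3 (lam p) = Q3 at *
      generalize Real.cos p.1 = x at *
      generalize Real.sin p.1 = y at *
      generalize Real.cos p.2 = z at *
      generalize Real.sin p.2 = w at *
      linear_combination (-z) * h1 - Q3 * a2
  obtain ⟨f, hfc, hf⟩ := Complex.exists_continuousOn_eqOn_exp_comp (U := (Set.univ : Set (ℝ × ℝ)))
    (g := U) (by
      have := (convex_univ (𝕜 := ℝ)).contractibleSpace (Set.univ_nonempty (α := ℝ × ℝ))
      exact (inferInstance : SimplyConnectedSpace (Set.univ : Set (ℝ × ℝ)))) isOpen_univ hU.continuousOn (by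
      rintro ⟨p, -, hp⟩
      exact hne p hp)
  rw [continuousOn_univ] at hfc
  have hf' : ∀ p, Complex.exp (f p) = U p := fun p => hf (Set.mem_univ p)
  -- winding difference is constant
  have hD := exp_const (g := fun φ => f (2 * Real.pi, φ) - f (0, φ)) (by fun_prop) (by
    have : ∀ φ, Complex.exp (f (2 * Real.pi, φ) - f (0, φ)) = 1 := by
      intro φ
      rw [Complex.exp_sub, hf', hf']
      have : U (2 * Real.pi, φ) = U (0, φ) := by simp [U, vp, vt, lam]
      rw [this, div_self (hne _)]
    intro t
    rw [this, this]) (Real.pi / 2)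
  -- at the pole
  have hP := exp_const (g := fun θ => f (θ, Real.pi / 2) + θ * Complex.I) (by fun_prop) (by
    have : ∀ θ : ℝ, Complex.exp (f (θ, Real.pi / 2) + θ * Complex.I) = ⟨q1 (0,0,1), q2 (0,0,1)⟩ := by
      intro θ
      rw [Complex.exp_add, hf', Complex.exp_mul_I]
      have a1 := Real.sin_sq_add_cos_sq θ
      apply Complex.ext
      · simp [U, vp, vt, lam, Complex.cos_ofReal_re, Complex.sin_ofReal_re,
          Complex.cos_ofReal_im, Complex.sin_ofReal_im]
        linear_combination (q1 (0,0,1)) * a1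
      · simp [U, vp, vt, lam, Complex.cos_ofReal_re, Complex.sin_ofReal_re,
          Complex.cos_ofReal_im, Complex.sin_ofReal_im]
        linear_combination (q2 (0,0,1)) * a1
    intro t
    rw [this, this]) (2 * Real.pi)
  -- at the equator
  have hE := exp_const (g := fun θ => f (θ + Real.pi, 0) - (starRingEnd ℂ) (f (θ, 0))) (by fun_prop) (by
    have : ∀ θ : ℝ, Complex.exp (f (θ + Real.pi, 0) - (starRingEnd ℂ) (f (θ, 0))) = 1 := by
      intro θ
      rw [Complex.exp_sub, Complex.exp_conj, hf', hf']
      have e : lam (θ + Real.pi, 0) = - lam (θ, 0) := by simp [lam]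
      have : U (θ + Real.pi, 0) = (starRingEnd ℂ) (U (θ, 0)) := by
        apply Complex.ext
        · simp [U, vp, e, s1, s2, s3]
        · simp [U, vt, e, s1, s2, s3]
          ring
      rw [this, div_self]
      simpa using hne _
    intro t
    rw [this, this]) Real.pi

  have i1 := congrArg Complex.im hD
  have i2 := congrArg Complex.im hP
  have i3 := congrArg Complex.im hE
  rw [← two_mul] at i3
  simp at i1 i2 i3
  have := Real.pi_pos
  linarith

section gaugepart
variable {V : Type*} [NormedAddCommGroup V] [NormedSpace ℝ V] [FiniteDimensional ℝ V] {F : V → ℝ}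

lemma Nm.ld_scale (h : Nm F) {x v : V} (hv : HasLineDerivAt ℝ F 0 x v) {c : ℝ} (hc : 0 ≤ c) :
    HasLineDerivAt ℝ F 0 (c • x) (c • v) := by
  unfold HasLineDerivAt at *
  have : (fun t : ℝ => F (c • x + t • c • v)) = fun t => c * F (x + t • v) := by
    funext t
    rw [← h.hom _ _ hc]
    congr 1
    module
  rw [this]
  simpa using hv.const_mul c

lemma Nm.ld_of_upper (h : Nm F) {x v : V} (h1 : ∀ ε > 0, ∃ T > 0, F (x + T • v) - F x ≤ ε * T)
    (h2 : ∀ ε > 0, ∃ T > 0, F (x + T • (-v)) - F x ≤ ε * T) : HasLineDerivAt ℝ F 0 x v := by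
  have cv : ∀ (p q : V) (a b : ℝ), 0 ≤ a → 0 ≤ b → F (a • p + b • q) ≤ a * F p + b * F q := by
    intro p q a b ha hb
    have := h.sub (a • p) (b • q)
    rwa [h.hom _ _ ha, h.hom _ _ hb] at this
  have key : ∀ v : V, ∀ ε T S : ℝ, 0 < T → 0 < S → F (x + T • v) - F x ≤ ε * T →
      F (x + S • (-v)) - F x ≤ ε * S → ∀ t, 0 ≤ t → t ≤ T → |F (x + t • v) - F x| ≤ ε * t := by
    intro v ε T S hT hS e1 e2 t ht htT
    have a1 := cv x (x + T • v) ((T - t)) t (by linarith) ht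
    have e : (T - t) • x + t • (x + T • v) = T • (x + t • v) := by module
    rw [e, h.hom _ _ hT.le] at a1
    have a2 := cv (x + S • (-v)) (x + t • v) t S ht hS.le
    have e : t • (x + S • (-v)) + S • (x + t • v) = (t + S) • x := by module
    rw [e, h.hom _ _ (by linarith)] at a2
    rw [abs_le]
    constructor
    · have : S * (F (x + t • v) - F x) ≥ S * (-(ε * t)) := by nlinarith
      exact le_of_mul_le_mul_left this hS
    · have : T * (F (x + t • v) - F x) ≤ T * (ε * t) := by nlinarith
      exact le_of_mul_le_mul_left this hT
  rw [hasLineDerivAt_iff_isLittleO_nhds_zero, Asymptotics.isLittleO_iff]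
  intro ε hε
  obtain ⟨T, hT, e1⟩ := h1 ε hε
  obtain ⟨S, hS, e2⟩ := h2 ε hε
  filter_upwards [lt_mem_nhds (show -S < 0 by linarith), gt_mem_nhds hT] with t ht1 ht2
  simp only [smul_zero, sub_zero, Real.norm_eq_abs]
  rcases le_total 0 t with ht | ht
  · have := key v ε T S hT hS e1 e2 t ht ht2.le
    rwa [abs_of_nonneg ht]
  · have := key (-v) ε S T hS hT e2 (by simpa using e1) (-t) (by linarith) (by linarith)
    rw [abs_of_nonpos ht]
    simpa using this

variable {K : Set V}

lemma nm_gauge (hKcomp : IsCompact K) (hKconv : Convex ℝ K) (h0 : (0 : V) ∈ interior K) :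
    Nm (gauge K) where
  conv := by
    have hn : K ∈ 𝓝 (0:V) := mem_interior_iff_mem_nhds.1 h0
    refine ⟨convex_univ, fun x _ y _ a b ha hb _ => ?_⟩
    refine (gauge_add_le hKconv (absorbent_nhds_zero hn) _ _).trans ?_
    rw [gauge_smul_of_nonneg ha, gauge_smul_of_nonneg hb]
  hom c x hc := by rw [gauge_smul_of_nonneg hc, smul_eq_mul]
  pos x hx := by
    have hn : K ∈ 𝓝 (0:V) := mem_interior_iff_mem_nhds.1 h0
    exact (gauge_pos (absorbent_nhds_zero hn)
      ((NormedSpace.isVonNBounded_iff ℝ).2 hKcomp.isBounded)).2 hx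

lemma tangent_iff (hKcomp : IsCompact K) (hKconv : Convex ℝ K) (h0 : (0 : V) ∈ interior K)
    {x v : V} (hx : x ∈ frontier K) :
    IsTangentVec K x v ↔ HasLineDerivAt ℝ (gauge K) 0 x v := by
  have h := nm_gauge hKcomp hKconv h0
  have hn : K ∈ 𝓝 (0:V) := mem_interior_iff_mem_nhds.1 h0
  have hfr : ∀ y, gauge K y = 1 ↔ y ∈ frontier K := fun y => gauge_eq_one_iff_mem_frontier hKconv hn
  have hx1 := (hfr x).2 hx
  constructor
  · have key : ∀ v, IsForwardTangent K x v →
        ∀ ε > 0, ∃ T > 0, gauge K (x + T • v) - gauge K x ≤ ε * T := by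
      rintro v ⟨p, c, hp, hc, -, hlim⟩ ε hε
      have hcont : Continuous (gauge K) := h.continuous
      have t1 : Tendsto (fun i => gauge K (v - c i • (p i - x))) atTop (𝓝 0) := by
        have h1 : Tendsto (fun i => v - c i • (p i - x)) atTop (𝓝 (v - v)) :=
          tendsto_const_nhds.sub hlim
        rw [sub_self] at h1
        have := (hcont.tendsto 0).comp h1
        rwa [h.zero] at this
      obtain ⟨i, hi⟩ := (t1.eventually (gt_mem_nhds hε)).exists
      refine ⟨(c i)⁻¹, inv_pos.2 (hc i), ?_⟩
      have e : x + (c i)⁻¹ • v = p i + (c i)⁻¹ • (v - c i • (p i - x)) := by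
        rw [smul_sub, smul_smul, inv_mul_cancel₀ (hc i).ne']
        module
      have := h.sub (p i) ((c i)⁻¹ • (v - c i • (p i - x)))
      rw [← e, h.hom _ _ (inv_pos.2 (hc i)).le, (hfr _).2 (hp i)] at this
      have h3 : (c i)⁻¹ * gauge K (v - c i • (p i - x)) ≤ (c i)⁻¹ * ε :=
        mul_le_mul_of_nonneg_left hi.le (inv_pos.2 (hc i)).le
      linarith
    rintro ⟨h1, h2⟩
    exact h.ld_of_upper (key v h1) (key (-v) h2)
  · have key : ∀ v, HasLineDerivAt ℝ (gauge K) 0 x v → IsForwardTangent K x v := by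
      intro v hv
      have hx0 : x ≠ 0 := by
        rintro rfl
        rw [h.zero] at hx1
        exact zero_ne_one hx1
      have hcont : Continuous (gauge K) := h.continuous
      -- sequence
      have ht0 : Tendsto (fun i : ℕ => 1 / ((i:ℝ) + 1)) atTop (𝓝 0) :=
        tendsto_one_div_add_atTop_nhds_zero_nat
      have hpt : Tendsto (fun i : ℕ => x + (1 / ((i:ℝ) + 1)) • v) atTop (𝓝 x) := by
        have := (ht0.smul_const v).const_add x
        simpa using this
      have hg : Tendsto (fun i : ℕ => gauge K (x + (1 / ((i:ℝ) + 1)) • v)) atTop (𝓝 1) := by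
        have := (hcont.tendsto x).comp hpt
        rwa [hx1] at this
      obtain ⟨n, hn'⟩ := eventually_atTop.1 (hg.eventually (lt_mem_nhds (show (0:ℝ) < 1 by norm_num)))
      set t : ℕ → ℝ := fun i => 1 / (((i + n : ℕ):ℝ) + 1) with ht
      have htpos : ∀ i, 0 < t i := fun i => by positivity
      have hpos : ∀ i, 0 < gauge K (x + t i • v) := fun i => hn' _ (Nat.le_add_left n i)
      have hpt' : Tendsto (fun i => x + t i • v) atTop (𝓝 x) := (tendsto_add_atTop_iff_nat n).2 hpt
      have hg' : Tendsto (fun i => gauge K (x + t i • v)) atTop (𝓝 1) := (tendsto_add_atTop_iff_nat n).2 hg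
      have ht0' : Tendsto t atTop (𝓝 0) := (tendsto_add_atTop_iff_nat n).2 ht0
      have hinv : Tendsto (fun i => (gauge K (x + t i • v))⁻¹) atTop (𝓝 1) := by
        simpa using hg'.inv₀ one_ne_zero
      refine ⟨fun i => (gauge K (x + t i • v))⁻¹ • (x + t i • v), fun i => (t i)⁻¹, ?_, ?_, ?_, ?_⟩
      · intro i
        rw [← hfr, h.hom _ _ (inv_pos.2 (hpos i)).le, inv_mul_cancel₀ (hpos i).ne']
      · exact fun i => inv_pos.2 (htpos i)
      · simpa using hinv.smul hpt'
      · have hs : Tendsto (fun i => (t i)⁻¹ * (gauge K (x + t i • v) - 1)) atTop (𝓝 0) := by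
          have := hv.tendsto_slope_zero
          have h3 : Tendsto t atTop (𝓝[≠] 0) := tendsto_nhdsWithin_iff.2
            ⟨ht0', Eventually.of_forall fun i => (htpos i).ne'⟩
          have := this.comp h3
          simpa [Function.comp_def, hx1] using this
        have hA : Tendsto (fun i => (gauge K (x + t i • v))⁻¹ • v
            - ((t i)⁻¹ * (gauge K (x + t i • v) - 1) * (gauge K (x + t i • v))⁻¹) • x) atTop
            (𝓝 ((1:ℝ) • v - ((0:ℝ) * 1) • x)) :=
          (hinv.smul_const v).sub ((hs.mul hinv).smul_const x)
        have e : (1:ℝ) • v - ((0:ℝ) * 1) • x = v := by simp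
        rw [e] at hA
        refine hA.congr fun i => ?_
        beta_reduce
        have h1 := (hpos i).ne'
        have h2 := (htpos i).ne'
        generalize gauge K (x + t i • v) = G at *
        generalize t i = τ at *
        match_scalars <;> field_simp <;> try ring
    intro hv
    exact ⟨key v hv, key (-v) (by simpa using Nm.smul0 (-1) hv)⟩

end gaugepart

def det3 (a b c : E3) : ℝ := a.1 * (b.2.1 * c.2.2 - b.2.2 * c.2.1)
  - a.2.1 * (b.1 * c.2.2 - b.2.2 * c.1) + a.2.2 * (b.1 * c.2.1 - b.2.1 * c.1)

lemma cramer3 (v x a b : E3) (h : det3 x a b ≠ 0) :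
    v = (det3 v a b / det3 x a b) • x + (det3 x v b / det3 x a b) • a
      + (det3 x a v / det3 x a b) • b := by
  have key : det3 x a b • v = det3 v a b • x + det3 x v b • a + det3 x a v • b := by
    ext <;> simp [det3] <;> ring
  have h2 : (det3 x a b)⁻¹ • (det3 x a b • v) = v := by rw [smul_smul, inv_mul_cancel₀ h, one_smul]
  rw [key] at h2
  simp only [smul_add, smul_smul, ← div_eq_inv_mul] at h2
  exact h2.symm

/-- if three vectors are dependent, and the last two independent -/
lemma dep3 (x a b : E3) (h : det3 x a b = 0) (hne : ¬ ∀ c, det3 c a b = 0) :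
    ∃ s t : ℝ, x = s • a + t • b := by
  push Not at hne
  obtain ⟨c, hc⟩ := hne
  have := cramer3 x c a b hc
  rw [h] at this
  rw [zero_div, zero_smul, zero_add] at this
  exact ⟨_, _, this⟩

def cross3 (a b : E3) : E3 →L[ℝ] ℝ :=
  (a.2.1 * b.2.2 - a.2.2 * b.2.1) • ContinuousLinearMap.fst ℝ ℝ (ℝ × ℝ)
  - (a.1 * b.2.2 - a.2.2 * b.1) • ((ContinuousLinearMap.fst ℝ ℝ ℝ).comp (ContinuousLinearMap.snd ℝ ℝ (ℝ × ℝ)))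
  + (a.1 * b.2.1 - a.2.1 * b.1) • ((ContinuousLinearMap.snd ℝ ℝ ℝ).comp (ContinuousLinearMap.snd ℝ ℝ (ℝ × ℝ)))

lemma cross3_apply (a b v : E3) : cross3 a b v = det3 v a b := by
  simp [cross3, det3]
  ring

lemma frob {F : E3 → ℝ} (h : Nm F) {w1 w2 : E3 → E3} {D1 D2 : E3 → E3 →L[ℝ] E3}
    (hd1 : ∀ x, HasFDerivAt w1 (D1 x) x) (hd2 : ∀ x, HasFDerivAt w2 (D2 x) x)
    (h1 : ∀ x, HasLineDerivAt ℝ F 0 x (w1 x)) (h2 : ∀ x, HasLineDerivAt ℝ F 0 x (w2 x))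
    (hw0 : w1 0 = 0) (x : E3) :
    det3 (w1 x) (w2 x) (D2 x (w1 x) - D1 x (w2 x)) = 0 := by
  have cyc : ∀ a b c, det3 a b c = det3 c a b := fun a b c => by simp only [det3]; ring
  by_cases hx0 : x = 0
  · rw [hx0, hw0]
    simp [det3]
  by_cases hΔ : det3 x (w1 x) (w2 x) = 0
  · by_contra hne
    rw [cyc] at hne
    obtain ⟨s, t, hst⟩ := dep3 x (w1 x) (w2 x) hΔ (fun hc => hne (hc _))
    have : HasLineDerivAt ℝ F 0 x ((1:ℝ) • x) := by
      rw [one_smul]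
      have := h.add0 (Nm.smul0 s (h1 x)) (Nm.smul0 t (h2 x))
      rwa [← hst] at this
    exact one_ne_zero (h.not_self hx0 this)
  -- the generic case
  have c1 : Continuous w1 := continuous_iff_continuousAt.2 fun x => (hd1 x).continuousAt
  have c2 : Continuous w2 := continuous_iff_continuousAt.2 fun x => (hd2 x).continuousAt
  have df1 : Differentiable ℝ w1 := fun x => (hd1 x).differentiableAt
  have df2 : Differentiable ℝ w2 := fun x => (hd2 x).differentiableAt
  have cΔ : Continuous fun y => det3 y (w1 y) (w2 y) := by
    unfold det3
    fun_prop
  obtain ⟨C, hC⟩ := h.lipschitz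
  let f' : E3 → E3 →L[ℝ] ℝ := fun y => (F y / det3 y (w1 y) (w2 y)) • cross3 (w1 y) (w2 y)
  have hfd : ∀ y, det3 y (w1 y) (w2 y) ≠ 0 → HasFDerivAt F (f' y) y := by
    intro y hy
    refine hC.hasFDerivAt_of_hasLineDerivAt_of_closure (s := Set.univ) (by simp) fun v _ => ?_
    have e := cramer3 v y (w1 y) (w2 y) hy
    have := h.ld_add (h.ld_add (Nm.ld_smul (det3 v (w1 y) (w2 y) / det3 y (w1 y) (w2 y)) (h.ld_self y))
      (Nm.ld_smul (det3 y v (w2 y) / det3 y (w1 y) (w2 y)) (h1 y)))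
      (Nm.ld_smul (det3 y (w1 y) v / det3 y (w1 y) (w2 y)) (h2 y))
    rw [← e] at this
    have e2 : f' y v = det3 v (w1 y) (w2 y) / det3 y (w1 y) (w2 y) * F y +
      det3 y v (w2 y) / det3 y (w1 y) (w2 y) * 0 + det3 y (w1 y) v / det3 y (w1 y) (w2 y) * 0 := by
      simp only [f', _root_.smul_apply, cross3_apply, smul_eq_mul]
      ring
    rw [e2]
    exact this
  have hev : ∀ᶠ y in 𝓝 x, HasFDerivAt F (f' y) y := by
    filter_upwards [cΔ.continuousAt.eventually_ne hΔ] with y hy using hfd y hy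
  have hdiff : DifferentiableAt ℝ f' x := by
    have dF : DifferentiableAt ℝ F x := (hfd x hΔ).differentiableAt
    have dΔ : DifferentiableAt ℝ (fun y => det3 y (w1 y) (w2 y)) x := by
      unfold det3
      fun_prop
    have dc : DifferentiableAt ℝ (fun y => cross3 (w1 y) (w2 y)) x := by
      unfold cross3
      fun_prop
    have dI : DifferentiableAt ℝ (fun y => (det3 y (w1 y) (w2 y))⁻¹) x := by
      exact (differentiableAt_inv hΔ).comp x dΔ
    have : f' = fun y => (F y * (det3 y (w1 y) (w2 y))⁻¹) • cross3 (w1 y) (w2 y) := by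
      funext y
      simp only [f', div_eq_mul_inv]
    rw [this]
    exact (dF.mul dI).smul dc
  have hsym := second_derivative_symmetric_of_eventually hev hdiff.hasFDerivAt (w1 x) (w2 x)
  have z1 : ∀ y, f' y (w1 y) = 0 := by
    intro y
    simp only [f', _root_.smul_apply, cross3_apply, smul_eq_mul]
    have : det3 (w1 y) (w1 y) (w2 y) = 0 := by simp only [det3]; ring
    rw [this, mul_zero]
  have z2 : ∀ y, f' y (w2 y) = 0 := by
    intro y
    simp only [f', _root_.smul_apply, cross3_apply, smul_eq_mul]
    have : det3 (w2 y) (w1 y) (w2 y) = 0 := by simp only [det3]; ring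
    rw [this, mul_zero]
  have g1 := hdiff.hasFDerivAt.clm_apply (hd1 x)
  have g2 := hdiff.hasFDerivAt.clm_apply (hd2 x)
  have e1 := g1.unique ((hasFDerivAt_const (0:ℝ) x).congr_of_eventuallyEq
    (Eventually.of_forall z1))
  have e2 := g2.unique ((hasFDerivAt_const (0:ℝ) x).congr_of_eventuallyEq
    (Eventually.of_forall z2))
  have e1' := congrArg (fun L : E3 →L[ℝ] ℝ => L (w2 x)) e1
  have e2' := congrArg (fun L : E3 →L[ℝ] ℝ => L (w1 x)) e2
  simp at e1' e2'
  have e3 : f' x (D2 x (w1 x) - D1 x (w2 x)) = 0 := by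
    rw [map_sub]
    linarith
  simp only [f', _root_.smul_apply, cross3_apply, smul_eq_mul] at e3
  rw [cyc]
  rcases mul_eq_zero.1 e3 with h3 | h3
  · exact absurd h3 (div_ne_zero (h.pos x hx0).ne' hΔ)
  · exact h3

structure M3 where
  (a11 a12 a13 a21 a22 a23 a31 a32 a33 : ℝ)

def X1 : E3 →L[ℝ] ℝ := ContinuousLinearMap.fst ℝ ℝ (ℝ × ℝ)
def X2 : E3 →L[ℝ] ℝ := (ContinuousLinearMap.fst ℝ ℝ ℝ).comp (ContinuousLinearMap.snd ℝ ℝ (ℝ × ℝ))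
def X3 : E3 →L[ℝ] ℝ := (ContinuousLinearMap.snd ℝ ℝ ℝ).comp (ContinuousLinearMap.snd ℝ ℝ (ℝ × ℝ))

lemma X1_apply (x : E3) : X1 x = x.1 := rfl
lemma X2_apply (x : E3) : X2 x = x.2.1 := rfl
lemma X3_apply (x : E3) : X3 x = x.2.2 := rfl

/-- the linear map of a matrix -/
def M3.L (m : M3) : E3 →L[ℝ] E3 :=
  (m.a11 • X1 + m.a12 • X2 + m.a13 • X3).prod
    ((m.a21 • X1 + m.a22 • X2 + m.a23 • X3).prod (m.a31 • X1 + m.a32 • X2 + m.a33 • X3))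

lemma M3.L_apply (m : M3) (x : E3) : m.L x =
    (m.a11 * x.1 + m.a12 * x.2.1 + m.a13 * x.2.2, m.a21 * x.1 + m.a22 * x.2.1 + m.a23 * x.2.2,
      m.a31 * x.1 + m.a32 * x.2.1 + m.a33 * x.2.2) := by
  simp [M3.L, X1_apply, X2_apply, X3_apply]

def Jm : M3 := ⟨0, -1, 0, 1, 0, 0, 0, 0, 0⟩

/-- the conditional tangency condition in coordinates -/
def CT (F : E3 → ℝ) (A B : M3) : Prop := ∀ (l1 l2 l3 : ℝ) (x : E3),
  l1 * x.1 + l2 * x.2.1 + l3 * x.2.2 = 0 →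
  HasLineDerivAt ℝ F 0 x (l1 • A.L x + l2 • B.L x + l3 • Jm.L x)

lemma poly5 {a0 a1 a2 a3 a4 a5 : ℝ}
    (H : ∀ s : ℝ, a0 + a1 * s + a2 * s ^ 2 + a3 * s ^ 3 + a4 * s ^ 4 + a5 * s ^ 5 = 0) :
    a0 = 0 ∧ a1 = 0 ∧ a2 = 0 ∧ a3 = 0 ∧ a4 = 0 ∧ a5 = 0 := by
  have h0 := H 0
  have h1 := H 1
  have h2 := H (-1)
  have h3 := H 2
  have h4 := H (-2)
  have h5 := H 3
  norm_num at h0 h1 h2 h3 h4 h5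
  refine ⟨?_, ?_, ?_, ?_, ?_, ?_⟩ <;> linarith

lemma poly27 {a0 a1 a2 a3 a4 a5 : ℝ}
    (H : ∀ s : ℝ, a0 * s ^ 2 + a1 * s ^ 3 + a2 * s ^ 4 + a3 * s ^ 5 + a4 * s ^ 6 + a5 * s ^ 7 = 0) :
    a0 = 0 ∧ a1 = 0 ∧ a2 = 0 ∧ a3 = 0 ∧ a4 = 0 ∧ a5 = 0 := by
  have h0 := H (-3)
  have h1 := H 1
  have h2 := H (-1)
  have h3 := H 2
  have h4 := H (-2)
  have h5 := H 3
  norm_num at h0 h1 h2 h3 h4 h5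
  refine ⟨?_, ?_, ?_, ?_, ?_, ?_⟩ <;> linarith

lemma coef21 {c052 c142 c232 c322 c412 c502 c043 c133 c223 c313 c403 c034 c124 c214 c304 c025 c115 c205 c016 c106 c007 : ℝ}
    (H : ∀ s t : ℝ, (c052 + c142 * s ^ 1 + c232 * s ^ 2 + c322 * s ^ 3 + c412 * s ^ 4 + c502 * s ^ 5) * t ^ 2
      + (c043 + c133 * s ^ 1 + c223 * s ^ 2 + c313 * s ^ 3 + c403 * s ^ 4) * t ^ 3
      + (c034 + c124 * s ^ 1 + c214 * s ^ 2 + c304 * s ^ 3) * t ^ 4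
      + (c025 + c115 * s ^ 1 + c205 * s ^ 2) * t ^ 5
      + (c016 + c106 * s ^ 1) * t ^ 6
      + (c007) * t ^ 7 = 0) :
    c052 = 0 ∧ c142 = 0 ∧ c232 = 0 ∧ c322 = 0 ∧ c412 = 0 ∧ c502 = 0 ∧ c043 = 0 ∧ c133 = 0 ∧ c223 = 0 ∧ c313 = 0 ∧ c403 = 0 ∧ c034 = 0 ∧ c124 = 0 ∧ c214 = 0 ∧ c304 = 0 ∧ c025 = 0 ∧ c115 = 0 ∧ c205 = 0 ∧ c016 = 0 ∧ c106 = 0 ∧ c007 = 0 := by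
  have H1 := fun s => poly27 (H s)
  have q2 := poly5 (a0 := c052) (a1 := c142) (a2 := c232) (a3 := c322) (a4 := c412) (a5 := c502)
    (fun s => by linear_combination (H1 s).1)
  have q3 := poly5 (a0 := c043) (a1 := c133) (a2 := c223) (a3 := c313) (a4 := c403) (a5 := 0)
    (fun s => by linear_combination (H1 s).2.1)
  have q4 := poly5 (a0 := c034) (a1 := c124) (a2 := c214) (a3 := c304) (a4 := 0) (a5 := 0)
    (fun s => by linear_combination (H1 s).2.2.1)
  have q5 := poly5 (a0 := c025) (a1 := c115) (a2 := c205) (a3 := 0) (a4 := 0) (a5 := 0)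
    (fun s => by linear_combination (H1 s).2.2.2.1)
  have q6 := poly5 (a0 := c016) (a1 := c106) (a2 := 0) (a3 := 0) (a4 := 0) (a5 := 0)
    (fun s => by linear_combination (H1 s).2.2.2.2.1)
  have q7 := poly5 (a0 := c007) (a1 := 0) (a2 := 0) (a3 := 0) (a4 := 0) (a5 := 0)
    (fun s => by linear_combination (H1 s).2.2.2.2.2)
  tauto

/-- all integrability equations -/
structure Eqs (gA gB gC gD gE gF t1 t2 a k1 k2 p q r s f h : ℝ) : Prop where
  e052 : 2 * gB * k2 -gF * k2 +a * gC * k2 +gF * k2 ^ 2 = 0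
  e142 : 2 * gA * k2 -2 * gC * k1 -gC * k2 -4 * gE * k2 +2 * a * gB * k2 -a * gF * k2 +gC * k1 * k2
    +2 * gE * k2 ^ 2 = 0
  e232 : -2 * gB * k1 -3 * gD * k2 +gF * k1 +a * gA * k2 +a * gC * k1 -2 * a * gE * k2 +2 * gB * k1 *
    k2 +gD * k2 ^ 2 +gF * k1 * k2 = 0
  e322 : gA * k2 -3 * gC * k1 -2 * gE * k2 +2 * a * gB * k1 -a * gD * k2 -a * gF * k1 +gA * k1 * k2
    +gC * k1 ^ 2 +2 * gE * k1 * k2 = 0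
  e412 : -4 * gB * k1 -gD * k1 -2 * gD * k2 +2 * gF * k1 +a * gA * k1 -2 * a * gE * k1 +2 * gB * k1 ^
    2 +gD * k1 * k2 = 0
  e502 : -gA * k1 +2 * gE * k1 -a * gD * k1 +gA * k1 ^ 2 = 0
  e043 : -2 * f * gB +f * gF -gC * h +k2 * p -k2 * s -a * gA * gC -a * gB * gF -2 * a * gB * t1 +2 *
    a * gB ^ 2 +a * gC * gE -a * gC * t2 +a * gC ^ 2 +a * gF * t1 +2 * a * k2 * q -2 * f * gF *
    k2 -gA * gF * k2 -gB * gC * k1 +2 * gB * gE * k2 -4 * gB * k2 * t2 +gC * gF * k2 +2 * gC * h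
    * k2 +gC * k1 * t1 -gE * gF * k2 +2 * gE * k2 * t1 +gF * k2 * t2 +2 * k2 ^ 2 * s = 0
  e133 : -2 * f * gA +2 * f * gC +4 * f * gE -2 * k1 * q -2 * k2 * r +2 * a * gA * gB -2 * a * gA *
    t1 +2 * a * gB * gC -4 * a * gB * gE +2 * a * gC * gD -2 * a * gC * gF +2 * a * gC * t1 +4 *
    a * gE * t1 +2 * a * k2 * p -2 * a * k2 * s -4 * f * gE * k2 -2 * gA * gC * k1 -4 * gA * k2
    * t2 +2 * gB * gD * k2 +2 * gB * gF * k1 +4 * gB * h * k2 -2 * gC * gE * k1 +2 * gC * gE *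
    k2 +2 * gC * k1 * t2 +2 * gC * k2 * t2 +2 * gC ^ 2 * k1 +2 * gD * k2 * t1 +4 * gE * k2 * t2
    -4 * gE ^ 2 * k2 -2 * gF * k1 * t1 +2 * k1 * k2 * q +2 * k2 ^ 2 * r = 0
  e223 : 2 * f * gB +3 * f * gD -f * gF +gA * h -3 * gC * h -2 * gE * h -k1 * p +k1 * s +k2 * p -k2 *
    s -a * gA * gC -3 * a * gA * gE +a * gA * t2 +a * gA ^ 2 -a * gB * gD -3 * a * gB * gF +2 *
    a * gB * t1 +2 * a * gB ^ 2 -a * gC * gE -3 * a * gC * t2 -a * gD * gF +3 * a * gD * t1 -2 *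
    a * gE * t2 +2 * a * gE ^ 2 -a * gF * t1 +a * gF ^ 2 +2 * a * k1 * q -2 * a * k2 * r -2 * f
    * gD * k2 -2 * f * gF * k1 -gA * gB * k1 +gA * gD * k2 +2 * gA * gF * k1 -2 * gA * gF * k2
    +2 * gA * h * k2 -gA * k1 * t1 +5 * gB * gC * k1 -2 * gB * gE * k1 +2 * gB * gE * k2 +2 * gB
    * k1 * t2 -gC * gD * k1 +gC * gD * k2 -gC * gF * k1 +2 * gC * h * k1 +3 * gC * k1 * t1 -5 *
    gD * gE * k2 +3 * gD * k2 * t2 +gE * gF * k2 +2 * gE * k2 * t1 -gF * k2 * t2 +2 * k1 * k2 *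
    p +2 * k1 * k2 * s = 0
  e313 : -4 * gB * h -2 * gD * h +2 * gF * h -2 * k1 * q -2 * k2 * r -2 * a * gA * gD -4 * a * gB *
    gE -4 * a * gB * t2 +2 * a * gC * gD +2 * a * gD * gE -2 * a * gD * t2 +2 * a * gE * gF +2 *
    a * gF * t2 +2 * a * k1 * p -2 * a * k1 * s -4 * f * gE * k1 -2 * gA * gE * k2 -2 * gA * k2
    * t2 -2 * gB * gD * k1 +2 * gB * gD * k2 +4 * gB * h * k1 +4 * gB * k1 * t1 +4 * gB ^ 2 * k1
    -2 * gC * gE * k1 +2 * gC * k1 * t2 +2 * gD * gF * k2 +2 * gD * k1 * t1 +2 * gD * k2 * t1 -2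
    * gD ^ 2 * k2 -4 * gF * k1 * t1 +2 * k1 * k2 * r +2 * k1 ^ 2 * q = 0
  e403 : f * gD -gA * h +2 * gE * h -k1 * p +k1 * s -a * gA * gE -a * gA * t2 +a * gB * gD -a * gD *
    gF +a * gD * t1 +a * gD ^ 2 +2 * a * gE * t2 +2 * a * gE ^ 2 -2 * a * k1 * r -2 * f * gD *
    k1 +gA * gB * k1 -gA * gD * k1 +gA * gF * k1 +2 * gA * h * k1 +gA * k1 * t1 -2 * gB * gE *
    k1 +2 * gB * k1 * t2 +gD * gE * k2 +gD * k2 * t2 -4 * gE * k1 * t1 +2 * k1 ^ 2 * p = 0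
  e034 : -f * p +f * s -h * q -a * f * q -a * gA * q +3 * a * gB * p -a * gB * s +2 * a * gC * q +a *
    gC * r +a * gE * q -a * gF * p -a * p * t1 -a * q * t2 +a * s * t1 +f * gA * gF -2 * f * gB
    * gE +4 * f * gB * t2 -2 * f * gC * gF -f * gC * h +f * gE * gF -2 * f * gE * t1 -f * gF *
    t2 -4 * f * k2 * s +f ^ 2 * gF -gA * gC * h -gA * k2 * s -2 * gB * h * t1 -gB * k1 * q +3 *
    gB * k2 * r +2 * gB ^ 2 * h -gC * gE * h +gC * h * t2 -gC * k1 * p +2 * gC * k2 * s +2 * gC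
    ^ 2 * h -gE * k2 * s -gF * k2 * r +3 * h * k2 * q +k1 * q * t1 -2 * k2 * p * t2 +k2 * r * t1
    +k2 * s * t2 -a * f * gB * gF +a * f * gC * gE -a * f * gC * t2 +a * f * gF * t1 -a * gA *
    gC * gE +a * gA * gC * t2 +a * gB * gC * gD -a * gB * gE * gF +2 * a * gB * gE * t1 +a * gB
    * gF * t2 +a * gB * k2 * s +2 * a * gB * t1 * t2 -2 * a * gB ^ 2 * t2 -a * gC * gD * t1 -2 *
    a * gC * gE * t2 +a * gC * gE ^ 2 -a * gC * k2 * r +a * gC * t2 ^ 2 +a * gE * gF * t1 +a *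
    gE * k2 * q -2 * a * gE * t1 ^ 2 -a * gF * k2 * p -a * gF * t1 * t2 -a * k2 * q * t2 -a * k2
    * s * t1 +a ^ 2 * gB * q -a ^ 2 * gC * p -a ^ 2 * q * t1 -gA * gE * gF * k2 +gA * gF * k2 *
    t2 -gB * gC * gE * k1 +gB * gC * k1 * t2 +gB * gD * gF * k2 -2 * gB * gE * k2 * t2 -gB * gF
    * h * k2 -2 * gB * gF * k1 * t1 +2 * gB * k2 * t2 ^ 2 +gB ^ 2 * gF * k1 +gC * gE * h * k2
    +gC * gE * k1 * t1 -gC * h * k2 * t2 -gC * k1 * t1 * t2 -gD * gF * k2 * t1 -2 * gE * k2 * t1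
    * t2 +gE * k2 ^ 2 * s +2 * gE ^ 2 * k2 * t1 +gF * h * k2 * t1 +gF * k1 * t1 ^ 2 -gF * k2 ^ 2
    * r -k2 ^ 2 * s * t2 = 0
  e124 : f * q +2 * f * r -a * f * p +a * f * s +2 * a * gA * p +3 * a * gB * q -2 * a * gB * r -a *
    gC * p -2 * a * gC * s +2 * a * gD * q -4 * a * gE * p -2 * a * gF * q +a * h * q +a * q *
    t1 +2 * a * r * t1 +4 * f * gA * t2 -2 * f * gB * gD -3 * f * gB * gF -2 * f * gB * h -2 * f
    * gC * gE -4 * f * gC * t2 -2 * f * gD * t1 -4 * f * gE * t2 +4 * f * gE ^ 2 -f * gF * h +f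
    * gF * t1 +f * gF ^ 2 -f * k1 * q -4 * f * k2 * r +2 * f ^ 2 * gE +2 * gA * gB * h -2 * gA *
    h * t1 -2 * gA * k1 * q +2 * gA * k2 * r +5 * gB * gC * h -4 * gB * gE * h +2 * gB * k1 * s
    +gB * k2 * s -gC * gF * h +3 * gC * h * t1 +gC * h ^ 2 +4 * gC * k1 * q -2 * gC * k1 * r +gC
    * k2 * r +4 * gE * h * t1 -2 * gE * k1 * q +2 * gE * k2 * q -6 * gE * k2 * r +2 * gF * k1 *
    p -2 * gF * k2 * p +3 * h * k2 * p +h * k2 * s +2 * k1 * q * t2 -2 * k1 * s * t1 +2 * k2 * r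
    * t2 +k2 * s * t1 -a * f * gA * gF -2 * a * f * gB * t2 +a * f * gC * gD +2 * a * f * gE *
    t1 -2 * a * gA * gB * gE -2 * a * gA * gB * t2 +a * gA * gC * gF +2 * a * gA * gE * t1 +a *
    gA * k2 * s +2 * a * gA * t1 * t2 +a * gB * gC * gE +a * gB * gC * t2 -2 * a * gB * gD * gF
    +a * gB * gF * h +a * gB * gF ^ 2 +2 * a * gB * k1 * q -a * gB * k2 * r +2 * a * gB ^ 2 * gD
    -a * gB ^ 2 * gF +2 * a * gC * gD * gE -2 * a * gC * gD * t2 -a * gC * gE * gF -a * gC * gE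
    * h -a * gC * gE * t1 +a * gC * gF * t2 +a * gC * h * t2 -2 * a * gC * k1 * p -a * gC * t1 *
    t2 -a * gC ^ 2 * gD +2 * a * gD * gF * t1 +a * gD * k2 * q -2 * a * gD * t1 ^ 2 -a * gE * k2
    * p -2 * a * gE * k2 * s -a * gF * h * t1 +2 * a * gF * k2 * r +a * gF * t1 ^ 2 -a * gF ^ 2
    * t1 -2 * a * k1 * q * t1 -a * k2 * p * t2 -a * k2 * r * t1 +2 * a * k2 * s * t2 +a ^ 2 * gA
    * q -a ^ 2 * gB * p -a ^ 2 * gB * s +a ^ 2 * gC * r -a ^ 2 * gE * q +a ^ 2 * gF * p -a ^ 2 *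
    p * t1 +a ^ 2 * q * t2 +a ^ 2 * s * t1 -f * gB * gF * k1 +f * gC * gE * k1 -f * gC * k1 * t2
    +f * gF * k1 * t1 +2 * gA * gB * gF * k1 -2 * gA * gC * gE * k1 +2 * gA * gC * k1 * t2 -2 *
    gA * gE ^ 2 * k2 -gA * gF * h * k2 -2 * gA * gF * k1 * t1 +gA * gF ^ 2 * k2 +2 * gA * k2 *
    t2 ^ 2 -gB * gC * gF * k1 +2 * gB * gD * gE * k2 -2 * gB * gD * k2 * t2 -gB * gE * gF * k2
    +gB * gF * k2 * t2 -2 * gB * h * k2 * t2 +gB * k1 * k2 * s -gC * gD * gF * k2 +gC * gD * h *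
    k2 +gC * gE ^ 2 * k2 +gC * gF * k1 * t1 -gC * k1 * k2 * r -gC * k2 * t2 ^ 2 +gC ^ 2 * gE *
    k1 -gC ^ 2 * k1 * t2 +2 * gD * gE * k2 * t1 -2 * gD * k2 * t1 * t2 +gD * k2 ^ 2 * s -gE * gF
    * k2 * t1 +2 * gE * h * k2 * t1 +gE * k1 * k2 * q -gE * k2 ^ 2 * r -gF * k1 * k2 * p +gF *
    k2 * t1 * t2 -k1 * k2 * q * t2 -k1 * k2 * s * t1 -k2 ^ 2 * r * t2 = 0
  e214 : -2 * h * q -h * r +a * f * r -2 * a * gA * r -4 * a * gB * s +2 * a * gC * r -2 * a * gD * p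
    -a * gD * s -2 * a * gE * q +3 * a * gE * r +2 * a * gF * s +a * h * p -a * h * s -2 * a * q
    * t2 -a * r * t2 -f * gA * gD -f * gA * h -4 * f * gB * gE -4 * f * gB * t2 +5 * f * gD * gE
    -3 * f * gD * t2 +2 * f * gE * gF -2 * f * gE * h +2 * f * gF * t2 -f * k1 * p -3 * f * k1 *
    s +f ^ 2 * gD -3 * gA * gE * h -gA * h * t2 +2 * gA * k1 * s -2 * gA * k2 * s +gA ^ 2 * h -2
    * gB * gD * h +4 * gB * h * t1 +2 * gB * h ^ 2 +6 * gB * k1 * q -2 * gB * k1 * r +2 * gB *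
    k2 * r +4 * gB ^ 2 * h -2 * gC * gE * h +2 * gC * h * t2 +4 * gD * h * t1 -gD * k1 * q +2 *
    gD * k2 * q -4 * gD * k2 * r -gE * k1 * p -2 * gE * k2 * p -4 * gF * h * t1 -2 * gF * k1 * q
    +2 * gF * k2 * r +4 * h * k1 * q +h * k2 * r +k1 * p * t2 +2 * k1 * q * t1 -2 * k2 * p * t2
    +2 * k2 * r * t1 -a * f * gA * gE -a * f * gA * t2 +a * f * gB * gD +a * f * gD * t1 +a * gA
    * gB * gD +2 * a * gA * gC * gE +2 * a * gA * gC * t2 -a * gA * gD * gF +a * gA * gD * t1 +a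
    * gA * gE ^ 2 +a * gA * gF * h +2 * a * gA * k1 * q -a * gA * t2 ^ 2 -a * gA ^ 2 * gE -a *
    gA ^ 2 * t2 -2 * a * gB * gC * gD -a * gB * gD * gE -a * gB * gD * t2 +2 * a * gB * gE * gF
    +2 * a * gB * gF * t2 +2 * a * gB * h * t2 -2 * a * gB * k1 * p -a * gB * k1 * s -a * gC *
    gD * h -2 * a * gC * gD * t1 +a * gC * gD ^ 2 -2 * a * gC * gE ^ 2 +a * gC * k1 * r +2 * a *
    gC * t2 ^ 2 +a * gD * gE * t1 -2 * a * gD * k2 * s +a * gD * t1 * t2 -2 * a * gE * gF * t1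
    -2 * a * gE * h * t1 -a * gE * k1 * q +2 * a * gE * k2 * r +a * gF * k1 * p -2 * a * gF * t1
    * t2 -2 * a * k1 * p * t1 +a * k1 * q * t2 +a * k1 * s * t1 +2 * a * k2 * r * t2 -a ^ 2 * gA
    * s +a ^ 2 * gB * r -a ^ 2 * gD * q +a ^ 2 * gE * p +a ^ 2 * gE * s -a ^ 2 * gF * r +a ^ 2 *
    p * t2 +a ^ 2 * r * t1 -a ^ 2 * s * t2 -f * gA * gF * k1 -2 * f * gB * k1 * t2 +f * gC * gD
    * k1 +2 * f * gE * k1 * t1 -gA * gB * gE * k1 +gA * gB * k1 * t2 -gA * gC * gD * k1 -gA * gD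
    * gE * k2 -gA * gD * k2 * t2 +2 * gA * gE * gF * k2 -gA * gE * h * k2 -gA * gE * k1 * t1 +2
    * gA * gF * k2 * t2 -gA * h * k2 * t2 +gA * k1 * k2 * s +gA * k1 * t1 * t2 +gA ^ 2 * gF * k1
    +2 * gB * gC * gE * k1 -2 * gB * gC * k1 * t2 -2 * gB * gD * gF * k2 +gB * gD * h * k2 +gB *
    gD ^ 2 * k2 -gB * k1 * k2 * r +gB * k1 ^ 2 * q +gB ^ 2 * gD * k1 -2 * gB ^ 2 * gF * k1 +2 *
    gC * gE * k1 * t1 -2 * gC * k1 * t1 * t2 -gC * k1 ^ 2 * p -2 * gD * gF * k2 * t1 +gD * h *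
    k2 * t1 +gD * k1 * k2 * q -gD * k1 * t1 ^ 2 +gD ^ 2 * k2 * t1 -gE * k1 * k2 * p +2 * gF * k1
    * t1 ^ 2 -k1 * k2 * p * t2 -k1 * k2 * r * t1 -k1 ^ 2 * q * t1 = 0
  e304 : f * r -h * p +h * s -a * gA * s +a * gB * r +a * gD * q +2 * a * gD * r -a * gE * p +3 * a *
    gE * s -a * gF * r -a * h * r -a * p * t2 +a * r * t1 +a * s * t2 -f * gB * gD -f * gD * gF
    -f * gD * h -f * gD * t1 +2 * f * gD ^ 2 +2 * f * gE * t2 +2 * f * gE ^ 2 -3 * f * k1 * r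
    +gA * gB * h -2 * gA * gD * h +gA * gF * h +gA * h * t1 +gA * h ^ 2 +gA * k1 * q -2 * gB *
    gE * h +2 * gB * h * t2 +gB * k1 * p -2 * gD * k1 * p +gD * k2 * s -4 * gE * h * t1 -3 * gE
    * k1 * q +gE * k2 * r +gF * k1 * p +4 * h * k1 * p +k1 * p * t1 +k1 * q * t2 -2 * k1 * s *
    t1 +k2 * r * t2 +a * gA * gB * gE +a * gA * gB * t2 +a * gA * gE * h +a * gA * gE * t1 +a *
    gA * h * t2 -a * gA * k1 * s +a * gA * t1 * t2 +a * gB * gD * gF -a * gB * gD * h -2 * a *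
    gB * gD * t1 +2 * a * gB * gE * t2 +a * gB * k1 * r +2 * a * gB * t2 ^ 2 -a * gB ^ 2 * gD -a
    * gC * gD * gE -a * gC * gD * t2 +a * gD * gF * t1 -a * gD * h * t1 -a * gD * k1 * q -a * gD
    * t1 ^ 2 +a * gE * k1 * p -2 * a * gE * t1 * t2 -2 * a * gE ^ 2 * t1 +a * k1 * p * t2 +a *
    k1 * r * t1 +a ^ 2 * gD * s -a ^ 2 * gE * r -a ^ 2 * r * t2 -f * gA * gE * k1 -f * gA * k1 *
    t2 +f * gB * gD * k1 +f * gD * k1 * t1 -gA * gB * gF * k1 +gA * gC * gE * k1 +gA * gC * k1 *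
    t2 +2 * gA * gE * k2 * t2 +gA * gE ^ 2 * k2 -gA * gF * k1 * t1 +gA * k1 ^ 2 * q +gA * k2 *
    t2 ^ 2 -gB * gD * gE * k2 -gB * gD * k2 * t2 +2 * gB * gE * k1 * t1 -2 * gB * k1 * t1 * t2
    -gB * k1 ^ 2 * p -2 * gB ^ 2 * k1 * t2 -gD * gE * k2 * t1 -gD * k2 * t1 * t2 +2 * gE * k1 *
    t1 ^ 2 -k1 ^ 2 * p * t1 = 0
  e025 : -a * p * s +a * p ^ 2 +a * q * r +a * q ^ 2 +f * gA * s -3 * f * gB * r -3 * f * gC * s +f *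
    gE * s -f * gF * q +f * gF * r -2 * f * h * q +2 * f * p * t2 -f * r * t1 -f * s * t2 +2 * f
    ^ 2 * s -gA * h * q +3 * gB * h * p +4 * gC * h * q -gC * h * r -gE * h * q -h * p * t1 +h *
    q * t2 -k1 * p * q +k2 * p * r +k2 * q * s -k2 * r * s -2 * a * f * gB * s +2 * a * f * gC *
    r +2 * a * f * s * t1 -a * gA * gC * r -a * gA * gE * q +a * gA * q * t2 +a * gB * gC * s +a
    * gB * gD * q -a * gB * gE * p -a * gB * gE * s -a * gB * gF * q -a * gB * gF * r +2 * a *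
    gB * h * q -3 * a * gB * p * t2 +a * gB * s * t2 +a * gB ^ 2 * r +a * gC * gD * p +2 * a *
    gC * gE * r +a * gC * gF * p -2 * a * gC * h * p -2 * a * gC * r * t2 -a * gC * s * t1 -a *
    gC ^ 2 * r -a * gD * q * t1 -a * gE * gF * p +3 * a * gE * p * t1 -2 * a * gE * q * t2 +a *
    gE * s * t1 +a * gE ^ 2 * q +a * gF * p * t2 +a * gF * q * t1 +a * gF * r * t1 -2 * a * h *
    q * t1 +a * p * t1 * t2 +a * q * t2 ^ 2 -a * r * t1 ^ 2 -a * s * t1 * t2 +f * gA * gE * gF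
    -f * gA * gF * t2 -f * gB * gD * gF +2 * f * gB * gE * t2 +f * gB * gF ^ 2 -2 * f * gB * t2
    ^ 2 -f * gC * gE * gF +f * gC * gF * t2 +f * gD * gF * t1 -2 * f * gE * k2 * s +2 * f * gE *
    t1 * t2 -2 * f * gE ^ 2 * t1 +2 * f * gF * k2 * r -f * gF ^ 2 * t1 +2 * f * k2 * s * t2 -gA
    * gC * gE * h +gA * gC * h * t2 -gA * gE * k2 * s -gA * gF * k2 * r +gA * k2 * s * t2 +gB *
    gC * gD * h -gB * gC * gF * h -gB * gC * k1 * r +gB * gD * k2 * s +2 * gB * gE * h * t1 -gB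
    * gE * k1 * q +gB * gE * k2 * r +2 * gB * gF * k1 * p +2 * gB * h * t1 * t2 +gB * k1 * q *
    t2 -2 * gB * k1 * s * t1 -3 * gB * k2 * r * t2 -2 * gB ^ 2 * h * t2 +gB ^ 2 * k1 * s -gC *
    gD * h * t1 -gC * gE * k1 * p +gC * gE * k2 * s +gC * gF * h * t1 -gC * gF * k2 * r +gC * k1
    * p * t2 +gC * k1 * r * t1 -gC * k2 * s * t2 +gC ^ 2 * gE * h -gC ^ 2 * h * t2 +gD * gF * k2
    * p -gD * k2 * s * t1 -gE * gF * k2 * q +2 * gE * h * k2 * q -2 * gE * h * t1 ^ 2 +gE * k1 *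
    q * t1 +3 * gE * k2 * r * t1 -gE ^ 2 * k2 * p -2 * gF * h * k2 * p -2 * gF * k1 * p * t1 +gF
    * k2 * q * t2 +gF ^ 2 * k2 * p -2 * h * k2 * q * t2 -k1 * q * t1 * t2 +k1 * s * t1 ^ 2 +k2 *
    p * t2 ^ 2 -k2 * r * t1 * t2 = 0
  e115 : -2 * a * p * r -2 * a * q * s -2 * f * gA * r -4 * f * gB * s -2 * f * gE * q +6 * f * gE *
    r +2 * f * gF * s -2 * f * h * p -2 * f * h * s -2 * f * q * t2 -2 * f * r * t2 +2 * f ^ 2 *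
    r +2 * gA * h * p +6 * gB * h * q -2 * gB * h * r -4 * gE * h * p -2 * gF * h * q +2 * h * q
    * t1 +2 * h * r * t1 +2 * h ^ 2 * q +2 * k1 * p * s -2 * k1 * q * r +2 * k1 * q ^ 2 -2 * k2
    * p * s +2 * k2 * q * r -2 * k2 * r ^ 2 -2 * a * f * gA * s +2 * a * f * gB * r +2 * a * f *
    gE * s -2 * a * f * gF * r +2 * a * f * r * t1 -2 * a * f * s * t2 +2 * a * gA * gC * s -2 *
    a * gA * gE * p +2 * a * gA * h * q -2 * a * gA * p * t2 -2 * a * gB * gC * r +2 * a * gB *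
    gD * p -2 * a * gB * gD * s +2 * a * gB * gF * s -2 * a * gB * h * p -2 * a * gC * gD * q +2
    * a * gC * gD * r +2 * a * gC * gE * p -2 * a * gC * gE * s +2 * a * gC * p * t2 -2 * a * gC
    * r * t1 +2 * a * gC * s * t2 +2 * a * gD * gE * q -2 * a * gD * gF * p +2 * a * gD * p * t1
    -2 * a * gD * q * t2 +2 * a * gD * s * t1 -2 * a * gE * h * q +2 * a * gF * h * p -2 * a *
    gF * s * t1 -2 * a * h * p * t1 +2 * a * h * q * t2 +2 * f * gA * gE ^ 2 -2 * f * gA * t2 ^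
    2 -2 * f * gB * gD * gE +2 * f * gB * gD * t2 +2 * f * gB * gE * gF +2 * f * gB * gF * t2 -2
    * f * gB * k1 * s -2 * f * gC * gE ^ 2 +2 * f * gC * k1 * r +2 * f * gC * t2 ^ 2 -2 * f * gD
    * gE * t1 -2 * f * gD * k2 * s +2 * f * gD * t1 * t2 -2 * f * gE * gF * t1 +2 * f * gE * k2
    * r -2 * f * gF * t1 * t2 +2 * f * k1 * s * t1 +2 * f * k2 * r * t2 -2 * gA * gB * gE * h -2
    * gA * gB * h * t2 +2 * gA * gB * k1 * s -2 * gA * gC * k1 * r +2 * gA * gE * h * t1 -2 * gA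
    * gE * k1 * q -2 * gA * gE * k2 * r +2 * gA * gF * k1 * p +2 * gA * gF * k2 * s +2 * gA * h
    * t1 * t2 +2 * gA * k1 * q * t2 -2 * gA * k1 * s * t1 -2 * gA * k2 * r * t2 +2 * gB * gC *
    gE * h -2 * gB * gC * h * t2 +2 * gB * gD * k2 * r -2 * gB * gF * k1 * q -2 * gB * gF * k2 *
    r +2 * gB * h * k1 * q +2 * gB ^ 2 * gD * h -2 * gB ^ 2 * gF * h +2 * gC * gE * h * t1 +2 *
    gC * gE * k1 * q -2 * gC * h * k1 * p -2 * gC * h * t1 * t2 -2 * gC * k1 * q * t2 -2 * gD *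
    gF * k2 * q +2 * gD * h * k2 * q -2 * gD * h * t1 ^ 2 +2 * gD * k2 * r * t1 +2 * gE * gF *
    k2 * p -2 * gE * h * k2 * p +2 * gF * h * t1 ^ 2 +2 * gF * k1 * q * t1 +2 * gF * k2 * p * t2
    -2 * gF * k2 * r * t1 -2 * h * k1 * q * t1 -2 * h * k2 * p * t2 = 0
  e205 : -a * p * s +a * q * r +a * r ^ 2 +a * s ^ 2 -f * gB * r -f * gD * q +4 * f * gD * r +3 * f *
    gE * s -f * gF * r -2 * f * h * r -f * r * t1 +f * s * t2 +gA * h * q -gA * h * r +gB * h *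
    p -3 * gD * h * p -3 * gE * h * q +gF * h * p +h * p * t1 +h * q * t2 -2 * h * s * t1 +2 * h
    ^ 2 * p +k1 * p * q -k1 * p * r -k1 * q * s +k2 * r * s +2 * a * f * gD * s -2 * a * f * gE
    * r -2 * a * f * r * t2 +a * gA * gB * s -a * gA * gD * s +a * gA * gE * q +a * gA * gE * r
    +a * gA * q * t2 +a * gA * r * t2 +a * gA * s * t1 -2 * a * gB * gD * q +a * gB * gE * p +a
    * gB * gE * s +a * gB * gF * r +a * gB * p * t2 -2 * a * gB * r * t1 +3 * a * gB * s * t2 -a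
    * gB ^ 2 * r -a * gC * gD * s -a * gC * gE * r -a * gC * r * t2 -a * gD * gE * p +a * gD *
    gF * q -2 * a * gD * h * q -a * gD * p * t2 -2 * a * gD * q * t1 +a * gD ^ 2 * q +2 * a * gE
    * h * p +a * gE * p * t1 -3 * a * gE * s * t1 -a * gE ^ 2 * q +a * gF * r * t1 +2 * a * h *
    p * t2 +a * p * t1 * t2 +a * q * t2 ^ 2 -a * r * t1 ^ 2 -a * s * t1 * t2 +f * gA * gD * gE
    +f * gA * gD * t2 -2 * f * gA * k1 * s +f * gB * gD * gF -f * gB * gD ^ 2 +2 * f * gB * gE *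
    t2 +2 * f * gB * k1 * r +2 * f * gB * t2 ^ 2 -f * gC * gD * gE -f * gC * gD * t2 +f * gD *
    gF * t1 -f * gD ^ 2 * t1 -2 * f * gE * t1 * t2 -2 * f * gE ^ 2 * t1 +2 * f * k1 * r * t1 +gA
    * gB * gD * h -gA * gB * gF * h -gA * gB * k1 * r +gA * gC * gE * h +gA * gC * h * t2 +gA *
    gC * k1 * s +gA * gD * h * t1 -gA * gD * k1 * q +2 * gA * gE * k2 * s -gA * gF * h * t1 -gA
    * gF * k1 * q +2 * gA * h * k1 * q -gA * k1 * r * t1 +2 * gA * k2 * s * t2 -gA ^ 2 * gE * h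
    -gA ^ 2 * h * t2 +gA ^ 2 * k1 * s +gB * gD * k1 * p -gB * gD * k2 * s +2 * gB * gE * h * t1
    +gB * gE * k1 * q -gB * gE * k2 * r -gB * gF * k1 * p -2 * gB * h * k1 * p -2 * gB * h * t1
    * t2 -3 * gB * k1 * q * t2 -gB * k2 * r * t2 -2 * gB ^ 2 * h * t2 -gB ^ 2 * k1 * s +gC * gE
    * k1 * p +gC * k1 * p * t2 -gD * gE * k2 * q +gD * k1 * p * t1 -gD * k2 * q * t2 -gD * k2 *
    s * t1 +2 * gE * h * t1 ^ 2 +3 * gE * k1 * q * t1 +2 * gE * k2 * p * t2 -gE * k2 * r * t1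
    +gE ^ 2 * k2 * p -gF * k1 * p * t1 -2 * h * k1 * p * t1 -k1 * q * t1 * t2 +k1 * s * t1 ^ 2
    +k2 * p * t2 ^ 2 -k2 * r * t1 * t2 = 0
  e016 : -f * p * r -2 * f * q * s +f * r * s +h * p ^ 2 -h * q * r +2 * h * q ^ 2 -a * f * p * s +a
    * f * q * r -a * gA * q * r +a * gB * p * r -a * gB * r * s +2 * a * gC * p * s -2 * a * gC
    * q * r +a * gC * r ^ 2 +a * gD * p * q -a * gE * p * s -a * gE * p ^ 2 +2 * a * gE * q * r
    -a * gF * p * r +a * p * r * t1 +a * p * s * t2 -a * p ^ 2 * t2 -2 * a * q * r * t2 +a * r *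
    s * t1 +f * gA * gE * s +f * gA * gF * r -f * gA * s * t2 -f * gB * gD * s -f * gB * gE * r
    +2 * f * gB * gF * s -f * gB * h * s +3 * f * gB * r * t2 -2 * f * gC * gE * s +f * gC * h *
    r +2 * f * gC * s * t2 -f * gD * gF * p +f * gD * s * t1 -f * gE * h * q -3 * f * gE * r *
    t1 +f * gE ^ 2 * p +f * gF * h * p -2 * f * gF * s * t1 +f * h * q * t2 +f * h * s * t1 -f *
    p * t2 ^ 2 +f * r * t1 * t2 +f ^ 2 * gE * s -f ^ 2 * gF * r -f ^ 2 * s * t2 -gA * gC * h * r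
    -gA * gE * h * q +gA * h * q * t2 -gA * k2 * r * s +gB * gD * h * q -gB * gE * h * p -2 * gB
    * gF * h * q -3 * gB * h * p * t2 +gB * h ^ 2 * q +2 * gB * k1 * p * s -gB * k1 * q * r +gB
    * k2 * r ^ 2 +gB ^ 2 * h * r +gC * gD * h * p +2 * gC * gE * h * q -2 * gC * h * q * t2 -gC
    * h ^ 2 * p -gC * k1 * p * r -gD * h * q * t1 +gD * k2 * p * s +3 * gE * h * p * t1 -gE * k1
    * p * q -gE * k2 * p * r +2 * gF * h * q * t1 +gF * k1 * p ^ 2 +2 * gF * k2 * p * s -2 * gF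
    * k2 * q * r -h * k2 * p * s +h * k2 * q * r +h * p * t1 * t2 -h * r * t1 ^ 2 -h ^ 2 * q *
    t1 +k1 * p * q * t2 -2 * k1 * p * s * t1 +k1 * q * r * t1 -k2 * p * r * t2 +k2 * r ^ 2 * t1 = 0
  e106 : -f * q * r +2 * f * r ^ 2 +f * s ^ 2 +h * p * q -2 * h * p * r -h * q * s +a * gA * q * s +a
    * gB * p * s -2 * a * gB * q * r +a * gB * s ^ 2 -a * gC * r * s -2 * a * gD * p * s +2 * a
    * gD * q * r -a * gD * q ^ 2 +a * gE * p * q -a * gE * q * s +a * gF * q * r +a * h * p * s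
    -a * h * q * r +a * p * q * t2 +a * p * s * t1 -2 * a * q * r * t1 +a * q * s * t2 -a * s ^
    2 * t1 +2 * f * gA * gE * r -f * gA * h * s +2 * f * gA * r * t2 -2 * f * gB * gD * r +f *
    gB * gE * s +f * gB * gF * r +f * gB * h * r +3 * f * gB * s * t2 -f * gC * gD * s -f * gC *
    gE * r -f * gC * r * t2 +f * gD * gF * q -f * gD * h * q -2 * f * gD * r * t1 +f * gE * h *
    p -3 * f * gE * s * t1 -f * gE ^ 2 * q +f * gF * r * t1 +f * h * p * t2 +f * h * r * t1 -f *
    k1 * p * s +f * k1 * q * r +f * q * t2 ^ 2 -f * s * t1 * t2 +f ^ 2 * gD * s -f ^ 2 * gE * r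
    -f ^ 2 * r * t2 +gA * gC * h * s -2 * gA * gE * h * p -gA * gF * h * q -2 * gA * h * p * t2
    +gA * h ^ 2 * q +2 * gA * k1 * p * s -2 * gA * k1 * q * r +gA * k2 * s ^ 2 +2 * gB * gD * h
    * p +gB * gE * h * q -gB * gF * h * p -3 * gB * h * q * t2 -gB * h ^ 2 * p -gB * k1 * q * s
    -gB * k2 * r * s -gB ^ 2 * h * s +gC * gE * h * p +gC * h * p * t2 +gC * k1 * p * s +2 * gD
    * h * p * t1 -gD * k2 * q * s +3 * gE * h * q * t1 +gE * k1 * q ^ 2 +2 * gE * k2 * p * s -gE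
    * k2 * q * r -gF * h * p * t1 -gF * k1 * p * q -h * q * t1 * t2 +h * s * t1 ^ 2 -h ^ 2 * p *
    t1 +k1 * q * s * t1 -k1 * q ^ 2 * t2 +2 * k2 * p * s * t2 -k2 * q * r * t2 -k2 * r * s * t1 = 0
  e007 : a * p * q * s -a * p * r * s +a * q * r ^ 2 -a * q ^ 2 * r +f * gA * r * s -f * gB * r ^ 2
    +f * gB * s ^ 2 -f * gC * r * s -f * gD * p * s +f * gE * p * r -f * gE * q * s +f * gF * q
    * r +f * p * r * t2 +f * q * s * t2 -f * r ^ 2 * t1 -f * s ^ 2 * t1 -gA * h * q * r +gB * h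
    * p * r -gB * h * q * s +gC * h * p * s +gD * h * p * q -gE * h * p ^ 2 +gE * h * q ^ 2 -gF
    * h * p * q +h * p * r * t1 -h * p ^ 2 * t2 +h * q * s * t1 -h * q ^ 2 * t2 -k1 * p * q * r
    +k1 * p ^ 2 * s +k2 * p * s ^ 2 -k2 * q * r * s = 0

lemma CT.w1 {F : E3 → ℝ} {A B : M3} (h : CT F A B) (x : E3) :
    HasLineDerivAt ℝ F 0 x (X3 x • A.L x - X1 x • Jm.L x) := by
  have := h x.2.2 0 (-x.1) x (by ring)
  refine ld_congr this rfl ?_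
  rw [X1_apply, X3_apply]
  module

lemma CT.w2 {F : E3 → ℝ} {A B : M3} (h : CT F A B) (x : E3) :
    HasLineDerivAt ℝ F 0 x (X3 x • B.L x - X2 x • Jm.L x) := by
  have := h 0 x.2.2 (-x.2.1) x (by ring)
  refine ld_congr this rfl ?_
  rw [X2_apply, X3_apply]
  module

lemma CT.frob {F : E3 → ℝ} (hF : Nm F) {A B : M3} (h : CT F A B) (x : E3) :
    det3 (X3 x • A.L x - X1 x • Jm.L x) (X3 x • B.L x - X2 x • Jm.L x)
      (X3 x • B.L (X3 x • A.L x - X1 x • Jm.L x) + X3 (X3 x • A.L x - X1 x • Jm.L x) • B.L x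
        - (X2 x • Jm.L (X3 x • A.L x - X1 x • Jm.L x) + X2 (X3 x • A.L x - X1 x • Jm.L x) • Jm.L x)
        - (X3 x • A.L (X3 x • B.L x - X2 x • Jm.L x) + X3 (X3 x • B.L x - X2 x • Jm.L x) • A.L x
        - (X1 x • Jm.L (X3 x • B.L x - X2 x • Jm.L x)
          + X1 (X3 x • B.L x - X2 x • Jm.L x) • Jm.L x))) = 0 := by
  have d : ∀ (Y : E3 →L[ℝ] ℝ) (C : E3 →L[ℝ] E3) (x : E3),
      HasFDerivAt (fun x => X3 x • C x - Y x • Jm.L x)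
        (X3 x • C + X3.smulRight (C x) - (Y x • Jm.L + Y.smulRight (Jm.L x))) x := by
    intro Y C x
    exact (X3.hasFDerivAt.smul C.hasFDerivAt).sub (Y.hasFDerivAt.smul Jm.L.hasFDerivAt)
  have := _root_.frob hF (fun x => d X1 A.L x) (fun x => d X2 B.L x) h.w1 h.w2 (by simp) x
  simpa only [_root_.sub_apply, _root_.add_apply, _root_.smul_apply,
    ContinuousLinearMap.smulRight_apply] using this

set_option maxRecDepth 1000000 in
set_option maxHeartbeats 0 in
lemma CT.eqs {F : E3 → ℝ} (hF : Nm F) {gA gB gC gD gE gF t1 t2 a k1 k2 p q r s f h : ℝ}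
    (hc : CT F ⟨gA, gB - t1, p, gB + t1, gC, q, a, -k2, f⟩ ⟨gD, gE - t2, r, gE + t2, gF, s, k1, a, h⟩) :
    Eqs gA gB gC gD gE gF t1 t2 a k1 k2 p q r s f h := by
  have key := coef21
    (c052 := 2 * gB * k2 -gF * k2 +a * gC * k2 +gF * k2 ^ 2)
    (c142 := 2 * gA * k2 -2 * gC * k1 -gC * k2 -4 * gE * k2 +2 * a * gB * k2 -a * gF * k2 +gC * k1 * k2
      +2 * gE * k2 ^ 2)
    (c232 := -2 * gB * k1 -3 * gD * k2 +gF * k1 +a * gA * k2 +a * gC * k1 -2 * a * gE * k2 +2 * gB * k1 *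
      k2 +gD * k2 ^ 2 +gF * k1 * k2)
    (c322 := gA * k2 -3 * gC * k1 -2 * gE * k2 +2 * a * gB * k1 -a * gD * k2 -a * gF * k1 +gA * k1 * k2
      +gC * k1 ^ 2 +2 * gE * k1 * k2)
    (c412 := -4 * gB * k1 -gD * k1 -2 * gD * k2 +2 * gF * k1 +a * gA * k1 -2 * a * gE * k1 +2 * gB * k1 ^
      2 +gD * k1 * k2)
    (c502 := -gA * k1 +2 * gE * k1 -a * gD * k1 +gA * k1 ^ 2)
    (c043 := -2 * f * gB +f * gF -gC * h +k2 * p -k2 * s -a * gA * gC -a * gB * gF -2 * a * gB * t1 +2 *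
      a * gB ^ 2 +a * gC * gE -a * gC * t2 +a * gC ^ 2 +a * gF * t1 +2 * a * k2 * q -2 * f * gF *
      k2 -gA * gF * k2 -gB * gC * k1 +2 * gB * gE * k2 -4 * gB * k2 * t2 +gC * gF * k2 +2 * gC * h
      * k2 +gC * k1 * t1 -gE * gF * k2 +2 * gE * k2 * t1 +gF * k2 * t2 +2 * k2 ^ 2 * s)
    (c133 := -2 * f * gA +2 * f * gC +4 * f * gE -2 * k1 * q -2 * k2 * r +2 * a * gA * gB -2 * a * gA *
      t1 +2 * a * gB * gC -4 * a * gB * gE +2 * a * gC * gD -2 * a * gC * gF +2 * a * gC * t1 +4 *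
      a * gE * t1 +2 * a * k2 * p -2 * a * k2 * s -4 * f * gE * k2 -2 * gA * gC * k1 -4 * gA * k2
      * t2 +2 * gB * gD * k2 +2 * gB * gF * k1 +4 * gB * h * k2 -2 * gC * gE * k1 +2 * gC * gE *
      k2 +2 * gC * k1 * t2 +2 * gC * k2 * t2 +2 * gC ^ 2 * k1 +2 * gD * k2 * t1 +4 * gE * k2 * t2
      -4 * gE ^ 2 * k2 -2 * gF * k1 * t1 +2 * k1 * k2 * q +2 * k2 ^ 2 * r)
    (c223 := 2 * f * gB +3 * f * gD -f * gF +gA * h -3 * gC * h -2 * gE * h -k1 * p +k1 * s +k2 * p -k2 *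
      s -a * gA * gC -3 * a * gA * gE +a * gA * t2 +a * gA ^ 2 -a * gB * gD -3 * a * gB * gF +2 *
      a * gB * t1 +2 * a * gB ^ 2 -a * gC * gE -3 * a * gC * t2 -a * gD * gF +3 * a * gD * t1 -2 *
      a * gE * t2 +2 * a * gE ^ 2 -a * gF * t1 +a * gF ^ 2 +2 * a * k1 * q -2 * a * k2 * r -2 * f
      * gD * k2 -2 * f * gF * k1 -gA * gB * k1 +gA * gD * k2 +2 * gA * gF * k1 -2 * gA * gF * k2
      +2 * gA * h * k2 -gA * k1 * t1 +5 * gB * gC * k1 -2 * gB * gE * k1 +2 * gB * gE * k2 +2 * gB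
      * k1 * t2 -gC * gD * k1 +gC * gD * k2 -gC * gF * k1 +2 * gC * h * k1 +3 * gC * k1 * t1 -5 *
      gD * gE * k2 +3 * gD * k2 * t2 +gE * gF * k2 +2 * gE * k2 * t1 -gF * k2 * t2 +2 * k1 * k2 *
      p +2 * k1 * k2 * s)
    (c313 := -4 * gB * h -2 * gD * h +2 * gF * h -2 * k1 * q -2 * k2 * r -2 * a * gA * gD -4 * a * gB *
      gE -4 * a * gB * t2 +2 * a * gC * gD +2 * a * gD * gE -2 * a * gD * t2 +2 * a * gE * gF +2 *
      a * gF * t2 +2 * a * k1 * p -2 * a * k1 * s -4 * f * gE * k1 -2 * gA * gE * k2 -2 * gA * k2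
      * t2 -2 * gB * gD * k1 +2 * gB * gD * k2 +4 * gB * h * k1 +4 * gB * k1 * t1 +4 * gB ^ 2 * k1
      -2 * gC * gE * k1 +2 * gC * k1 * t2 +2 * gD * gF * k2 +2 * gD * k1 * t1 +2 * gD * k2 * t1 -2
      * gD ^ 2 * k2 -4 * gF * k1 * t1 +2 * k1 * k2 * r +2 * k1 ^ 2 * q)
    (c403 := f * gD -gA * h +2 * gE * h -k1 * p +k1 * s -a * gA * gE -a * gA * t2 +a * gB * gD -a * gD *
      gF +a * gD * t1 +a * gD ^ 2 +2 * a * gE * t2 +2 * a * gE ^ 2 -2 * a * k1 * r -2 * f * gD *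
      k1 +gA * gB * k1 -gA * gD * k1 +gA * gF * k1 +2 * gA * h * k1 +gA * k1 * t1 -2 * gB * gE *
      k1 +2 * gB * k1 * t2 +gD * gE * k2 +gD * k2 * t2 -4 * gE * k1 * t1 +2 * k1 ^ 2 * p)
    (c034 := -f * p +f * s -h * q -a * f * q -a * gA * q +3 * a * gB * p -a * gB * s +2 * a * gC * q +a *
      gC * r +a * gE * q -a * gF * p -a * p * t1 -a * q * t2 +a * s * t1 +f * gA * gF -2 * f * gB
      * gE +4 * f * gB * t2 -2 * f * gC * gF -f * gC * h +f * gE * gF -2 * f * gE * t1 -f * gF *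
      t2 -4 * f * k2 * s +f ^ 2 * gF -gA * gC * h -gA * k2 * s -2 * gB * h * t1 -gB * k1 * q +3 *
      gB * k2 * r +2 * gB ^ 2 * h -gC * gE * h +gC * h * t2 -gC * k1 * p +2 * gC * k2 * s +2 * gC
      ^ 2 * h -gE * k2 * s -gF * k2 * r +3 * h * k2 * q +k1 * q * t1 -2 * k2 * p * t2 +k2 * r * t1
      +k2 * s * t2 -a * f * gB * gF +a * f * gC * gE -a * f * gC * t2 +a * f * gF * t1 -a * gA *
      gC * gE +a * gA * gC * t2 +a * gB * gC * gD -a * gB * gE * gF +2 * a * gB * gE * t1 +a * gB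
      * gF * t2 +a * gB * k2 * s +2 * a * gB * t1 * t2 -2 * a * gB ^ 2 * t2 -a * gC * gD * t1 -2 *
      a * gC * gE * t2 +a * gC * gE ^ 2 -a * gC * k2 * r +a * gC * t2 ^ 2 +a * gE * gF * t1 +a *
      gE * k2 * q -2 * a * gE * t1 ^ 2 -a * gF * k2 * p -a * gF * t1 * t2 -a * k2 * q * t2 -a * k2
      * s * t1 +a ^ 2 * gB * q -a ^ 2 * gC * p -a ^ 2 * q * t1 -gA * gE * gF * k2 +gA * gF * k2 *
      t2 -gB * gC * gE * k1 +gB * gC * k1 * t2 +gB * gD * gF * k2 -2 * gB * gE * k2 * t2 -gB * gF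
      * h * k2 -2 * gB * gF * k1 * t1 +2 * gB * k2 * t2 ^ 2 +gB ^ 2 * gF * k1 +gC * gE * h * k2
      +gC * gE * k1 * t1 -gC * h * k2 * t2 -gC * k1 * t1 * t2 -gD * gF * k2 * t1 -2 * gE * k2 * t1
      * t2 +gE * k2 ^ 2 * s +2 * gE ^ 2 * k2 * t1 +gF * h * k2 * t1 +gF * k1 * t1 ^ 2 -gF * k2 ^ 2
      * r -k2 ^ 2 * s * t2)
    (c124 := f * q +2 * f * r -a * f * p +a * f * s +2 * a * gA * p +3 * a * gB * q -2 * a * gB * r -a *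
      gC * p -2 * a * gC * s +2 * a * gD * q -4 * a * gE * p -2 * a * gF * q +a * h * q +a * q *
      t1 +2 * a * r * t1 +4 * f * gA * t2 -2 * f * gB * gD -3 * f * gB * gF -2 * f * gB * h -2 * f
      * gC * gE -4 * f * gC * t2 -2 * f * gD * t1 -4 * f * gE * t2 +4 * f * gE ^ 2 -f * gF * h +f
      * gF * t1 +f * gF ^ 2 -f * k1 * q -4 * f * k2 * r +2 * f ^ 2 * gE +2 * gA * gB * h -2 * gA *
      h * t1 -2 * gA * k1 * q +2 * gA * k2 * r +5 * gB * gC * h -4 * gB * gE * h +2 * gB * k1 * s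
      +gB * k2 * s -gC * gF * h +3 * gC * h * t1 +gC * h ^ 2 +4 * gC * k1 * q -2 * gC * k1 * r +gC
      * k2 * r +4 * gE * h * t1 -2 * gE * k1 * q +2 * gE * k2 * q -6 * gE * k2 * r +2 * gF * k1 *
      p -2 * gF * k2 * p +3 * h * k2 * p +h * k2 * s +2 * k1 * q * t2 -2 * k1 * s * t1 +2 * k2 * r
      * t2 +k2 * s * t1 -a * f * gA * gF -2 * a * f * gB * t2 +a * f * gC * gD +2 * a * f * gE *
      t1 -2 * a * gA * gB * gE -2 * a * gA * gB * t2 +a * gA * gC * gF +2 * a * gA * gE * t1 +a *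
      gA * k2 * s +2 * a * gA * t1 * t2 +a * gB * gC * gE +a * gB * gC * t2 -2 * a * gB * gD * gF
      +a * gB * gF * h +a * gB * gF ^ 2 +2 * a * gB * k1 * q -a * gB * k2 * r +2 * a * gB ^ 2 * gD
      -a * gB ^ 2 * gF +2 * a * gC * gD * gE -2 * a * gC * gD * t2 -a * gC * gE * gF -a * gC * gE
      * h -a * gC * gE * t1 +a * gC * gF * t2 +a * gC * h * t2 -2 * a * gC * k1 * p -a * gC * t1 *
      t2 -a * gC ^ 2 * gD +2 * a * gD * gF * t1 +a * gD * k2 * q -2 * a * gD * t1 ^ 2 -a * gE * k2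
      * p -2 * a * gE * k2 * s -a * gF * h * t1 +2 * a * gF * k2 * r +a * gF * t1 ^ 2 -a * gF ^ 2
      * t1 -2 * a * k1 * q * t1 -a * k2 * p * t2 -a * k2 * r * t1 +2 * a * k2 * s * t2 +a ^ 2 * gA
      * q -a ^ 2 * gB * p -a ^ 2 * gB * s +a ^ 2 * gC * r -a ^ 2 * gE * q +a ^ 2 * gF * p -a ^ 2 *
      p * t1 +a ^ 2 * q * t2 +a ^ 2 * s * t1 -f * gB * gF * k1 +f * gC * gE * k1 -f * gC * k1 * t2
      +f * gF * k1 * t1 +2 * gA * gB * gF * k1 -2 * gA * gC * gE * k1 +2 * gA * gC * k1 * t2 -2 *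
      gA * gE ^ 2 * k2 -gA * gF * h * k2 -2 * gA * gF * k1 * t1 +gA * gF ^ 2 * k2 +2 * gA * k2 *
      t2 ^ 2 -gB * gC * gF * k1 +2 * gB * gD * gE * k2 -2 * gB * gD * k2 * t2 -gB * gE * gF * k2
      +gB * gF * k2 * t2 -2 * gB * h * k2 * t2 +gB * k1 * k2 * s -gC * gD * gF * k2 +gC * gD * h *
      k2 +gC * gE ^ 2 * k2 +gC * gF * k1 * t1 -gC * k1 * k2 * r -gC * k2 * t2 ^ 2 +gC ^ 2 * gE *
      k1 -gC ^ 2 * k1 * t2 +2 * gD * gE * k2 * t1 -2 * gD * k2 * t1 * t2 +gD * k2 ^ 2 * s -gE * gF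
      * k2 * t1 +2 * gE * h * k2 * t1 +gE * k1 * k2 * q -gE * k2 ^ 2 * r -gF * k1 * k2 * p +gF *
      k2 * t1 * t2 -k1 * k2 * q * t2 -k1 * k2 * s * t1 -k2 ^ 2 * r * t2)
    (c214 := -2 * h * q -h * r +a * f * r -2 * a * gA * r -4 * a * gB * s +2 * a * gC * r -2 * a * gD * p
      -a * gD * s -2 * a * gE * q +3 * a * gE * r +2 * a * gF * s +a * h * p -a * h * s -2 * a * q
      * t2 -a * r * t2 -f * gA * gD -f * gA * h -4 * f * gB * gE -4 * f * gB * t2 +5 * f * gD * gE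
      -3 * f * gD * t2 +2 * f * gE * gF -2 * f * gE * h +2 * f * gF * t2 -f * k1 * p -3 * f * k1 *
      s +f ^ 2 * gD -3 * gA * gE * h -gA * h * t2 +2 * gA * k1 * s -2 * gA * k2 * s +gA ^ 2 * h -2
      * gB * gD * h +4 * gB * h * t1 +2 * gB * h ^ 2 +6 * gB * k1 * q -2 * gB * k1 * r +2 * gB *
      k2 * r +4 * gB ^ 2 * h -2 * gC * gE * h +2 * gC * h * t2 +4 * gD * h * t1 -gD * k1 * q +2 *
      gD * k2 * q -4 * gD * k2 * r -gE * k1 * p -2 * gE * k2 * p -4 * gF * h * t1 -2 * gF * k1 * q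
      +2 * gF * k2 * r +4 * h * k1 * q +h * k2 * r +k1 * p * t2 +2 * k1 * q * t1 -2 * k2 * p * t2
      +2 * k2 * r * t1 -a * f * gA * gE -a * f * gA * t2 +a * f * gB * gD +a * f * gD * t1 +a * gA
      * gB * gD +2 * a * gA * gC * gE +2 * a * gA * gC * t2 -a * gA * gD * gF +a * gA * gD * t1 +a
      * gA * gE ^ 2 +a * gA * gF * h +2 * a * gA * k1 * q -a * gA * t2 ^ 2 -a * gA ^ 2 * gE -a *
      gA ^ 2 * t2 -2 * a * gB * gC * gD -a * gB * gD * gE -a * gB * gD * t2 +2 * a * gB * gE * gF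
      +2 * a * gB * gF * t2 +2 * a * gB * h * t2 -2 * a * gB * k1 * p -a * gB * k1 * s -a * gC *
      gD * h -2 * a * gC * gD * t1 +a * gC * gD ^ 2 -2 * a * gC * gE ^ 2 +a * gC * k1 * r +2 * a *
      gC * t2 ^ 2 +a * gD * gE * t1 -2 * a * gD * k2 * s +a * gD * t1 * t2 -2 * a * gE * gF * t1
      -2 * a * gE * h * t1 -a * gE * k1 * q +2 * a * gE * k2 * r +a * gF * k1 * p -2 * a * gF * t1
      * t2 -2 * a * k1 * p * t1 +a * k1 * q * t2 +a * k1 * s * t1 +2 * a * k2 * r * t2 -a ^ 2 * gA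
      * s +a ^ 2 * gB * r -a ^ 2 * gD * q +a ^ 2 * gE * p +a ^ 2 * gE * s -a ^ 2 * gF * r +a ^ 2 *
      p * t2 +a ^ 2 * r * t1 -a ^ 2 * s * t2 -f * gA * gF * k1 -2 * f * gB * k1 * t2 +f * gC * gD
      * k1 +2 * f * gE * k1 * t1 -gA * gB * gE * k1 +gA * gB * k1 * t2 -gA * gC * gD * k1 -gA * gD
      * gE * k2 -gA * gD * k2 * t2 +2 * gA * gE * gF * k2 -gA * gE * h * k2 -gA * gE * k1 * t1 +2
      * gA * gF * k2 * t2 -gA * h * k2 * t2 +gA * k1 * k2 * s +gA * k1 * t1 * t2 +gA ^ 2 * gF * k1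
      +2 * gB * gC * gE * k1 -2 * gB * gC * k1 * t2 -2 * gB * gD * gF * k2 +gB * gD * h * k2 +gB *
      gD ^ 2 * k2 -gB * k1 * k2 * r +gB * k1 ^ 2 * q +gB ^ 2 * gD * k1 -2 * gB ^ 2 * gF * k1 +2 *
      gC * gE * k1 * t1 -2 * gC * k1 * t1 * t2 -gC * k1 ^ 2 * p -2 * gD * gF * k2 * t1 +gD * h *
      k2 * t1 +gD * k1 * k2 * q -gD * k1 * t1 ^ 2 +gD ^ 2 * k2 * t1 -gE * k1 * k2 * p +2 * gF * k1
      * t1 ^ 2 -k1 * k2 * p * t2 -k1 * k2 * r * t1 -k1 ^ 2 * q * t1)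
    (c304 := f * r -h * p +h * s -a * gA * s +a * gB * r +a * gD * q +2 * a * gD * r -a * gE * p +3 * a *
      gE * s -a * gF * r -a * h * r -a * p * t2 +a * r * t1 +a * s * t2 -f * gB * gD -f * gD * gF
      -f * gD * h -f * gD * t1 +2 * f * gD ^ 2 +2 * f * gE * t2 +2 * f * gE ^ 2 -3 * f * k1 * r
      +gA * gB * h -2 * gA * gD * h +gA * gF * h +gA * h * t1 +gA * h ^ 2 +gA * k1 * q -2 * gB *
      gE * h +2 * gB * h * t2 +gB * k1 * p -2 * gD * k1 * p +gD * k2 * s -4 * gE * h * t1 -3 * gE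
      * k1 * q +gE * k2 * r +gF * k1 * p +4 * h * k1 * p +k1 * p * t1 +k1 * q * t2 -2 * k1 * s *
      t1 +k2 * r * t2 +a * gA * gB * gE +a * gA * gB * t2 +a * gA * gE * h +a * gA * gE * t1 +a *
      gA * h * t2 -a * gA * k1 * s +a * gA * t1 * t2 +a * gB * gD * gF -a * gB * gD * h -2 * a *
      gB * gD * t1 +2 * a * gB * gE * t2 +a * gB * k1 * r +2 * a * gB * t2 ^ 2 -a * gB ^ 2 * gD -a
      * gC * gD * gE -a * gC * gD * t2 +a * gD * gF * t1 -a * gD * h * t1 -a * gD * k1 * q -a * gD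
      * t1 ^ 2 +a * gE * k1 * p -2 * a * gE * t1 * t2 -2 * a * gE ^ 2 * t1 +a * k1 * p * t2 +a *
      k1 * r * t1 +a ^ 2 * gD * s -a ^ 2 * gE * r -a ^ 2 * r * t2 -f * gA * gE * k1 -f * gA * k1 *
      t2 +f * gB * gD * k1 +f * gD * k1 * t1 -gA * gB * gF * k1 +gA * gC * gE * k1 +gA * gC * k1 *
      t2 +2 * gA * gE * k2 * t2 +gA * gE ^ 2 * k2 -gA * gF * k1 * t1 +gA * k1 ^ 2 * q +gA * k2 *
      t2 ^ 2 -gB * gD * gE * k2 -gB * gD * k2 * t2 +2 * gB * gE * k1 * t1 -2 * gB * k1 * t1 * t2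
      -gB * k1 ^ 2 * p -2 * gB ^ 2 * k1 * t2 -gD * gE * k2 * t1 -gD * k2 * t1 * t2 +2 * gE * k1 *
      t1 ^ 2 -k1 ^ 2 * p * t1)
    (c025 := -a * p * s +a * p ^ 2 +a * q * r +a * q ^ 2 +f * gA * s -3 * f * gB * r -3 * f * gC * s +f *
      gE * s -f * gF * q +f * gF * r -2 * f * h * q +2 * f * p * t2 -f * r * t1 -f * s * t2 +2 * f
      ^ 2 * s -gA * h * q +3 * gB * h * p +4 * gC * h * q -gC * h * r -gE * h * q -h * p * t1 +h *
      q * t2 -k1 * p * q +k2 * p * r +k2 * q * s -k2 * r * s -2 * a * f * gB * s +2 * a * f * gC *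
      r +2 * a * f * s * t1 -a * gA * gC * r -a * gA * gE * q +a * gA * q * t2 +a * gB * gC * s +a
      * gB * gD * q -a * gB * gE * p -a * gB * gE * s -a * gB * gF * q -a * gB * gF * r +2 * a *
      gB * h * q -3 * a * gB * p * t2 +a * gB * s * t2 +a * gB ^ 2 * r +a * gC * gD * p +2 * a *
      gC * gE * r +a * gC * gF * p -2 * a * gC * h * p -2 * a * gC * r * t2 -a * gC * s * t1 -a *
      gC ^ 2 * r -a * gD * q * t1 -a * gE * gF * p +3 * a * gE * p * t1 -2 * a * gE * q * t2 +a *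
      gE * s * t1 +a * gE ^ 2 * q +a * gF * p * t2 +a * gF * q * t1 +a * gF * r * t1 -2 * a * h *
      q * t1 +a * p * t1 * t2 +a * q * t2 ^ 2 -a * r * t1 ^ 2 -a * s * t1 * t2 +f * gA * gE * gF
      -f * gA * gF * t2 -f * gB * gD * gF +2 * f * gB * gE * t2 +f * gB * gF ^ 2 -2 * f * gB * t2
      ^ 2 -f * gC * gE * gF +f * gC * gF * t2 +f * gD * gF * t1 -2 * f * gE * k2 * s +2 * f * gE *
      t1 * t2 -2 * f * gE ^ 2 * t1 +2 * f * gF * k2 * r -f * gF ^ 2 * t1 +2 * f * k2 * s * t2 -gA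
      * gC * gE * h +gA * gC * h * t2 -gA * gE * k2 * s -gA * gF * k2 * r +gA * k2 * s * t2 +gB *
      gC * gD * h -gB * gC * gF * h -gB * gC * k1 * r +gB * gD * k2 * s +2 * gB * gE * h * t1 -gB
      * gE * k1 * q +gB * gE * k2 * r +2 * gB * gF * k1 * p +2 * gB * h * t1 * t2 +gB * k1 * q *
      t2 -2 * gB * k1 * s * t1 -3 * gB * k2 * r * t2 -2 * gB ^ 2 * h * t2 +gB ^ 2 * k1 * s -gC *
      gD * h * t1 -gC * gE * k1 * p +gC * gE * k2 * s +gC * gF * h * t1 -gC * gF * k2 * r +gC * k1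
      * p * t2 +gC * k1 * r * t1 -gC * k2 * s * t2 +gC ^ 2 * gE * h -gC ^ 2 * h * t2 +gD * gF * k2
      * p -gD * k2 * s * t1 -gE * gF * k2 * q +2 * gE * h * k2 * q -2 * gE * h * t1 ^ 2 +gE * k1 *
      q * t1 +3 * gE * k2 * r * t1 -gE ^ 2 * k2 * p -2 * gF * h * k2 * p -2 * gF * k1 * p * t1 +gF
      * k2 * q * t2 +gF ^ 2 * k2 * p -2 * h * k2 * q * t2 -k1 * q * t1 * t2 +k1 * s * t1 ^ 2 +k2 *
      p * t2 ^ 2 -k2 * r * t1 * t2)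
    (c115 := -2 * a * p * r -2 * a * q * s -2 * f * gA * r -4 * f * gB * s -2 * f * gE * q +6 * f * gE *
      r +2 * f * gF * s -2 * f * h * p -2 * f * h * s -2 * f * q * t2 -2 * f * r * t2 +2 * f ^ 2 *
      r +2 * gA * h * p +6 * gB * h * q -2 * gB * h * r -4 * gE * h * p -2 * gF * h * q +2 * h * q
      * t1 +2 * h * r * t1 +2 * h ^ 2 * q +2 * k1 * p * s -2 * k1 * q * r +2 * k1 * q ^ 2 -2 * k2
      * p * s +2 * k2 * q * r -2 * k2 * r ^ 2 -2 * a * f * gA * s +2 * a * f * gB * r +2 * a * f *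
      gE * s -2 * a * f * gF * r +2 * a * f * r * t1 -2 * a * f * s * t2 +2 * a * gA * gC * s -2 *
      a * gA * gE * p +2 * a * gA * h * q -2 * a * gA * p * t2 -2 * a * gB * gC * r +2 * a * gB *
      gD * p -2 * a * gB * gD * s +2 * a * gB * gF * s -2 * a * gB * h * p -2 * a * gC * gD * q +2
      * a * gC * gD * r +2 * a * gC * gE * p -2 * a * gC * gE * s +2 * a * gC * p * t2 -2 * a * gC
      * r * t1 +2 * a * gC * s * t2 +2 * a * gD * gE * q -2 * a * gD * gF * p +2 * a * gD * p * t1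
      -2 * a * gD * q * t2 +2 * a * gD * s * t1 -2 * a * gE * h * q +2 * a * gF * h * p -2 * a *
      gF * s * t1 -2 * a * h * p * t1 +2 * a * h * q * t2 +2 * f * gA * gE ^ 2 -2 * f * gA * t2 ^
      2 -2 * f * gB * gD * gE +2 * f * gB * gD * t2 +2 * f * gB * gE * gF +2 * f * gB * gF * t2 -2
      * f * gB * k1 * s -2 * f * gC * gE ^ 2 +2 * f * gC * k1 * r +2 * f * gC * t2 ^ 2 -2 * f * gD
      * gE * t1 -2 * f * gD * k2 * s +2 * f * gD * t1 * t2 -2 * f * gE * gF * t1 +2 * f * gE * k2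
      * r -2 * f * gF * t1 * t2 +2 * f * k1 * s * t1 +2 * f * k2 * r * t2 -2 * gA * gB * gE * h -2
      * gA * gB * h * t2 +2 * gA * gB * k1 * s -2 * gA * gC * k1 * r +2 * gA * gE * h * t1 -2 * gA
      * gE * k1 * q -2 * gA * gE * k2 * r +2 * gA * gF * k1 * p +2 * gA * gF * k2 * s +2 * gA * h
      * t1 * t2 +2 * gA * k1 * q * t2 -2 * gA * k1 * s * t1 -2 * gA * k2 * r * t2 +2 * gB * gC *
      gE * h -2 * gB * gC * h * t2 +2 * gB * gD * k2 * r -2 * gB * gF * k1 * q -2 * gB * gF * k2 *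
      r +2 * gB * h * k1 * q +2 * gB ^ 2 * gD * h -2 * gB ^ 2 * gF * h +2 * gC * gE * h * t1 +2 *
      gC * gE * k1 * q -2 * gC * h * k1 * p -2 * gC * h * t1 * t2 -2 * gC * k1 * q * t2 -2 * gD *
      gF * k2 * q +2 * gD * h * k2 * q -2 * gD * h * t1 ^ 2 +2 * gD * k2 * r * t1 +2 * gE * gF *
      k2 * p -2 * gE * h * k2 * p +2 * gF * h * t1 ^ 2 +2 * gF * k1 * q * t1 +2 * gF * k2 * p * t2
      -2 * gF * k2 * r * t1 -2 * h * k1 * q * t1 -2 * h * k2 * p * t2)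
    (c205 := -a * p * s +a * q * r +a * r ^ 2 +a * s ^ 2 -f * gB * r -f * gD * q +4 * f * gD * r +3 * f *
      gE * s -f * gF * r -2 * f * h * r -f * r * t1 +f * s * t2 +gA * h * q -gA * h * r +gB * h *
      p -3 * gD * h * p -3 * gE * h * q +gF * h * p +h * p * t1 +h * q * t2 -2 * h * s * t1 +2 * h
      ^ 2 * p +k1 * p * q -k1 * p * r -k1 * q * s +k2 * r * s +2 * a * f * gD * s -2 * a * f * gE
      * r -2 * a * f * r * t2 +a * gA * gB * s -a * gA * gD * s +a * gA * gE * q +a * gA * gE * r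
      +a * gA * q * t2 +a * gA * r * t2 +a * gA * s * t1 -2 * a * gB * gD * q +a * gB * gE * p +a
      * gB * gE * s +a * gB * gF * r +a * gB * p * t2 -2 * a * gB * r * t1 +3 * a * gB * s * t2 -a
      * gB ^ 2 * r -a * gC * gD * s -a * gC * gE * r -a * gC * r * t2 -a * gD * gE * p +a * gD *
      gF * q -2 * a * gD * h * q -a * gD * p * t2 -2 * a * gD * q * t1 +a * gD ^ 2 * q +2 * a * gE
      * h * p +a * gE * p * t1 -3 * a * gE * s * t1 -a * gE ^ 2 * q +a * gF * r * t1 +2 * a * h *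
      p * t2 +a * p * t1 * t2 +a * q * t2 ^ 2 -a * r * t1 ^ 2 -a * s * t1 * t2 +f * gA * gD * gE
      +f * gA * gD * t2 -2 * f * gA * k1 * s +f * gB * gD * gF -f * gB * gD ^ 2 +2 * f * gB * gE *
      t2 +2 * f * gB * k1 * r +2 * f * gB * t2 ^ 2 -f * gC * gD * gE -f * gC * gD * t2 +f * gD *
      gF * t1 -f * gD ^ 2 * t1 -2 * f * gE * t1 * t2 -2 * f * gE ^ 2 * t1 +2 * f * k1 * r * t1 +gA
      * gB * gD * h -gA * gB * gF * h -gA * gB * k1 * r +gA * gC * gE * h +gA * gC * h * t2 +gA *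
      gC * k1 * s +gA * gD * h * t1 -gA * gD * k1 * q +2 * gA * gE * k2 * s -gA * gF * h * t1 -gA
      * gF * k1 * q +2 * gA * h * k1 * q -gA * k1 * r * t1 +2 * gA * k2 * s * t2 -gA ^ 2 * gE * h
      -gA ^ 2 * h * t2 +gA ^ 2 * k1 * s +gB * gD * k1 * p -gB * gD * k2 * s +2 * gB * gE * h * t1
      +gB * gE * k1 * q -gB * gE * k2 * r -gB * gF * k1 * p -2 * gB * h * k1 * p -2 * gB * h * t1
      * t2 -3 * gB * k1 * q * t2 -gB * k2 * r * t2 -2 * gB ^ 2 * h * t2 -gB ^ 2 * k1 * s +gC * gE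
      * k1 * p +gC * k1 * p * t2 -gD * gE * k2 * q +gD * k1 * p * t1 -gD * k2 * q * t2 -gD * k2 *
      s * t1 +2 * gE * h * t1 ^ 2 +3 * gE * k1 * q * t1 +2 * gE * k2 * p * t2 -gE * k2 * r * t1
      +gE ^ 2 * k2 * p -gF * k1 * p * t1 -2 * h * k1 * p * t1 -k1 * q * t1 * t2 +k1 * s * t1 ^ 2
      +k2 * p * t2 ^ 2 -k2 * r * t1 * t2)
    (c016 := -f * p * r -2 * f * q * s +f * r * s +h * p ^ 2 -h * q * r +2 * h * q ^ 2 -a * f * p * s +a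
      * f * q * r -a * gA * q * r +a * gB * p * r -a * gB * r * s +2 * a * gC * p * s -2 * a * gC
      * q * r +a * gC * r ^ 2 +a * gD * p * q -a * gE * p * s -a * gE * p ^ 2 +2 * a * gE * q * r
      -a * gF * p * r +a * p * r * t1 +a * p * s * t2 -a * p ^ 2 * t2 -2 * a * q * r * t2 +a * r *
      s * t1 +f * gA * gE * s +f * gA * gF * r -f * gA * s * t2 -f * gB * gD * s -f * gB * gE * r
      +2 * f * gB * gF * s -f * gB * h * s +3 * f * gB * r * t2 -2 * f * gC * gE * s +f * gC * h *
      r +2 * f * gC * s * t2 -f * gD * gF * p +f * gD * s * t1 -f * gE * h * q -3 * f * gE * r *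
      t1 +f * gE ^ 2 * p +f * gF * h * p -2 * f * gF * s * t1 +f * h * q * t2 +f * h * s * t1 -f *
      p * t2 ^ 2 +f * r * t1 * t2 +f ^ 2 * gE * s -f ^ 2 * gF * r -f ^ 2 * s * t2 -gA * gC * h * r
      -gA * gE * h * q +gA * h * q * t2 -gA * k2 * r * s +gB * gD * h * q -gB * gE * h * p -2 * gB
      * gF * h * q -3 * gB * h * p * t2 +gB * h ^ 2 * q +2 * gB * k1 * p * s -gB * k1 * q * r +gB
      * k2 * r ^ 2 +gB ^ 2 * h * r +gC * gD * h * p +2 * gC * gE * h * q -2 * gC * h * q * t2 -gC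
      * h ^ 2 * p -gC * k1 * p * r -gD * h * q * t1 +gD * k2 * p * s +3 * gE * h * p * t1 -gE * k1
      * p * q -gE * k2 * p * r +2 * gF * h * q * t1 +gF * k1 * p ^ 2 +2 * gF * k2 * p * s -2 * gF
      * k2 * q * r -h * k2 * p * s +h * k2 * q * r +h * p * t1 * t2 -h * r * t1 ^ 2 -h ^ 2 * q *
      t1 +k1 * p * q * t2 -2 * k1 * p * s * t1 +k1 * q * r * t1 -k2 * p * r * t2 +k2 * r ^ 2 * t1)
    (c106 := -f * q * r +2 * f * r ^ 2 +f * s ^ 2 +h * p * q -2 * h * p * r -h * q * s +a * gA * q * s +a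
      * gB * p * s -2 * a * gB * q * r +a * gB * s ^ 2 -a * gC * r * s -2 * a * gD * p * s +2 * a
      * gD * q * r -a * gD * q ^ 2 +a * gE * p * q -a * gE * q * s +a * gF * q * r +a * h * p * s
      -a * h * q * r +a * p * q * t2 +a * p * s * t1 -2 * a * q * r * t1 +a * q * s * t2 -a * s ^
      2 * t1 +2 * f * gA * gE * r -f * gA * h * s +2 * f * gA * r * t2 -2 * f * gB * gD * r +f *
      gB * gE * s +f * gB * gF * r +f * gB * h * r +3 * f * gB * s * t2 -f * gC * gD * s -f * gC *
      gE * r -f * gC * r * t2 +f * gD * gF * q -f * gD * h * q -2 * f * gD * r * t1 +f * gE * h *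
      p -3 * f * gE * s * t1 -f * gE ^ 2 * q +f * gF * r * t1 +f * h * p * t2 +f * h * r * t1 -f *
      k1 * p * s +f * k1 * q * r +f * q * t2 ^ 2 -f * s * t1 * t2 +f ^ 2 * gD * s -f ^ 2 * gE * r
      -f ^ 2 * r * t2 +gA * gC * h * s -2 * gA * gE * h * p -gA * gF * h * q -2 * gA * h * p * t2
      +gA * h ^ 2 * q +2 * gA * k1 * p * s -2 * gA * k1 * q * r +gA * k2 * s ^ 2 +2 * gB * gD * h
      * p +gB * gE * h * q -gB * gF * h * p -3 * gB * h * q * t2 -gB * h ^ 2 * p -gB * k1 * q * s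
      -gB * k2 * r * s -gB ^ 2 * h * s +gC * gE * h * p +gC * h * p * t2 +gC * k1 * p * s +2 * gD
      * h * p * t1 -gD * k2 * q * s +3 * gE * h * q * t1 +gE * k1 * q ^ 2 +2 * gE * k2 * p * s -gE
      * k2 * q * r -gF * h * p * t1 -gF * k1 * p * q -h * q * t1 * t2 +h * s * t1 ^ 2 -h ^ 2 * p *
      t1 +k1 * q * s * t1 -k1 * q ^ 2 * t2 +2 * k2 * p * s * t2 -k2 * q * r * t2 -k2 * r * s * t1)
    (c007 := a * p * q * s -a * p * r * s +a * q * r ^ 2 -a * q ^ 2 * r +f * gA * r * s -f * gB * r ^ 2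
      +f * gB * s ^ 2 -f * gC * r * s -f * gD * p * s +f * gE * p * r -f * gE * q * s +f * gF * q
      * r +f * p * r * t2 +f * q * s * t2 -f * r ^ 2 * t1 -f * s ^ 2 * t1 -gA * h * q * r +gB * h
      * p * r -gB * h * q * s +gC * h * p * s +gD * h * p * q -gE * h * p ^ 2 +gE * h * q ^ 2 -gF
      * h * p * q +h * p * r * t1 -h * p ^ 2 * t2 +h * q * s * t1 -h * q ^ 2 * t2 -k1 * p * q * r
      +k1 * p ^ 2 * s +k2 * p * s ^ 2 -k2 * q * r * s)
    (fun s' t' => by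
      have := hc.frob hF (s', 1, t')
      simp only [M3.L_apply, X1_apply, X2_apply, X3_apply, Jm, det3, Prod.fst_add, Prod.snd_add,
        Prod.fst_sub, Prod.snd_sub, Prod.smul_fst, Prod.smul_snd, smul_eq_mul] at this
      linear_combination this)
  obtain ⟨h0, h1, h2, h3, h4, h5, h6, h7, h8, h9, h10, h11, h12, h13, h14, h15, h16, h17, h18, h19, h20⟩ := key
  exact ⟨h0, h1, h2, h3, h4, h5, h6, h7, h8, h9, h10, h11, h12, h13, h14, h15, h16, h17, h18, h19, h20⟩

/-- the desired conclusion in coordinates (up to the vector `u`) -/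
def Concl (F : E3 → ℝ) (A B : M3) : Prop := ∃ u : E3, ∀ (l1 l2 l3 : ℝ) (x : E3),
  HasLineDerivAt ℝ F 0 x (l1 • A.L x + l2 • B.L x + l3 • Jm.L x
    - (l1 * x.1 + l2 * x.2.1 + l3 * x.2.2) • u)

lemma ld_comp_iff {F : E3 → ℝ} (T : M3) (x v : E3) :
    HasLineDerivAt ℝ (fun x => F (T.L x)) 0 x v ↔ HasLineDerivAt ℝ F 0 (T.L x) (T.L v) := by
  have : (fun t : ℝ => F (T.L (x + t • v))) = fun t : ℝ => F (T.L x + t • T.L v) := by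
    funext t; rw [map_add, map_smul]
  constructor
  · intro h
    have h' : HasDerivAt (fun t : ℝ => F (T.L (x + t • v))) 0 0 := h
    rw [this] at h'
    exact h'
  · intro h
    have h' : HasDerivAt (fun t : ℝ => F (T.L x + t • T.L v)) 0 0 := h
    rw [← this] at h'
    exact h'

/-- shear -/
def Sh (d1 d2 : ℝ) : M3 := ⟨1, 0, d1, 0, 1, d2, 0, 0, 1⟩
/-- rotation -/
def Ro (c s : ℝ) : M3 := ⟨c, -s, 0, s, c, 0, 0, 0, 1⟩

def shA (d1 d2 : ℝ) (A : M3) : M3 :=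
  ⟨A.a11 - d1 * A.a31 + d2, A.a12 + d1 - d1 * A.a32,
    A.a11 * d1 + (A.a12 + d1) * d2 + A.a13 - d1 * (A.a31 * d1 + A.a32 * d2 + A.a33),
   A.a21 - d1 - d2 * A.a31 - d1, A.a22 - d2 * A.a32,
    (A.a21 - d1) * d1 + A.a22 * d2 + A.a23 - d2 * (A.a31 * d1 + A.a32 * d2 + A.a33),
   A.a31, A.a32, A.a31 * d1 + A.a32 * d2 + A.a33⟩

def shB (d1 d2 : ℝ) (B : M3) : M3 :=
  ⟨B.a11 - d1 * B.a31, B.a12 + d2 - d1 * B.a32 + d2,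
    B.a11 * d1 + (B.a12 + d2) * d2 + B.a13 - d1 * (B.a31 * d1 + B.a32 * d2 + B.a33),
   B.a21 - d2 - d2 * B.a31, B.a22 - d2 * B.a32 - d1,
    (B.a21 - d2) * d1 + B.a22 * d2 + B.a23 - d2 * (B.a31 * d1 + B.a32 * d2 + B.a33),
   B.a31, B.a32, B.a31 * d1 + B.a32 * d2 + B.a33⟩

lemma sh_nm {F : E3 → ℝ} (hF : Nm F) (d1 d2 : ℝ) : Nm (fun x => F ((Sh d1 d2).L x)) := by
  refine hF.comp_inj ((Sh d1 d2).L : E3 →ₗ[ℝ] E3) ?_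
  rintro ⟨x, y, z⟩ h
  have h' : (Sh d1 d2).L (x, y, z) = 0 := h
  simp only [M3.L_apply, Sh, Prod.mk_eq_zero] at h' ⊢
  obtain ⟨h1, h2, h3⟩ := h'
  have hz : z = 0 := by linarith
  subst hz
  refine ⟨?_, ?_, ?_⟩ <;> linarith

lemma ro_nm {F : E3 → ℝ} (hF : Nm F) {c s : ℝ} (hcs : c ^ 2 + s ^ 2 = 1) :
    Nm (fun x => F ((Ro c s).L x)) := by
  refine hF.comp_inj ((Ro c s).L : E3 →ₗ[ℝ] E3) ?_
  rintro ⟨x, y, z⟩ h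
  have h' : (Ro c s).L (x, y, z) = 0 := h
  simp only [M3.L_apply, Ro, Prod.mk_eq_zero] at h' ⊢
  obtain ⟨h1, h2, h3⟩ := h'
  refine ⟨?_, ?_, ?_⟩
  · linear_combination c * h1 + s * h2 - x * hcs
  · linear_combination c * h2 - s * h1 - y * hcs
  · linarith

lemma CT.shift {F : E3 → ℝ} {A B : M3} (h : CT F A B) (d1 d2 : ℝ) :
    CT (fun x => F ((Sh d1 d2).L x)) (shA d1 d2 A) (shB d1 d2 B) := by
  rintro l1 l2 l3 ⟨x, y, z⟩ hl
  rw [ld_comp_iff]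
  simp only at hl
  have := h l1 l2 (l3 - d1 * l1 - d2 * l2) ((Sh d1 d2).L (x, y, z)) (by
    simp only [M3.L_apply, Sh]; linear_combination hl)
  refine ld_congr this rfl ?_
  simp only [M3.L_apply, Sh, shA, shB, Jm, Prod.smul_mk, Prod.mk_add_mk, smul_eq_mul, Prod.mk.injEq]
  refine ⟨?_, ?_, ?_⟩
  · linear_combination (-d2) * hl
  · linear_combination (d1) * hl
  · ring

lemma Concl.unshift {F : E3 → ℝ} {A B : M3} {d1 d2 : ℝ}
    (h : Concl (fun x => F ((Sh d1 d2).L x)) (shA d1 d2 A) (shB d1 d2 B)) : Concl F A B := by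
  obtain ⟨⟨u1, u2, u3⟩, hu⟩ := h
  refine ⟨(u1 + d1 * u3 - d2, u2 + d2 * u3 + d1, u3), ?_⟩
  rintro l1 l2 l3 ⟨x, y, z⟩
  have := hu l1 l2 (l3 + d1 * l1 + d2 * l2) (x - d1 * z, y - d2 * z, z)
  rw [ld_comp_iff] at this
  refine ld_congr this ?_ ?_
  · simp only [M3.L_apply, Sh, Prod.mk.injEq]
    refine ⟨?_, ?_, ?_⟩ <;> ring
  simp only [M3.L_apply, Sh, shA, shB, Jm, Prod.smul_mk, Prod.mk_add_mk, Prod.mk_sub_mk, smul_eq_mul, Prod.mk.injEq]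
  refine ⟨?_, ?_, ?_⟩ <;> ring

def rc (c s : ℝ) (A : M3) : M3 :=
  ⟨c * (c * A.a11 + s * A.a12) + s * (c * A.a21 + s * A.a22),
   c * (-s * A.a11 + c * A.a12) + s * (-s * A.a21 + c * A.a22),
   c * A.a13 + s * A.a23,
   -s * (c * A.a11 + s * A.a12) + c * (c * A.a21 + s * A.a22),
   -s * (-s * A.a11 + c * A.a12) + c * (-s * A.a21 + c * A.a22),
   -s * A.a13 + c * A.a23,
   c * A.a31 + s * A.a32, -s * A.a31 + c * A.a32, A.a33⟩

def lc (a : ℝ) (A : M3) (b : ℝ) (B : M3) : M3 :=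
  ⟨a * A.a11 + b * B.a11, a * A.a12 + b * B.a12, a * A.a13 + b * B.a13,
   a * A.a21 + b * B.a21, a * A.a22 + b * B.a22, a * A.a23 + b * B.a23,
   a * A.a31 + b * B.a31, a * A.a32 + b * B.a32, a * A.a33 + b * B.a33⟩

lemma CT.rot {F : E3 → ℝ} {A B : M3} (h : CT F A B) {c s : ℝ} (hcs : c ^ 2 + s ^ 2 = 1) :
    CT (fun x => F ((Ro c s).L x)) (rc c s (lc c A s B)) (rc c s (lc (-s) A c B)) := by
  rintro l1 l2 l3 ⟨x, y, z⟩ hl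
  rw [ld_comp_iff]
  simp only at hl
  have := h (c * l1 - s * l2) (s * l1 + c * l2) l3 ((Ro c s).L (x, y, z)) (by
    simp only [M3.L_apply, Ro]; linear_combination hl + (l1 * x + l2 * y) * hcs)
  refine ld_congr this rfl ?_
  have hc : c ^ 2 = 1 - s ^ 2 := by linarith
  cases A; cases B
  simp only [M3.L_apply, Ro, rc, lc, Jm, Prod.smul_mk, Prod.mk_add_mk, smul_eq_mul, Prod.mk.injEq]
  refine ⟨?_, ?_, ?_⟩
  · ring_nf
    simp only [hc, show c ^ 3 = c * (1 - s^2) by rw [← hc]; ring, show c ^ 4 = (1 - s^2)^2 by rw [← hc]; ring]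
    ring
  · ring_nf
    simp only [hc, show c ^ 3 = c * (1 - s^2) by rw [← hc]; ring, show c ^ 4 = (1 - s^2)^2 by rw [← hc]; ring]
    ring
  · ring

lemma Concl.unrot {F : E3 → ℝ} {A B : M3} {c s : ℝ} (hcs : c ^ 2 + s ^ 2 = 1)
    (h : Concl (fun x => F ((Ro c s).L x)) (rc c s (lc c A s B)) (rc c s (lc (-s) A c B))) :
    Concl F A B := by
  obtain ⟨⟨u1, u2, u3⟩, hu⟩ := h
  refine ⟨(c * u1 - s * u2, s * u1 + c * u2, u3), ?_⟩
  rintro l1 l2 l3 ⟨x, y, z⟩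
  have := hu (c * l1 + s * l2) (-s * l1 + c * l2) l3 (c * x + s * y, -s * x + c * y, z)
  rw [ld_comp_iff] at this
  have hc : c ^ 2 = 1 - s ^ 2 := by linarith
  have h3 : c ^ 3 = c * (1 - s^2) := by rw [← hc]; ring
  have h4 : c ^ 4 = (1 - s^2)^2 := by rw [← hc]; ring
  have h5 : c ^ 5 = c * (1 - s^2)^2 := by rw [← hc]; ring
  have h6 : c ^ 6 = (1 - s^2)^3 := by rw [← hc]; ring
  refine ld_congr this ?_ ?_
  · simp only [M3.L_apply, Ro, Prod.mk.injEq]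
    refine ⟨?_, ?_, ?_⟩
    · linear_combination x * hcs
    · linear_combination y * hcs
    · ring
  cases A; cases B
  simp only [M3.L_apply, Ro, rc, lc, Jm, Prod.smul_mk, Prod.mk_add_mk, Prod.mk_sub_mk, smul_eq_mul, Prod.mk.injEq]
  refine ⟨?_, ?_, ?_⟩
  · ring_nf
    simp only [hc, h3, h4, h5, h6]
    ring
  · ring_nf
    simp only [hc, h3, h4, h5, h6]
    ring
  · ring_nf
    simp only [hc, h3, h4, h5, h6]
    ring

lemma CT.plane {F : E3 → ℝ} (hF : Nm F) {A B : M3} (h : CT F A B) (l1 l2 l3 : ℝ) (u v : E3)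
    (huv : ∀ s t : ℝ, s • u + t • v = 0 → s = 0 ∧ t = 0)
    (hu : l1 * u.1 + l2 * u.2.1 + l3 * u.2.2 = 0) (hv : l1 * v.1 + l2 * v.2.1 + l3 * v.2.2 = 0)
    {α β γ δ : ℝ}
    (hMu : l1 • A.L u + l2 • B.L u + l3 • Jm.L u = α • u + β • v)
    (hMv : l1 • A.L v + l2 • B.L v + l3 • Jm.L v = γ • u + δ • v) :
    α + δ = 0 ∧ (0 < α * δ - β * γ ∨ (α = 0 ∧ β = 0 ∧ γ = 0 ∧ δ = 0)) := by
  let T : E2 →ₗ[ℝ] E3 :=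
    (LinearMap.fst ℝ ℝ ℝ).smulRight u + (LinearMap.snd ℝ ℝ ℝ).smulRight v
  have hT : ∀ s t : ℝ, T (s, t) = s • u + t • v := fun s t => rfl
  have hN : Nm (fun x => F (T x)) := hF.comp_inj T (by
    rintro ⟨s, t⟩ h0
    rw [hT] at h0
    obtain ⟨h1, h2⟩ := huv s t h0
    rw [h1, h2]; rfl)
  refine hN.planar (fun s t => ?_)
  have h1 := h l1 l2 l3 (s • u + t • v) (by
    simp only [Prod.fst_add, Prod.snd_add, Prod.smul_fst, Prod.smul_snd, smul_eq_mul]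
    linear_combination s * hu + t * hv)
  have e1 : l1 • A.L (s • u + t • v) + l2 • B.L (s • u + t • v) + l3 • Jm.L (s • u + t • v)
      = (α * s + γ * t) • u + (β * s + δ * t) • v := by
    have : l1 • A.L (s • u + t • v) + l2 • B.L (s • u + t • v) + l3 • Jm.L (s • u + t • v)
      = s • (l1 • A.L u + l2 • B.L u + l3 • Jm.L u) + t • (l1 • A.L v + l2 • B.L v + l3 • Jm.L v) := by
      simp only [map_add, map_smul]; module
    rw [this, hMu, hMv]; module
  rw [e1] at h1
  have h1' : HasDerivAt (fun r : ℝ => F (s • u + t • v + r • ((α * s + γ * t) • u + (β * s + δ * t) • v))) 0 0 := h1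
  have : (fun r : ℝ => F (s • u + t • v + r • ((α * s + γ * t) • u + (β * s + δ * t) • v)))
    = fun r : ℝ => F (T ((s, t) + r • (α * s + γ * t, β * s + δ * t))) := by
    funext r
    congr 1
    rw [map_add, map_smul, hT, hT]
  rw [this] at h1'
  exact h1'

lemma angle2 (α β : ℝ) : ∃ c s : ℝ, c ^ 2 + s ^ 2 = 1 ∧ (c ^ 2 - s ^ 2) * α + 2 * c * s * β = 0 := by
  have hcont : Continuous (fun θ : ℝ => Real.cos (2 * θ) * α + Real.sin (2 * θ) * β) := by fun_prop
  have key : ∃ θ : ℝ, Real.cos (2 * θ) * α + Real.sin (2 * θ) * β = 0 := by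
    have e0 : Real.cos (2 * 0) * α + Real.sin (2 * 0) * β = α := by simp
    have e1 : Real.cos (2 * (Real.pi / 2)) * α + Real.sin (2 * (Real.pi / 2)) * β = -α := by
      rw [show 2 * (Real.pi / 2) = Real.pi by ring]; simp
    rcases le_total 0 α with ha | ha
    · obtain ⟨θ, hθ⟩ := mem_range_of_exists_le_of_exists_ge hcont (c := 0)
        ⟨Real.pi / 2, by rw [e1]; linarith⟩ ⟨0, by rw [e0]; exact ha⟩
      exact ⟨θ, hθ⟩
    · obtain ⟨θ, hθ⟩ := mem_range_of_exists_le_of_exists_ge hcont (c := 0)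
        ⟨0, by rw [e0]; exact ha⟩ ⟨Real.pi / 2, by rw [e1]; linarith⟩
      exact ⟨θ, hθ⟩
  obtain ⟨θ, hθ⟩ := key
  refine ⟨Real.cos θ, Real.sin θ, Real.cos_sq_add_sin_sq θ, ?_⟩
  rw [Real.cos_two_mul, Real.sin_two_mul] at hθ
  linear_combination hθ + α * (-(Real.cos_sq_add_sin_sq θ))

lemma angle3 (α β : ℝ) : ∃ c s : ℝ, c ^ 2 + s ^ 2 = 1 ∧
    (4 * c ^ 3 - 3 * c) * α + (3 * s - 4 * s ^ 3) * β = 0 := by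
  have hcont : Continuous (fun θ : ℝ => Real.cos (3 * θ) * α + Real.sin (3 * θ) * β) := by fun_prop
  have key : ∃ θ : ℝ, Real.cos (3 * θ) * α + Real.sin (3 * θ) * β = 0 := by
    have e0 : Real.cos (3 * 0) * α + Real.sin (3 * 0) * β = α := by simp
    have e1 : Real.cos (3 * (Real.pi / 3)) * α + Real.sin (3 * (Real.pi / 3)) * β = -α := by
      rw [show 3 * (Real.pi / 3) = Real.pi by ring]; simp
    rcases le_total 0 α with ha | ha
    · obtain ⟨θ, hθ⟩ := mem_range_of_exists_le_of_exists_ge hcont (c := 0)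
        ⟨Real.pi / 3, by rw [e1]; linarith⟩ ⟨0, by rw [e0]; exact ha⟩
      exact ⟨θ, hθ⟩
    · obtain ⟨θ, hθ⟩ := mem_range_of_exists_le_of_exists_ge hcont (c := 0)
        ⟨0, by rw [e0]; exact ha⟩ ⟨Real.pi / 3, by rw [e1]; linarith⟩
      exact ⟨θ, hθ⟩
  obtain ⟨θ, hθ⟩ := key
  refine ⟨Real.cos θ, Real.sin θ, Real.cos_sq_add_sin_sq θ, ?_⟩
  rw [Real.cos_three_mul, Real.sin_three_mul] at hθ
  exact hθ

@[fun_prop] lemma an_fst {V W U : Type*} [NormedAddCommGroup V] [NormedSpace ℝ V] [NormedAddCommGroup W]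
    [NormedSpace ℝ W] [NormedAddCommGroup U] [NormedSpace ℝ U] {f : U → V × W} {x : U}
    (hf : AnalyticAt ℝ f x) : AnalyticAt ℝ (fun x => (f x).1) x :=
  ((ContinuousLinearMap.fst ℝ V W).analyticAt (f x)).fun_comp hf
@[fun_prop] lemma an_snd {V W U : Type*} [NormedAddCommGroup V] [NormedSpace ℝ V] [NormedAddCommGroup W]
    [NormedSpace ℝ W] [NormedAddCommGroup U] [NormedSpace ℝ U] {f : U → V × W} {x : U}
    (hf : AnalyticAt ℝ f x) : AnalyticAt ℝ (fun x => (f x).2) x :=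
  ((ContinuousLinearMap.snd ℝ V W).analyticAt (f x)).fun_comp hf

lemma concl_of {F : E3 → ℝ} (hF : Nm F) {A B : M3} (u : E3) {Z : E3 → ℝ}
    (hZ : ∀ x, AnalyticAt ℝ Z x) {x0 : E3} (hZ0 : Z x0 ≠ 0)
    (h : ∀ (l1 l2 l3 : ℝ) (x : E3), Z x ≠ 0 → HasLineDerivAt ℝ F 0 x (l1 • A.L x + l2 • B.L x
      + l3 • Jm.L x - (l1 * x.1 + l2 * x.2.1 + l3 * x.2.2) • u)) : Concl F A B := by
  refine ⟨u, fun l1 l2 l3 x => ?_⟩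
  exact hF.everywhere (l1 • A.L + l2 • B.L + l3 • Jm.L
    - (l1 • X1 + l2 • X2 + l3 • X3).smulRight u) hZ hZ0 (fun x hx => h l1 l2 l3 x hx) x

lemma conclF2 {F : E3 → ℝ} (hF : Nm F) {t1 t2 a31 a32 b31 b32 f h : ℝ}
    (hc : CT F ⟨0, -t1, 0, t1, 0, 0, a31, a32, f⟩ ⟨0, -t2, 0, t2, 0, 0, b31, b32, h⟩) :
    Concl F ⟨0, -t1, 0, t1, 0, 0, a31, a32, f⟩ ⟨0, -t2, 0, t2, 0, 0, b31, b32, h⟩ := by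
  have hw1 := hc.w1
  have hw2 := hc.w2
  have Q : ∀ x1 x2 t : ℝ, t * ((x1 - t1 * t) * (b31 * x1 + b32 * x2 + h * t)
      - (x2 - t2 * t) * (a31 * x1 + a32 * x2 + f * t)) = 0 := by
    intro x1 x2 t
    by_contra hne
    refine hF.line_absurd (x := (x1, x2, 0)) (v := (0, 0, 1)) (by simp)
      (z := fun t => t * ((x1 - t1 * t) * (b31 * x1 + b32 * x2 + h * t)
      - (x2 - t2 * t) * (a31 * x1 + a32 * x2 + f * t))) (fun t => by fun_prop) t hne ?_
    intro r hr
    have e1 := hw1 ((x1, x2, 0) + r • (0, 0, 1))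
    have e2 := hw2 ((x1, x2, 0) + r • (0, 0, 1))
    have e3 := Nm.smul0 (r * ((x1 - t1 * r) * (b31 * x1 + b32 * x2 + h * r)
      - (x2 - t2 * r) * (a31 * x1 + a32 * x2 + f * r)))⁻¹ (hF.add0 (Nm.smul0 (-(x2 - t2 * r)) e1)
        (Nm.smul0 (x1 - t1 * r) e2))
    refine ld_congr e3 rfl ?_
    simp only [M3.L_apply, X1_apply, X2_apply, X3_apply, Jm, Prod.smul_mk, Prod.mk_add_mk,
      Prod.mk_sub_mk, smul_eq_mul, Prod.mk.injEq]
    refine ⟨by ring, by ring, ?_⟩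
    rw [inv_mul_eq_iff_eq_mul₀ hr]; ring
  have c1 := Q 1 0 1
  have c2 := Q 1 0 (-1)
  have c3 := Q 1 0 2
  have c4 := Q 0 1 1
  have c5 := Q 0 1 (-1)
  have c6 := Q 0 1 2
  have c7 := Q 1 1 1
  have c8 := Q 1 1 (-1)
  have c9 := Q 1 1 2
  norm_num at c1 c2 c3 c4 c5 c6 c7 c8 c9
  have hb31 : b31 = 0 := by linarith
  subst hb31
  have ha32 : a32 = 0 := by linarith
  subst ha32
  have hb32 : b32 = a31 := by linarith
  subst hb32
  have hh : h = - (b32 * t2) := by linarith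
  have hf : f = - (b32 * t1) := by linarith
  have hY : ∀ x, HasLineDerivAt ℝ F 0 x ((⟨0, 1, 0, -1, 0, 0, 0, 0, b32⟩ : M3).L x) := by
    refine hF.everywhere _ (Z := fun x => x.1 - t1 * x.2.2) (fun x => by fun_prop) (x0 := (1, 0, 0))
      (by norm_num) ?_
    rintro ⟨x, y, z⟩ hx
    refine ld_congr (Nm.smul0 (x - t1 * z)⁻¹ (hw1 (x, y, z))) rfl ?_
    simp only at hx
    simp only [M3.L_apply, X1_apply, X2_apply, X3_apply, Jm, Prod.smul_mk, Prod.mk_add_mk,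
      Prod.mk_sub_mk, smul_eq_mul, Prod.mk.injEq]
    subst hf
    refine ⟨?_, ?_, ?_⟩
    · field_simp; ring
    · field_simp; ring
    · field_simp; ring
  have hk : b32 = 0 := by
    refine hF.not_self (x := (0, 0, 1)) (by simp) (ld_congr (hY (0, 0, 1)) rfl ?_)
    simp [M3.L_apply]
  subst hk
  refine ⟨0, ?_⟩
  rintro l1 l2 l3 ⟨x, y, z⟩
  refine ld_congr (Nm.smul0 (-(l1 * t1 + l2 * t2 + l3)) (hY (x, y, z))) rfl ?_
  simp only [M3.L_apply, X1_apply, X2_apply, X3_apply, Jm, Prod.smul_mk, Prod.mk_add_mk,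
      Prod.mk_sub_mk, smul_eq_mul, Prod.mk.injEq, smul_zero, sub_zero, hf, hh]
  refine ⟨by ring, by ring, by ring⟩

lemma conclF3 {F : E3 → ℝ} (hF : Nm F) {t1 t2 p q r s : ℝ}
    (hc : CT F ⟨0, -t1, p, t1, 0, q, 0, 0, 0⟩ ⟨0, -t2, r, t2, 0, s, 0, 0, 0⟩) :
    Concl F ⟨0, -t1, p, t1, 0, q, 0, 0, 0⟩ ⟨0, -t2, r, t2, 0, s, 0, 0, 0⟩ := by
  have hw1 := hc.w1
  have hw2 := hc.w2
  have Q : ∀ x1 x2 : ℝ, ((x1 - t1) * x2 + p) * (- (x2 - t2) * x1 + s)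
      - (-(x1 - t1) * x1 + q) * ((x2 - t2) * x2 + r) = 0 := by
    intro x1 x2
    by_contra hne
    refine hF.line_absurd (x := (0, x2, 1)) (v := (1, 0, 0)) (by simp)
      (z := fun x1 => ((x1 - t1) * x2 + p) * (- (x2 - t2) * x1 + s)
      - (-(x1 - t1) * x1 + q) * ((x2 - t2) * x2 + r)) (fun t => by fun_prop) x1 hne ?_
    intro x1 hr
    have e1 := hw1 ((0, x2, 1) + x1 • (1, 0, 0))
    have e2 := hw2 ((0, x2, 1) + x1 • (1, 0, 0))
    have e3 := Nm.smul0 (((x1 - t1) * x2 + p) * (- (x2 - t2) * x1 + s)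
      - (-(x1 - t1) * x1 + q) * ((x2 - t2) * x2 + r))⁻¹ (hF.add0 (Nm.smul0 (- (x2 - t2) * x1 + s) e1)
        (Nm.smul0 (- (-(x1 - t1) * x1 + q)) e2))
    refine ld_congr e3 rfl ?_
    simp only [M3.L_apply, X1_apply, X2_apply, X3_apply, Jm, Prod.smul_mk, Prod.mk_add_mk,
      Prod.mk_sub_mk, smul_eq_mul, Prod.mk.injEq]
    refine ⟨?_, ?_, ?_⟩
    · rw [inv_mul_eq_iff_eq_mul₀ hr]; ring
    · rw [inv_mul_eq_iff_eq_mul₀ hr]; ring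
    · ring
  have c0 := Q 0 0
  have c1 := Q 1 0
  have c2 := Q (-1) 0
  have c3 := Q 0 1
  have c4 := Q 0 (-1)
  have c5 := Q 1 1
  norm_num at c0 c1 c2 c3 c4 c5
  have hr : r = 0 := by linarith
  subst hr
  have hq : q = 0 := by linarith
  subst hq
  have hs : s = p := by linarith
  subst hs
  have hp : s = 0 := by nlinarith
  subst hp
  exact conclF2 hF hc

lemma conclF1 {F : E3 → ℝ} (hF : Nm F) {t1 t2 a31 a32 b31 b32 k : ℝ} (hk : k ≠ 0)
    (hc : CT F ⟨0, -t1, -k * a31, t1, 0, -k * a32, a31, a32, 0⟩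
      ⟨0, -t2, -k * b31, t2, 0, -k * b32, b31, b32, 0⟩) :
    Concl F ⟨0, -t1, -k * a31, t1, 0, -k * a32, a31, a32, 0⟩
      ⟨0, -t2, -k * b31, t2, 0, -k * b32, b31, b32, 0⟩ := by
  have hw1 := hc.w1
  have hw2 := hc.w2
  let Z : E3 → ℝ := fun x => (x.1 ^ 2 + x.2.1 ^ 2 + k * x.2.2 ^ 2) * (x.2.2 *
    ((x.2.1 - t2 * x.2.2) * (a31 * x.1 + a32 * x.2.1) - (x.1 - t1 * x.2.2) * (b31 * x.1 + b32 * x.2.1)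
      + k * x.2.2 ^ 2 * (a31 * b32 - a32 * b31)))
  by_cases hZ : ∃ x, Z x ≠ 0
  · obtain ⟨x0, hx0⟩ := hZ
    refine concl_of hF 0 (Z := Z) (fun x => by unfold Z; fun_prop) hx0 ?_
    intro l1 l2 l3 x hx
    set w1 := X3 x • (⟨0, -t1, -k * a31, t1, 0, -k * a32, a31, a32, 0⟩ : M3).L x - X1 x • Jm.L x with ew1
    set w2 := X3 x • (⟨0, -t2, -k * b31, t2, 0, -k * b32, b31, b32, 0⟩ : M3).L x - X2 x • Jm.L x with ew2
    set v := l1 • (⟨0, -t1, -k * a31, t1, 0, -k * a32, a31, a32, 0⟩ : M3).L x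
      + l2 • (⟨0, -t2, -k * b31, t2, 0, -k * b32, b31, b32, 0⟩ : M3).L x + l3 • Jm.L x
      - (l1 * x.1 + l2 * x.2.1 + l3 * x.2.2) • (0 : E3) with ev
    have hdet : det3 x w1 w2 = Z x := by
      obtain ⟨x1, x2, x3⟩ := x
      simp only [ew1, ew2, Z, M3.L_apply, X1_apply, X2_apply, X3_apply, Jm, det3, Prod.smul_mk,
        Prod.mk_sub_mk, smul_eq_mul]
      ring
    have hd1 : x.1 * w1.1 + x.2.1 * w1.2.1 + k * x.2.2 * w1.2.2 = 0 := by
      obtain ⟨x1, x2, x3⟩ := x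
      simp only [ew1, M3.L_apply, X1_apply, X2_apply, X3_apply, Jm, Prod.smul_mk,
        Prod.mk_sub_mk, smul_eq_mul]
      ring
    have hd2 : x.1 * w2.1 + x.2.1 * w2.2.1 + k * x.2.2 * w2.2.2 = 0 := by
      obtain ⟨x1, x2, x3⟩ := x
      simp only [ew2, M3.L_apply, X1_apply, X2_apply, X3_apply, Jm, Prod.smul_mk,
        Prod.mk_sub_mk, smul_eq_mul]
      ring
    have hd3 : x.1 * v.1 + x.2.1 * v.2.1 + k * x.2.2 * v.2.2 = 0 := by
      obtain ⟨x1, x2, x3⟩ := x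
      simp only [ev, M3.L_apply, X1_apply, X2_apply, X3_apply, Jm, Prod.smul_mk, Prod.mk_add_mk,
        Prod.mk_sub_mk, smul_eq_mul, smul_zero, sub_zero]
      ring
    have hv0 : det3 v w1 w2 = 0 := by
      by_contra hne
      have g1 : x.1 * det3 v w1 w2 = 0 := by
        simp only [det3]
        linear_combination (w1.2.1 * w2.2.2 - w1.2.2 * w2.2.1) * hd3
          - (v.2.1 * w2.2.2 - v.2.2 * w2.2.1) * hd1 + (v.2.1 * w1.2.2 - v.2.2 * w1.2.1) * hd2
      have g2 : x.2.1 * det3 v w1 w2 = 0 := by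
        simp only [det3]
        linear_combination -(w1.1 * w2.2.2 - w1.2.2 * w2.1) * hd3
          + (v.1 * w2.2.2 - v.2.2 * w2.1) * hd1 - (v.1 * w1.2.2 - v.2.2 * w1.1) * hd2
      have g3 : k * x.2.2 * det3 v w1 w2 = 0 := by
        simp only [det3]
        linear_combination (w1.1 * w2.2.1 - w1.2.1 * w2.1) * hd3
          - (v.1 * w2.2.1 - v.2.1 * w2.1) * hd1 + (v.1 * w1.2.1 - v.2.1 * w1.1) * hd2
      have g1' := (mul_eq_zero.1 g1).resolve_right hne
      have g2' := (mul_eq_zero.1 g2).resolve_right hne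
      have g3' := (mul_eq_zero.1 ((mul_eq_zero.1 g3).resolve_right hne)).resolve_left hk
      apply hx
      simp only [Z, g1', g2', g3']
      ring
    rw [← hdet] at hx
    have e := cramer3 v x w1 w2 hx
    rw [hv0, zero_div, zero_smul, zero_add] at e
    rw [e]
    exact hF.add0 (Nm.smul0 _ (hw1 x)) (Nm.smul0 _ (hw2 x))
  · push Not at hZ
    obtain ⟨-, h1, h2, h3, -, -⟩ := poly5 (a0 := 0) (a1 := -b31) (a2 := - t2 * a31 + t1 * b31)
      (a3 := k * (a31 * b32 - a32 * b31) - k * b31) (a4 := k * (- t2 * a31 + t1 * b31))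
      (a5 := k * (k * (a31 * b32 - a32 * b31))) (fun t => by
        have := hZ (1, 0, t)
        simp only [Z] at this
        linear_combination this)
    obtain ⟨-, h4, h5, -, -, -⟩ := poly5 (a0 := 0) (a1 := a32) (a2 := - t2 * a32 + t1 * b32)
      (a3 := k * (a31 * b32 - a32 * b31) + k * a32) (a4 := k * (- t2 * a32 + t1 * b32))
      (a5 := k * (k * (a31 * b32 - a32 * b31))) (fun t => by
        have := hZ (0, 1, t)
        simp only [Z] at this
        linear_combination this)
    obtain ⟨-, h6, -, -, -, -⟩ := poly5 (a0 := 0) (a1 := 2 * (a31 + a32 - b31 - b32))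
      (a2 := 2 * (- t2 * (a31 + a32) + t1 * (b31 + b32)))
      (a3 := 2 * k * (a31 * b32 - a32 * b31) + k * (a31 + a32 - b31 - b32))
      (a4 := k * (- t2 * (a31 + a32) + t1 * (b31 + b32)))
      (a5 := k * (k * (a31 * b32 - a32 * b31))) (fun t => by
        have := hZ (1, 1, t)
        simp only [Z] at this
        linear_combination this)
    have hb31 : b31 = 0 := by linarith
    subst hb31
    have hb32 : b32 = a31 := by linarith
    subst hb32
    subst h4
    have : b32 = 0 := by
      have : k * (b32 * b32) = 0 := by linarith
      simpa [hk] using this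
    subst this
    simp only [mul_zero] at hc ⊢
    exact conclF2 hF hc

lemma stage3 {F : E3 → ℝ} (hF : Nm F) {t1 t2 a k1 k2 k f h : ℝ} (hk12 : k1 ≠ 0 ∨ k2 ≠ 0)
    (hc : CT F ⟨0, -t1, -k * a, t1, 0, -k * -k2, a, -k2, f⟩
      ⟨0, -t2, -k * k1, t2, 0, -k * a, k1, a, h⟩) :
    Concl F ⟨0, -t1, -k * a, t1, 0, -k * -k2, a, -k2, f⟩
      ⟨0, -t2, -k * k1, t2, 0, -k * a, k1, a, h⟩ := by
  by_cases hk : k = 0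
  · subst hk
    simp only [neg_zero, zero_mul] at hc ⊢
    exact conclF2 hF hc
  by_cases hfh : f = 0 ∧ h = 0
  · obtain ⟨rfl, rfl⟩ := hfh
    exact conclF1 hF hk hc
  exfalso
  have hfh2 : f ^ 2 + h ^ 2 ≠ 0 := by
    intro h0
    apply hfh
    constructor <;> nlinarith [sq_nonneg f, sq_nonneg h]
  have E : Eqs 0 0 0 0 0 0 t1 t2 a k1 k2 (-k * a) (-k * -k2) (-k * k1) (-k * a) f h := by
    refine CT.eqs hF ?_
    simpa only [zero_sub, zero_add] using hc
  have q1 : k2 * (3 * a * f + h * (3 * k2 - 1)) = 0 :=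
    mul_left_cancel₀ hk (by linear_combination E.e034)
  have q2 : f * (k2 - 2 * k1 + 3 * k1 * k2) - 3 * a * h * k2 = 0 :=
    mul_left_cancel₀ hk (by linear_combination E.e124)
  have q3 : h * (k1 - 2 * k2 + 3 * k1 * k2) + 3 * a * f * k1 = 0 :=
    mul_left_cancel₀ hk (by linear_combination E.e214)
  have q4 : k1 * (f * (3 * k1 - 1) - 3 * a * h) = 0 :=
    mul_left_cancel₀ hk (by linear_combination E.e304)
  by_cases h1 : k1 = 0
  · have h2 : k2 ≠ 0 := hk12.resolve_left (fun hn => hn h1)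
    subst h1
    have hh : h = 0 := mul_left_cancel₀ h2 (by linear_combination (-1/2) * q3)
    subst hh
    have hf : f = 0 := mul_left_cancel₀ h2 (by linear_combination q2)
    exact hfh ⟨hf, rfl⟩
  by_cases h2 : k2 = 0
  · subst h2
    have hf : f = 0 := mul_left_cancel₀ h1 (by linear_combination (-1/2) * q2)
    subst hf
    have hh : h = 0 := mul_left_cancel₀ h1 (by linear_combination q3)
    exact hfh ⟨rfl, hh⟩
  have q1' := (mul_eq_zero.1 q1).resolve_left h2
  have q4' := (mul_eq_zero.1 q4).resolve_left h1
  have r1 : h * (k1 - k2) = 0 := by linear_combination (1/2) * q3 - (1/2) * k1 * q1'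
  have r2 : f * (k1 - k2) = 0 := by linear_combination (-1/2) * q2 + (1/2) * k2 * q4'
  have hk' : k1 - k2 = 0 := mul_left_cancel₀ hfh2 (by linear_combination f * r2 + h * r1)
  have hk'' : k1 = k2 := by linarith
  subst hk''
  have ha : a = 0 := mul_left_cancel₀ hfh2
    (by linear_combination (1/3) * f * q1' - (1/3) * h * q4')
  subst ha
  have hk3 : 3 * k1 - 1 = 0 := mul_left_cancel₀ hfh2 (by linear_combination f * q4' + h * q1')
  have hk3' : k1 = 1 / 3 := by linarith
  subst hk3'
  have ht : f * t1 + h * t2 = 0 := mul_left_cancel₀ hk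
    (by linear_combination (9/4) * E.e025 + (9/4) * E.e205)
  have := hc.plane hF f h 0 (-h, f, 0) (0, 0, 1) (by
      intro s t hst
      simp only [Prod.smul_mk, Prod.mk_add_mk, smul_eq_mul, Prod.mk_eq_zero] at hst
      obtain ⟨c1, c2, c3⟩ := hst
      refine ⟨mul_left_cancel₀ hfh2 (by linear_combination f * c2 - h * c1), by linarith⟩)
    (by simp only; ring) (by simp only; ring)
    (α := 0) (β := -(f ^ 2 + h ^ 2) / 3) (γ := k / 3) (δ := f ^ 2 + h ^ 2)
    (by
      simp only [M3.L_apply, Jm, Prod.smul_mk, Prod.mk_add_mk, smul_eq_mul, Prod.mk.injEq]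
      refine ⟨?_, ?_, ?_⟩
      · linear_combination (-f) * ht
      · linear_combination (-h) * ht
      · ring)
    (by
      simp only [M3.L_apply, Jm, Prod.smul_mk, Prod.mk_add_mk, smul_eq_mul, Prod.mk.injEq]
      refine ⟨?_, ?_, ?_⟩ <;> ring)
  exact hfh2 (by linarith [this.1])

lemma indep_e1e3 : ∀ s t : ℝ, s • ((1, 0, 0) : E3) + t • ((0, 0, 1) : E3) = 0 → s = 0 ∧ t = 0 := by
  intro s t hst
  simp only [Prod.smul_mk, Prod.mk_add_mk, smul_eq_mul, Prod.mk_eq_zero] at hst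
  obtain ⟨c1, c2, c3⟩ := hst
  constructor <;> linarith

lemma indep_e2e3 : ∀ s t : ℝ, s • ((0, 1, 0) : E3) + t • ((0, 0, 1) : E3) = 0 → s = 0 ∧ t = 0 := by
  intro s t hst
  simp only [Prod.smul_mk, Prod.mk_add_mk, smul_eq_mul, Prod.mk_eq_zero] at hst
  obtain ⟨c1, c2, c3⟩ := hst
  constructor <;> linarith

lemma CT.plane1 {F : E3 → ℝ} (hF : Nm F) {A B : M3} (h : CT F A B) (h1 : A.a12 = 0) (h2 : A.a13 = 0) :
    A.a22 + A.a33 = 0 ∧ (0 < A.a22 * A.a33 - A.a32 * A.a23 ∨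
      (A.a22 = 0 ∧ A.a32 = 0 ∧ A.a23 = 0 ∧ A.a33 = 0)) := by
  refine h.plane hF 1 0 0 (0, 1, 0) (0, 0, 1) indep_e2e3 (by norm_num) (by norm_num) ?_ ?_ <;>
  simp [M3.L_apply, h1, h2]

lemma CT.plane2 {F : E3 → ℝ} (hF : Nm F) {A B : M3} (h : CT F A B) (h1 : B.a21 = 0) (h2 : B.a23 = 0) :
    B.a11 + B.a33 = 0 ∧ (0 < B.a11 * B.a33 - B.a31 * B.a13 ∨
      (B.a11 = 0 ∧ B.a31 = 0 ∧ B.a13 = 0 ∧ B.a33 = 0)) := by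
  refine h.plane hF 0 1 0 (1, 0, 0) (0, 0, 1) indep_e1e3 (by norm_num) (by norm_num) ?_ ?_ <;>
  simp [M3.L_apply, h1, h2]

lemma caseE2 {F : E3 → ℝ} (hF : Nm F) {t1 t2 s k f h : ℝ}
    (hc : CT F ⟨0, -t1, 0, t1, 0, s + k, 0, -1, f⟩ ⟨0, -t2, s - k, t2, 0, 0, 1, 0, h⟩) :
    Concl F ⟨0, -t1, 0, t1, 0, s + k, 0, -1, f⟩ ⟨0, -t2, s - k, t2, 0, 0, 1, 0, h⟩ := by
  by_cases hs : s = 0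
  · subst hs
    have := stage3 hF (t1 := t1) (t2 := t2) (a := 0) (k1 := 1) (k2 := 1) (k := k) (f := f) (h := h)
      (by norm_num) (by simpa using hc)
    simpa using this
  exfalso
  have E : Eqs 0 0 0 0 0 0 t1 t2 0 1 1 0 (s + k) (s - k) 0 f h := by
    refine CT.eqs hF ?_
    simpa only [zero_sub, zero_add] using hc
  have q1 : h * (k + s) + s * t1 = 0 := by linear_combination (1/2) * E.e034
  have q2 : f * (k - s) + s * t2 = 0 := by linear_combination (1/2) * E.e124
  have q3 : f * h + t1 * t2 = 0 := mul_left_cancel₀ hs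
    (by linear_combination (-1/4) * E.e025 - (1/4) * E.e205)
  have q4 : k * (4 * s - f * t2 - h * t1) = 0 := by
    linear_combination (1/2) * E.e115 + f * q2 - h * q1
  have q5 : f * h * k ^ 2 = 0 := by
    linear_combination h * (k + s) * q2 - s * t2 * q1 + s ^ 2 * q3
  by_cases hk : k = 0
  · subst hk
    have hf : f = t2 := mul_left_cancel₀ hs (by linear_combination -q2)
    have hh : h = -t1 := mul_left_cancel₀ hs (by linear_combination q1)
    subst hf hh
    obtain ⟨c, d, hcd, hQ⟩ := angle2 (-(t1 * f)) ((4 * s - f ^ 2 + t1 ^ 2) / 2)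
    have main : ∀ l1 l2 : ℝ, l1 ^ 2 + l2 ^ 2 = 1 →
        (l1 ^ 2 - l2 ^ 2) * (-(t1 * f)) + 2 * l1 * l2 * ((4 * s - f ^ 2 + t1 ^ 2) / 2) = 0 →
        l1 * f - l2 * t1 = 0 := by
      intro l1 l2 hl hq
      have := hc.plane hF l1 l2 (-(l1 * t1 + l2 * f) / 2) (-l2, l1, 0)
        ((l1 * t1 + l2 * f) / 2 * l1, (l1 * t1 + l2 * f) / 2 * l2, 1) (by
          intro s t hst
          simp only [Prod.smul_mk, Prod.mk_add_mk, smul_eq_mul, Prod.mk_eq_zero] at hst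
          obtain ⟨c1, c2, c3⟩ := hst
          have ht : t = 0 := by linarith
          subst ht
          refine ⟨by linear_combination l1 * c2 - l2 * c1 - s * hl, rfl⟩)
        (by simp only; ring)
        (by simp only; linear_combination ((l1 * t1 + l2 * f) / 2) * hl)
        (α := 0) (β := -1) (γ := -l2 ^ 2 * (s - ((l1 * t1 + l2 * f) / 2) ^ 2)
          + l1 ^ 2 * (s + ((l1 * t1 + l2 * f) / 2) ^ 2)) (δ := l1 * f - l2 * t1)
        (by
          simp only [M3.L_apply, Jm, Prod.smul_mk, Prod.mk_add_mk, smul_eq_mul, Prod.mk.injEq]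
          refine ⟨?_, ?_, ?_⟩
          · ring
          · ring
          · linear_combination -hl)
        (by
          simp only [M3.L_apply, Jm, Prod.smul_mk, Prod.mk_add_mk, smul_eq_mul, Prod.mk.injEq]
          refine ⟨?_, ?_, ?_⟩
          · linear_combination (l1/2) * hq - (l2 * (s - ((l1 * t1 + l2 * f) / 2) ^ 2)) * hl
          · linear_combination (l2/2) * hq - (l1 * (s + ((l1 * t1 + l2 * f) / 2) ^ 2)) * hl
          · ring)
      linarith [this.1]
    have m1 := main c d hcd hQ
    have m2 := main (-d) c (by linarith) (by linear_combination -hQ)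
    have hf : f = 0 := by linear_combination c * m1 - d * m2 - f * hcd
    have ht1 : t1 = 0 := by linear_combination -d * m1 - c * m2 - t1 * hcd
    subst hf ht1
    have p1 := (hc.plane1 hF (by simp) (by simp)).2
    have p2 := (hc.plane2 hF (by simp) (by simp)).2
    norm_num at p1 p2
    linarith
  · have q5' : f * h = 0 := (mul_eq_zero.1 q5).resolve_right (pow_ne_zero 2 hk)
    have q4' := (mul_eq_zero.1 q4).resolve_left hk
    rcases mul_eq_zero.1 q5' with hf | hh
    · subst hf
      have ht2 : t2 = 0 := mul_left_cancel₀ hs (by linear_combination q2)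
      subst ht2
      have p2 := (hc.plane2 hF (by simp) (by simp)).1
      simp only [zero_add] at p2
      subst p2
      apply hs; linarith
    · subst hh
      have ht1 : t1 = 0 := mul_left_cancel₀ hs (by linear_combination q1)
      subst ht1
      have p2 := (hc.plane1 hF (by simp) (by simp)).1
      simp only [zero_add] at p2
      subst p2
      apply hs; linarith

lemma eqN {A : M3} {x11 x12 x21 x22 x31 x32 : ℝ} (h11 : A.a11 = x11) (h12 : A.a12 = x12)
    (h21 : A.a21 = x21) (h22 : A.a22 = x22) (h31 : A.a31 = x31) (h32 : A.a32 = x32) :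
    A = ⟨x11, x12, A.a13, x21, x22, A.a23, x31, x32, A.a33⟩ := by
  cases A
  simp only at h11 h12 h21 h22 h31 h32
  subst h11 h12 h21 h22 h31 h32
  rfl

lemma caseE2rot {F : E3 → ℝ} (hF : Nm F) {t1 t2 p q r f h : ℝ}
    (hc : CT F ⟨0, -t1, p, t1, 0, q, 0, -1, f⟩ ⟨0, -t2, r, t2, 0, -p, 1, 0, h⟩) :
    Concl F ⟨0, -t1, p, t1, 0, q, 0, -1, f⟩ ⟨0, -t2, r, t2, 0, -p, 1, 0, h⟩ := by
  obtain ⟨c, d, hcd, hQ⟩ := angle2 p ((q + r) / 2)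
  have hc' := hc.rot hcd
  refine Concl.unrot hcd ?_
  have hN := ro_nm hF hcd
  have e1 : rc c d (lc c ⟨0, -t1, p, t1, 0, q, 0, -1, f⟩ d ⟨0, -t2, r, t2, 0, -p, 1, 0, h⟩)
      = ⟨0, -(c * t1 + d * t2), 0, c * t1 + d * t2, 0, ((q + r) / 2 * (c ^ 2 - d ^ 2) - 2 * c * d * p)
        + (q - r) / 2, 0, -1, c * f + d * h⟩ := by
    simp only [rc, lc, M3.mk.injEq]
    refine ⟨?_, ?_, ?_, ?_, ?_, ?_, ?_, ?_, ?_⟩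
    · ring
    · linear_combination -(c * t1 + d * t2) * hcd
    · linear_combination hQ
    · linear_combination (c * t1 + d * t2) * hcd
    · ring
    · linear_combination ((q - r) / 2) * hcd
    · ring
    · linear_combination -hcd
    · trivial
  have e2 : rc c d (lc (-d) ⟨0, -t1, p, t1, 0, q, 0, -1, f⟩ c ⟨0, -t2, r, t2, 0, -p, 1, 0, h⟩)
      = ⟨0, -(-d * t1 + c * t2), ((q + r) / 2 * (c ^ 2 - d ^ 2) - 2 * c * d * p)
        - (q - r) / 2, -d * t1 + c * t2, 0, 0, 1, 0, -d * f + c * h⟩ := by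
    simp only [rc, lc, M3.mk.injEq]
    refine ⟨?_, ?_, ?_, ?_, ?_, ?_, ?_, ?_, ?_⟩
    · ring
    · linear_combination -(-d * t1 + c * t2) * hcd
    · linear_combination -((q - r) / 2) * hcd
    · linear_combination (-d * t1 + c * t2) * hcd
    · ring
    · linear_combination -hQ
    · linear_combination hcd
    · ring
    · trivial
  rw [e1, e2] at hc' ⊢
  exact caseE2 hN hc'

lemma stage2 {F : E3 → ℝ} (hF : Nm F) {t1 t2 a k1 k2 p q r s f h : ℝ} (hk12 : k1 ≠ 0 ∨ k2 ≠ 0)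
    (hc : CT F ⟨0, -t1, p, t1, 0, q, a, -k2, f⟩ ⟨0, -t2, r, t2, 0, s, k1, a, h⟩) :
    Concl F ⟨0, -t1, p, t1, 0, q, a, -k2, f⟩ ⟨0, -t2, r, t2, 0, s, k1, a, h⟩ := by
  have E : Eqs 0 0 0 0 0 0 t1 t2 a k1 k2 p q r s f h := by
    refine CT.eqs hF ?_
    simpa only [zero_sub, zero_add] using hc
  have q1 : k2 * (p - s + 2 * a * q + 2 * k2 * s) = 0 := by linear_combination E.e043
  have q2 : -(k1 * q + k2 * r) + k2 * (a * (p - s) + (k1 * q + k2 * r)) = 0 := by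
    linear_combination (1/2) * E.e133
  have q3 : (k2 - k1) * (p - s) + 2 * a * (k1 * q - k2 * r) + 2 * k1 * k2 * (p + s) = 0 := by
    linear_combination E.e223
  have q4 : -(k1 * q + k2 * r) + k1 * (a * (p - s) + (k1 * q + k2 * r)) = 0 := by
    linear_combination (1/2) * E.e313
  have q5 : k1 * (-p + s - 2 * a * r + 2 * k1 * p) = 0 := by linear_combination E.e403
  have hkk : k1 ^ 2 + k2 ^ 2 ≠ 0 := by
    intro h0
    have h1 : k1 = 0 := by nlinarith [sq_nonneg k1, sq_nonneg k2]
    have h2 : k2 = 0 := by nlinarith [sq_nonneg k1, sq_nonneg k2]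
    rcases hk12 with h | h
    · exact h h1
    · exact h h2
  have tri : (p = s ∧ k1 * q + k2 * r = 0 ∧ a * q + k2 * p = 0 ∧ a * r = k1 * p) ∨
      (a = 0 ∧ k1 = 1 ∧ k2 = 1 ∧ s = -p) := by
    by_cases h1 : k1 = 0
    · left
      have h2 : k2 ≠ 0 := hk12.resolve_left (fun hn => hn h1)
      subst h1
      have hr : r = 0 := mul_left_cancel₀ h2 (by linear_combination -q4)
      subst hr
      have hp : p = s := by
        have : p - s = 0 := mul_left_cancel₀ h2 (by linear_combination q3)
        linarith
      subst hp
      refine ⟨rfl, by ring, ?_, by ring⟩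
      have := (mul_eq_zero.1 q1).resolve_left h2
      linarith
    by_cases h2 : k2 = 0
    · left
      subst h2
      have hr : q = 0 := mul_left_cancel₀ h1 (by linear_combination -q2)
      subst hr
      have hp : p = s := by
        have : p - s = 0 := mul_left_cancel₀ h1 (by linear_combination -q3)
        linarith
      subst hp
      refine ⟨rfl, by ring, by ring, ?_⟩
      have := (mul_eq_zero.1 q5).resolve_left h1
      linarith
    have q1' := (mul_eq_zero.1 q1).resolve_left h2
    have q5' := (mul_eq_zero.1 q5).resolve_left h1
    by_cases hW : a * (p - s) + (k1 * q + k2 * r) = 0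
    · rw [hW] at q2
      have hB : k1 * q + k2 * r = 0 := by linarith
      have hA : a * (p - s) = 0 := by linarith
      by_cases hps : p - s = 0
      · left
        refine ⟨by linarith, hB, by linear_combination (1/2) * q1' + (k2 - 1/2) * hps,
          by linear_combination (-1/2) * q5' - (1/2) * hps⟩
      · right
        have ha : a = 0 := (mul_eq_zero.1 hA).resolve_right hps
        subst ha
        have m1 : k1 = k2 := by
          have : (p - s) * (k2 - k1) = 0 := by
            linear_combination (1/2) * q3 - (1/2) * k1 * q1' - (1/2) * k2 * q5'
          have := (mul_eq_zero.1 this).resolve_left hps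
          linarith
        subst m1
        have m2 : k1 = 1 := by
          have : (p - s) * (k1 - 1) = 0 := by linear_combination (1/2) * q5' - (1/2) * q1'
          have := (mul_eq_zero.1 this).resolve_left hps
          linarith
        subst m2
        refine ⟨rfl, rfl, rfl, by linarith⟩
    · right
      have m1 : k1 = k2 := by
        have : (a * (p - s) + (k1 * q + k2 * r)) * (k1 - k2) = 0 := by linear_combination q4 - q2
        have := (mul_eq_zero.1 this).resolve_left hW
        linarith
      subst m1
      have g1 : (1 - k1) * (q + r) - a * (p - s) = 0 :=
        mul_left_cancel₀ h1 (by linear_combination -q2)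
      have g2 : (1 - k1) * (p - s) + a * (q + r) = 0 := by
        linear_combination (1/2) * q1' - (1/2) * q5'
      have g3 : a * ((q + r) ^ 2 + (p - s) ^ 2) = 0 := by
        linear_combination (q + r) * g2 - (p - s) * g1
      by_cases ha : a = 0
      · subst ha
        have hqr : q + r ≠ 0 := by
          intro h0; apply hW; linear_combination k1 * h0
        have m2 : 1 - k1 = 0 := by
          have : (1 - k1) * (q + r) = 0 := by linarith
          exact (mul_eq_zero.1 this).resolve_right hqr
        have m3 : k1 = 1 := by linarith
        subst m3
        refine ⟨rfl, rfl, rfl, by linarith⟩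
      · exfalso
        have g4 := (mul_eq_zero.1 g3).resolve_left ha
        have g5 : q + r = 0 := by nlinarith [sq_nonneg (q + r), sq_nonneg (p - s)]
        have g6 : p - s = 0 := by nlinarith [sq_nonneg (q + r), sq_nonneg (p - s)]
        apply hW; linear_combination a * g6 + k1 * g5
  rcases tri with ⟨hps, hB, hq, hr⟩ | ⟨rfl, rfl, rfl, rfl⟩
  · subst hps
    have hp' : p = -((k2 * q - k1 * r) / (k1 ^ 2 + k2 ^ 2)) * a := by
      rw [← neg_div, div_mul_eq_mul_div, eq_div_iff hkk]
      linear_combination k2 * hq - k1 * hr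
    have hq' : q = -((k2 * q - k1 * r) / (k1 ^ 2 + k2 ^ 2)) * -k2 := by
      rw [← neg_div, div_mul_eq_mul_div, eq_div_iff hkk]
      linear_combination k1 * hB
    have hr' : r = -((k2 * q - k1 * r) / (k1 ^ 2 + k2 ^ 2)) * k1 := by
      rw [← neg_div, div_mul_eq_mul_div, eq_div_iff hkk]
      linear_combination k2 * hB
    have := stage3 hF (t1 := t1) (t2 := t2) (a := a) (f := f) (h := h)
      (k := (k2 * q - k1 * r) / (k1 ^ 2 + k2 ^ 2)) hk12
    rw [← hp', ← hq', ← hr'] at this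
    exact this hc
  · exact caseE2rot hF hc

lemma e1core0 {F : E3 → ℝ} (hF : Nm F) {t1 t2 C p q r s f h : ℝ} (hC : C ≠ 0) (ht : t1 = 0)
    (hc : CT F ⟨C, -t1, p, t1, -C, q, 0, -3, f⟩ ⟨0, -C - t2, r, -C + t2, 0, s, 3, 0, h⟩) :
    False := by
  have E : Eqs C 0 (-C) 0 (-C) 0 t1 t2 0 3 3 p q r s f h := by
    refine CT.eqs hF ?_
    simpa only [zero_sub, zero_add] using hc
  subst ht
  have a1 := E.e043
  have a2 := E.e223
  have a3 := E.e403
  have a4 := E.e133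
  have a5 := E.e313
  have hh : h = 0 := mul_left_cancel₀ hC (by
    linear_combination (-1/8) * a1 + (1/8) * a2 - (1/8) * a3)
  have hf : f = -3 * t2 := mul_left_cancel₀ hC (by linear_combination (1/8) * a5 - (1/8) * a4)
  subst hh hf
  have hp : p = 0 := by linear_combination (1/12) * a3 - (1/72) * a2
  have hs : s = 0 := by linear_combination (1/12) * a1 - (1/72) * a2
  have hr : r = 4 * C * t2 - q := by linear_combination (1/12) * a4
  have hpl := hc.plane1 hF (by simp) (by simpa using hp)
  obtain ⟨h1, h2⟩ := hpl
  simp only at h1 h2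
  have ht2 : t2 = -C / 3 := by linarith
  subst hp hs hr ht2
  have b1 := E.e124
  have hq : q = -C ^ 2 := mul_left_cancel₀ hC (by linear_combination (-1/64) * b1)
  subst hq
  rcases h2 with h2 | h2
  · nlinarith [sq_nonneg C]
  · exact hC (by linarith [h2.1])

lemma e1core {F : E3 → ℝ} (hF : Nm F) {t1 t2 C p q r s f h : ℝ} (hC : C ≠ 0)
    (hc : CT F ⟨C, -t1, p, t1, -C, q, 0, -3, f⟩ ⟨0, -C - t2, r, -C + t2, 0, s, 3, 0, h⟩) :
    False := by
  by_cases ht : t1 = 0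
  · exact e1core0 hF hC ht hc
  have E : Eqs C 0 (-C) 0 (-C) 0 t1 t2 0 3 3 p q r s f h := by
    refine CT.eqs hF ?_
    simpa only [zero_sub, zero_add] using hc
  have a1 := E.e043
  have a2 := E.e223
  have a3 := E.e403
  have a4 := E.e133
  have a5 := E.e313
  have hh : h = 3 * t1 := mul_left_cancel₀ hC (by
    linear_combination (-1/8) * a1 + (1/8) * a2 - (1/8) * a3)
  have hf : f = -3 * t2 := mul_left_cancel₀ hC (by linear_combination (1/8) * a5 - (1/8) * a4)
  subst hh hf
  have hp : p = -2 * C * t1 := by linear_combination (1/12) * a3 - (1/72) * a2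
  have hs : s = 2 * C * t1 := by linear_combination (1/12) * a1 - (1/72) * a2
  have hr : r = 4 * C * t2 - q := by linear_combination (1/12) * a4
  subst hp hs hr
  have b1 := E.e034
  have b2 := E.e025
  have b3 := E.e115
  have c2 : t1 ^ 2 + t2 ^ 2 - 20 / 3 * C * t2 + C ^ 2 = 0 :=
    mul_left_cancel₀ (mul_ne_zero hC ht) (by linear_combination (1/18) * b2)
  have c3 : t1 ^ 2 = 3 * t2 ^ 2 := mul_left_cancel₀ (pow_ne_zero 2 hC)
    (by linear_combination (-1/120) * b3 + (36/120) * C * t2 * c2)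
  have ht2 : t2 ≠ 0 := by
    rintro rfl
    apply ht
    have : t1 ^ 2 = 0 := by linarith
    exact pow_eq_zero_iff (two_ne_zero) |>.1 this
  obtain ⟨d, hd⟩ : ∃ d, d = t1 / (2 * t2) := ⟨_, rfl⟩
  have hd1 : d * t2 = t1 / 2 := by rw [hd]; field_simp
  have hd2 : d ^ 2 = 3 / 4 := mul_left_cancel₀ (pow_ne_zero 2 ht2)
    (by linear_combination (d * t2 + t1 / 2) * hd1 + (1/4) * c3)
  have hcd : (-1/2 : ℝ) ^ 2 + d ^ 2 = 1 := by linarith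
  have hd3 : d ^ 3 = 3 / 4 * d := by rw [← hd2]; ring
  have hc' := hc.rot hcd
  have hN := ro_nm hF hcd
  rw [eqN (A := rc (-1/2) d (lc (-1/2) _ d _)) (x11 := C) (x12 := -0) (x21 := 0) (x22 := -C) (x31 := 0) (x32 := -3)
    (by simp only [rc, lc]; linear_combination ((3/2) * C) * hd2)
    (by simp only [rc, lc]; linear_combination (-1/4 - d ^ 2) * hd1 + C * hd3)
    (by simp only [rc, lc]; linear_combination (1/4 + d ^ 2) * hd1 + C * hd3)
    (by simp only [rc, lc]; linear_combination (-(3/2) * C) * hd2)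
    (by simp only [rc, lc]; ring)
    (by simp only [rc, lc]; linear_combination (-3) * hd2),
    eqN (A := rc (-1/2) d (lc (-d) _ (-1/2) _)) (x11 := 0) (x12 := -C - (-d * t1 - t2 / 2))
      (x21 := -C + (-d * t1 - t2 / 2)) (x22 := 0) (x31 := 3) (x32 := 0)
    (by simp only [rc, lc]; linear_combination C * hd3)
    (by simp only [rc, lc]; linear_combination (d * t1 + t2 / 2 - (3/2) * C) * hd2)
    (by simp only [rc, lc]; linear_combination (-d * t1 - t2 / 2 - (3/2) * C) * hd2)
    (by simp only [rc, lc]; linear_combination (-C) * hd3)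
    (by simp only [rc, lc]; linear_combination 3 * hd2)
    (by simp only [rc, lc]; ring)] at hc'
  exact e1core0 hN hC rfl hc'

lemma caseE1n {F : E3 → ℝ} (hF : Nm F) {α β t1 t2 p q r s f h : ℝ}
    (hc : CT F ⟨α, β - t1, p, β + t1, -α, q, 0, -3, f⟩ ⟨β, -α - t2, r, -α + t2, -β, s, 3, 0, h⟩) :
    Concl F ⟨α, β - t1, p, β + t1, -α, q, 0, -3, f⟩ ⟨β, -α - t2, r, -α + t2, -β, s, 3, 0, h⟩ := by
  obtain ⟨c, d, hcd, hQ⟩ := angle3 β (-α)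
  have hc' := hc.rot hcd
  refine Concl.unrot hcd ?_
  have hN := ro_nm hF hcd
  have hoff : (c ^ 2 - d ^ 2) * (c * β - d * α) - 2 * c * d * (c * α + d * β) = 0 := by
    linear_combination hQ + (-3 * c * β - 3 * d * α) * hcd
  obtain ⟨C, hC⟩ : ∃ C, C = (c ^ 2 - d ^ 2) * (c * α + d * β) + 2 * c * d * (c * β - d * α) :=
    ⟨_, rfl⟩
  have hA := eqN (A := rc c d (lc c ⟨α, β - t1, p, β + t1, -α, q, 0, -3, f⟩ d
      ⟨β, -α - t2, r, -α + t2, -β, s, 3, 0, h⟩)) (x11 := C) (x12 := -(c * t1 + d * t2))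
      (x21 := c * t1 + d * t2) (x22 := -C) (x31 := 0) (x32 := -3)
    (by simp only [rc, lc]; linear_combination -hC)
    (by simp only [rc, lc]; linear_combination hoff - (c * t1 + d * t2) * hcd)
    (by simp only [rc, lc]; linear_combination hoff + (c * t1 + d * t2) * hcd)
    (by simp only [rc, lc]; linear_combination hC)
    (by simp only [rc, lc]; ring)
    (by simp only [rc, lc]; linear_combination (-3) * hcd)
  have hB := eqN (A := rc c d (lc (-d) ⟨α, β - t1, p, β + t1, -α, q, 0, -3, f⟩ c
      ⟨β, -α - t2, r, -α + t2, -β, s, 3, 0, h⟩)) (x11 := 0) (x12 := -C - (-d * t1 + c * t2))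
      (x21 := -C + (-d * t1 + c * t2)) (x22 := 0) (x31 := 3) (x32 := 0)
    (by simp only [rc, lc]; linear_combination hoff)
    (by simp only [rc, lc]; linear_combination hC - (-d * t1 + c * t2) * hcd)
    (by simp only [rc, lc]; linear_combination hC + (-d * t1 + c * t2) * hcd)
    (by simp only [rc, lc]; linear_combination -hoff)
    (by simp only [rc, lc]; linear_combination 3 * hcd)
    (by simp only [rc, lc]; ring)
  rw [hA, hB] at hc' ⊢
  clear hC
  by_cases h0 : C = 0
  · subst h0
    simp only [neg_zero, zero_sub, zero_add] at hc' ⊢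
    exact stage2 hN (Or.inl three_ne_zero) hc'
  · exact (e1core hN h0 hc').elim

lemma caseE1 {F : E3 → ℝ} (hF : Nm F) {gA gB gC gD gE gF t1 t2 p q r s f h : ℝ}
    (hc : CT F ⟨gA, gB - t1, p, gB + t1, gC, q, 0, -3, f⟩
      ⟨gD, gE - t2, r, gE + t2, gF, s, 3, 0, h⟩) :
    Concl F ⟨gA, gB - t1, p, gB + t1, gC, q, 0, -3, f⟩
      ⟨gD, gE - t2, r, gE + t2, gF, s, 3, 0, h⟩ := by
  have E := CT.eqs hF hc
  have h1 : gF = -gB := by linear_combination (1/6) * E.e052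
  have h2 : gE = -gA := by linear_combination (1/6) * E.e502
  clear E
  subst h1 h2
  have hc' := hc.shift ((gD - gB) / 4) (-(gA + gC) / 4)
  refine Concl.unshift (d1 := (gD - gB) / 4) (d2 := -(gA + gC) / 4) ?_
  have hN := sh_nm hF ((gD - gB) / 4) (-(gA + gC) / 4)
  have hA := eqN (A := shA ((gD - gB) / 4) (-(gA + gC) / 4) ⟨gA, gB - t1, p, gB + t1, gC, q, 0, -3, f⟩)
    (x11 := gA - (gA + gC) / 4) (x12 := (gB + (gD - gB) / 4) - (t1 - 3 * (gD - gB) / 4))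
    (x21 := (gB + (gD - gB) / 4) + (t1 - 3 * (gD - gB) / 4)) (x22 := -(gA - (gA + gC) / 4))
    (x31 := 0) (x32 := -3)
    (by simp only [shA]; ring) (by simp only [shA]; ring) (by simp only [shA]; ring)
    (by simp only [shA]; ring) rfl rfl
  have hB := eqN (A := shB ((gD - gB) / 4) (-(gA + gC) / 4) ⟨gD, -gA - t2, r, -gA + t2, -gB, s, 3, 0, h⟩)
    (x11 := gB + (gD - gB) / 4) (x12 := -(gA - (gA + gC) / 4) - (t2 + 3 * (gA + gC) / 4))
    (x21 := -(gA - (gA + gC) / 4) + (t2 + 3 * (gA + gC) / 4)) (x22 := -(gB + (gD - gB) / 4))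
    (x31 := 3) (x32 := 0)
    (by simp only [shB]; ring) (by simp only [shB]; ring) (by simp only [shB]; ring)
    (by simp only [shB]; ring) rfl rfl
  rw [hA, hB] at hc' ⊢
  exact caseE1n hN hc'

lemma sq2_ne {k1 k2 : ℝ} (h : k1 ≠ 0 ∨ k2 ≠ 0) : k1 ^ 2 + k2 ^ 2 ≠ 0 := by
  intro h0
  have h1 : k1 = 0 := by nlinarith [sq_nonneg k1, sq_nonneg k2]
  have h2 : k2 = 0 := by nlinarith [sq_nonneg k1, sq_nonneg k2]
  rcases h with h | h
  · exact h h1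
  · exact h h2

lemma stage1s {F : E3 → ℝ} (hF : Nm F) {gA gB gC gD gE gF t1 t2 a k1 k2 p q r s f h : ℝ}
    (hk12 : k1 ≠ 0 ∨ k2 ≠ 0) (s1 : k1 * gD + k2 * (gF - 2 * gB) = 0)
    (s2 : k1 * (2 * gE - gA) = k2 * gC)
    (hc : CT F ⟨gA, gB - t1, p, gB + t1, gC, q, a, -k2, f⟩
      ⟨gD, gE - t2, r, gE + t2, gF, s, k1, a, h⟩) :
    Concl F ⟨gA, gB - t1, p, gB + t1, gC, q, a, -k2, f⟩
      ⟨gD, gE - t2, r, gE + t2, gF, s, k1, a, h⟩ := by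
  have E := CT.eqs hF hc
  have hn := sq2_ne hk12
  obtain ⟨g, hg⟩ : ∃ g, g = (k1 * (gF - 2 * gB) - k2 * gD) / (k1 ^ 2 + k2 ^ 2) := ⟨_, rfl⟩
  obtain ⟨l, hl⟩ : ∃ l, l = (k2 * (2 * gE - gA) + k1 * gC) / (k1 ^ 2 + k2 ^ 2) := ⟨_, rfl⟩
  have hg' : g * (k1 ^ 2 + k2 ^ 2) = k1 * (gF - 2 * gB) - k2 * gD := by
    rw [hg]; exact div_mul_cancel₀ _ hn
  have hl' : l * (k1 ^ 2 + k2 ^ 2) = k2 * (2 * gE - gA) + k1 * gC := by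
    rw [hl]; exact div_mul_cancel₀ _ hn
  clear hg hl
  have hD : gD = -k2 * g := mul_left_cancel₀ hn (by linear_combination k2 * hg' + k1 * s1)
  have hU : gF = k1 * g + 2 * gB := by
    have : gF - 2 * gB = k1 * g := mul_left_cancel₀ hn (by linear_combination -k1 * hg' + k2 * s1)
    linarith
  have hV : gA = 2 * gE - k2 * l := by
    have : 2 * gE - gA = k2 * l := mul_left_cancel₀ hn (by linear_combination -k2 * hl' + k1 * s2)
    linarith
  have hC : gC = k1 * l := mul_left_cancel₀ hn (by linear_combination -k1 * hl' - k2 * s2)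
  have tri : (gB = 0 ∧ gE = 0 ∧ gA = 0 ∧ gC = 0 ∧ gD = 0 ∧ gF = 0) ∨ (a = 0 ∧ k1 = 3 ∧ k2 = 3) := by
    clear hc
    subst hD hU hV hC
    clear hg' hl' s1 s2
    have q05 := E.e052
    have q14 := E.e142
    have q23 := E.e232
    have q32 := E.e322
    have q41 := E.e412
    have q50 := E.e502
    clear E
    by_cases h1 : k1 = 0
    · left
      have h2 : k2 ≠ 0 := hk12.resolve_left (fun hn => hn h1)
      subst h1
      have hB : gB = 0 := mul_left_cancel₀ (pow_ne_zero 2 h2) (by linear_combination (1/2) * q05)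
      subst hB
      have hg : g = 0 := mul_left_cancel₀ (pow_ne_zero 2 h2) (by linear_combination (1/2) * q41)
      subst hg
      have hl : l = 0 := mul_left_cancel₀ (pow_ne_zero 2 h2) (by linear_combination (-1) * q32)
      subst hl
      have hE : gE = 0 := mul_left_cancel₀ (pow_ne_zero 2 h2) (by linear_combination (1/2) * q14)
      subst hE
      simp
    by_cases h2 : k2 = 0
    · left
      subst h2
      have hE : gE = 0 := mul_left_cancel₀ (pow_ne_zero 2 h1) (by linear_combination (1/2) * q50)
      subst hE
      have hl : l = 0 := mul_left_cancel₀ (pow_ne_zero 2 h1) (by linear_combination (-1/2) * q14)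
      subst hl
      have hg : g = 0 := mul_left_cancel₀ (pow_ne_zero 2 h1) (by linear_combination q23)
      subst hg
      have hB : gB = 0 := mul_left_cancel₀ (pow_ne_zero 2 h1) (by linear_combination (1/2) * q41)
      subst hB
      simp
    have m1 : -k1 * g + a * k1 * l + k2 * (k1 * g + 2 * gB) = 0 :=
      mul_left_cancel₀ h2 (by linear_combination q05)
    have m2 : k2 * l + k1 * (2 * gE - k2 * l) + a * k2 * g = 0 :=
      mul_left_cancel₀ h1 (by linear_combination q50)
    have n1 : (3 - k2) * g - a * l = 0 :=
      mul_left_cancel₀ hn (by linear_combination q23 - 2 * k1 * m1)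
    have n2 : (3 - k1) * l + a * g = 0 :=
      mul_left_cancel₀ hn (by linear_combination -q32 + 2 * k2 * m2)
    have n3 : -2 * k1 * l - k2 * l + k1 * k2 * l - a * k2 * g = 0 :=
      mul_left_cancel₀ hn (by linear_combination k1 * q14 - k2 ^ 2 * m2)
    have n4 : 2 * k2 * g + k1 * g - k1 * k2 * g - a * k1 * l = 0 :=
      mul_left_cancel₀ hn (by linear_combination k2 * q41 - k1 ^ 2 * m1)
    have o1 : l * (k1 - k2) = 0 := by linear_combination (-1/2) * n3 - (1/2) * k2 * n2
    have o2 : g * (k1 - k2) = 0 := by linear_combination (-1/2) * n4 + (1/2) * k1 * n1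
    by_cases hk : k1 - k2 = 0
    · have hk' : k2 = k1 := by linarith
      subst hk'
      have o3 : a * (g ^ 2 + l ^ 2) = 0 := by linear_combination g * n2 - l * n1
      have o4 : (3 - k2) * (g ^ 2 + l ^ 2) = 0 := by linear_combination g * n1 + l * n2
      by_cases hgl : g ^ 2 + l ^ 2 = 0
      · left
        have hg : g = 0 := by nlinarith [sq_nonneg g, sq_nonneg l]
        have hl : l = 0 := by nlinarith [sq_nonneg g, sq_nonneg l]
        subst hg hl
        have hB : gB = 0 := mul_left_cancel₀ h2 (by linear_combination (1/2) * m1)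
        have hE : gE = 0 := mul_left_cancel₀ h2 (by linear_combination (1/2) * m2)
        subst hB hE
        simp
      · right
        have := (mul_eq_zero.1 o4).resolve_right hgl
        have := (mul_eq_zero.1 o3).resolve_right hgl
        refine ⟨by linarith, by linarith, by linarith⟩
    · left
      have hg := (mul_eq_zero.1 o2).resolve_right hk
      have hl := (mul_eq_zero.1 o1).resolve_right hk
      subst hg hl
      have hB : gB = 0 := mul_left_cancel₀ h2 (by linear_combination (1/2) * m1)
      have hE : gE = 0 := mul_left_cancel₀ h1 (by linear_combination (1/2) * m2)
      subst hB hE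
      simp
  clear hD hU hV hC hg' hl' E s1 s2
  rcases tri with ⟨rfl, rfl, rfl, rfl, rfl, rfl⟩ | ⟨rfl, rfl, rfl⟩
  · simp only [zero_sub, zero_add] at hc ⊢
    exact stage2 hF hk12 hc
  · exact caseE1 hF hc

lemma stage1 {F : E3 → ℝ} (hF : Nm F) {gA gB gC gD gE gF t1 t2 a k1 k2 p q r s f h : ℝ}
    (hk12 : k1 ≠ 0 ∨ k2 ≠ 0)
    (hc : CT F ⟨gA, gB - t1, p, gB + t1, gC, q, a, -k2, f⟩
      ⟨gD, gE - t2, r, gE + t2, gF, s, k1, a, h⟩) :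
    Concl F ⟨gA, gB - t1, p, gB + t1, gC, q, a, -k2, f⟩
      ⟨gD, gE - t2, r, gE + t2, gF, s, k1, a, h⟩ := by
  have hn := sq2_ne hk12
  obtain ⟨d1, hd1⟩ : ∃ d1, d1 * (k1 ^ 2 + k2 ^ 2) = k1 * gD + k2 * (gF - 2 * gB) :=
    ⟨_, div_mul_cancel₀ _ hn⟩
  obtain ⟨d2, hd2⟩ : ∃ d2, d2 * (k1 ^ 2 + k2 ^ 2) = k1 * (2 * gE - gA) - k2 * gC :=
    ⟨_, div_mul_cancel₀ _ hn⟩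
  have hc' := hc.shift d1 d2
  refine Concl.unshift (d1 := d1) (d2 := d2) ?_
  have hN := sh_nm hF d1 d2
  have hA := eqN (A := shA d1 d2 ⟨gA, gB - t1, p, gB + t1, gC, q, a, -k2, f⟩)
    (x11 := gA - d1 * a + d2)
    (x12 := (gB + (-d1 + d1 * k2 - d2 * a) / 2) - (t1 + (-3 * d1 - d2 * a - d1 * k2) / 2))
    (x21 := (gB + (-d1 + d1 * k2 - d2 * a) / 2) + (t1 + (-3 * d1 - d2 * a - d1 * k2) / 2))
    (x22 := gC + d2 * k2) (x31 := a) (x32 := -k2)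
    (by simp only [shA]) (by simp only [shA]; ring) (by simp only [shA]; ring)
    (by simp only [shA]; ring) rfl rfl
  have hB := eqN (A := shB d1 d2 ⟨gD, gE - t2, r, gE + t2, gF, s, k1, a, h⟩)
    (x11 := gD - d1 * k1)
    (x12 := (gE + (d2 - d1 * a - d2 * k1) / 2) - (t2 + (-3 * d2 - d2 * k1 + d1 * a) / 2))
    (x21 := (gE + (d2 - d1 * a - d2 * k1) / 2) + (t2 + (-3 * d2 - d2 * k1 + d1 * a) / 2))
    (x22 := gF - d2 * a - d1) (x31 := k1) (x32 := a)
    (by simp only [shB]) (by simp only [shB]; ring) (by simp only [shB]; ring)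
    (by simp only [shB]) rfl rfl
  rw [hA, hB] at hc' ⊢
  exact stage1s hN hk12 (by linear_combination -hd1) (by linear_combination -hd2) hc'

lemma f1' {F : E3 → ℝ} (hF : Nm F) {t1 t2 k p : ℝ} (hk : k ≠ 0) (hp : p ≠ 0)
    (hc : CT F ⟨0, -t1, p, t1, 0, 0, k, 0, 0⟩ ⟨0, -t2, 0, t2, 0, p, 0, k, 0⟩) :
    Concl F ⟨0, -t1, p, t1, 0, 0, k, 0, 0⟩ ⟨0, -t2, 0, t2, 0, p, 0, k, 0⟩ := by
  have := conclF1 hF (t1 := t1) (t2 := t2) (a31 := k) (a32 := 0) (b31 := 0) (b32 := k) (k := -p / k)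
    (div_ne_zero (neg_ne_zero.2 hp) hk)
  have e : -(-p / k) * k = p := by field_simp
  rw [e, mul_zero] at this
  exact this hc

lemma stage2' {F : E3 → ℝ} (hF : Nm F) {t1 t2 k p q r s f h : ℝ}
    (hc : CT F ⟨0, -t1, p, t1, 0, q, k, 0, f⟩ ⟨0, -t2, r, t2, 0, s, 0, k, h⟩) :
    Concl F ⟨0, -t1, p, t1, 0, q, k, 0, f⟩ ⟨0, -t2, r, t2, 0, s, 0, k, h⟩ := by
  have E : Eqs 0 0 0 0 0 0 t1 t2 k 0 0 p q r s f h := by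
    refine CT.eqs hF ?_
    simpa only [zero_sub, zero_add, neg_zero] using hc
  obtain ⟨φ, hφ⟩ : ∃ φ, φ = f + k * t1 := ⟨_, rfl⟩
  obtain ⟨ψ, hψ⟩ : ∃ ψ, ψ = h + k * t2 := ⟨_, rfl⟩
  have hkp : 1 + k ^ 2 ≠ 0 := by positivity
  by_cases h0 : φ = 0 ∧ ψ = 0
  · obtain ⟨h1, h2⟩ := h0
    have hf : f = -(k * t1) := by linarith
    have hh : h = -(k * t2) := by linarith
    clear hφ hψ h1 h2
    subst hf hh
    by_cases hk : k = 0
    · subst hk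
      simp only [zero_mul, neg_zero] at hc ⊢
      exact conclF3 hF hc
    have g1 : p ^ 2 + q ^ 2 + q * r - p * s = 0 :=
      mul_left_cancel₀ hk (by linear_combination E.e025)
    have g2 : p * r + q * s = 0 :=
      mul_left_cancel₀ hk (by linear_combination (-1/2) * E.e115)
    have g3 : r ^ 2 + s ^ 2 + q * r - p * s = 0 :=
      mul_left_cancel₀ hk (by linear_combination E.e205)
    have g4 : s - p = 0 := by nlinarith [sq_nonneg (s - p), sq_nonneg (q + r)]
    have g5 : q + r = 0 := by nlinarith [sq_nonneg (s - p), sq_nonneg (q + r)]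
    have g6 : s = p := by linarith
    have g7 : r = -q := by linarith
    subst g6 g7
    by_cases hpq : s ^ 2 + q ^ 2 = 0
    · have hp : s = 0 := by nlinarith [sq_nonneg s, sq_nonneg q]
      have hq : q = 0 := by nlinarith [sq_nonneg s, sq_nonneg q]
      subst hp hq
      simp only [neg_zero] at hc ⊢
      exact conclF2 hF hc
    have k1 : k * t1 - t2 = 0 :=
      mul_left_cancel₀ (mul_ne_zero hk hpq) (by linear_combination E.e016)
    have k2 : t1 + k * t2 = 0 :=
      mul_left_cancel₀ (mul_ne_zero hk hpq) (by linear_combination (-1) * E.e106)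
    have ht1 : t1 = 0 := mul_left_cancel₀ hkp (by linear_combination k2 + k * k1)
    have ht2 : t2 = 0 := by rw [ht1] at k1; linarith
    subst ht1 ht2
    have hq : q = 0 := mul_left_cancel₀ (mul_ne_zero hk hpq) (by linear_combination (1/2) * E.e007)
    subst hq
    have hs : s ≠ 0 := by
      rintro rfl; apply hpq; ring
    simp only [neg_zero, mul_zero] at hc ⊢
    have := f1' hF (t1 := 0) (t2 := 0) hk hs
    simp only [neg_zero] at this
    exact this hc
  have hn : φ ^ 2 + ψ ^ 2 ≠ 0 := by
    intro h1; apply h0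
    constructor <;> nlinarith [sq_nonneg φ, sq_nonneg ψ]
  have l1 : φ * (s - p) - (k * φ + ψ) * q = 0 := by
    rw [hφ, hψ]; linear_combination E.e034
  have l2 : k * φ * (s - p) + (φ + k * ψ) * q + 2 * φ * r = 0 := by
    rw [hφ, hψ]; linear_combination E.e124
  have l3 : -k * ψ * (s - p) - 2 * ψ * q + (k * φ - ψ) * r = 0 := by
    rw [hφ, hψ]; linear_combination E.e214
  have l4 : ψ * (s - p) + (φ - k * ψ) * r = 0 := by
    rw [hφ, hψ]; linear_combination E.e304
  have i1 : ((1 + k ^ 2) * φ + 2 * k * ψ) * q + 2 * φ * r = 0 := by linear_combination l2 - k * l1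
  have i2 : -2 * ψ * q + (2 * k * φ - (1 + k ^ 2) * ψ) * r = 0 := by linear_combination l3 + k * l4
  have i3 : (k * φ * ψ + ψ ^ 2) * q + (φ ^ 2 - k * φ * ψ) * r = 0 := by
    linear_combination φ * l4 - ψ * l1
  have qr : q = 0 ∧ r = 0 := by
    by_cases hφ0 : φ = 0
    · have hψ0 : ψ ≠ 0 := fun h => h0 ⟨hφ0, h⟩
      rw [hφ0] at i2 i3
      have hq : q = 0 := mul_left_cancel₀ (pow_ne_zero 2 hψ0) (by linear_combination i3)
      subst hq
      exact ⟨rfl, mul_left_cancel₀ (mul_ne_zero hkp hψ0) (by linear_combination (-1) * i2)⟩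
    by_cases hψ0 : ψ = 0
    · rw [hψ0] at i1 i3
      have hr : r = 0 := mul_left_cancel₀ (pow_ne_zero 2 hφ0) (by linear_combination i3)
      subst hr
      exact ⟨mul_left_cancel₀ (mul_ne_zero hkp hφ0) (by linear_combination i1), rfl⟩
    have hrq : r = q := by
      have : r - q = 0 := mul_left_cancel₀ (mul_ne_zero hkp (mul_ne_zero hφ0 hψ0))
        (by linear_combination ψ * i1 + φ * i2 - 2 * k * i3)
      linarith
    subst hrq
    have hd : (3 + k ^ 2) ^ 2 + 4 * k ^ 2 ≠ 0 := by positivity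
    have : r = 0 := mul_left_cancel₀ (mul_ne_zero hd hφ0)
      (by linear_combination (3 + k ^ 2) * i1 + 2 * k * i2)
    exact ⟨this, this⟩
  obtain ⟨rfl, rfl⟩ := qr
  have hs : s = p := by
    have : s - p = 0 := mul_left_cancel₀ hn (by linear_combination φ * l1 + ψ * l4)
    linarith
  subst hs
  by_cases hp : s = 0
  · subst hp
    exact conclF2 hF hc
  have n1 : f * t2 - h * t1 + 2 * f * φ = 0 :=
    mul_left_cancel₀ hp (by rw [hφ]; linear_combination E.e025)
  have n2 : h * φ + f * ψ = 0 :=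
    mul_left_cancel₀ hp (by rw [hφ, hψ]; linear_combination (-1/2) * E.e115)
  have n3 : f * t2 - h * t1 + 2 * h * ψ = 0 :=
    mul_left_cancel₀ hp (by rw [hψ]; linear_combination E.e205)
  have n4 : f ^ 2 + h ^ 2 = 0 := by
    have hA : φ * (f ^ 2 + h ^ 2) = 0 := by linear_combination (1/2) * f * (n1 - n3) + h * n2
    have hB : ψ * (f ^ 2 + h ^ 2) = 0 := by linear_combination (-1/2) * h * (n1 - n3) + f * n2
    exact mul_left_cancel₀ hn (by linear_combination φ * hA + ψ * hB)
  have hf : f = 0 := by nlinarith [sq_nonneg f, sq_nonneg h]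
  have hh : h = 0 := by nlinarith [sq_nonneg f, sq_nonneg h]
  subst hf hh
  have hk : k ≠ 0 := by
    rintro rfl
    apply h0
    constructor <;> simp [hφ, hψ]
  exact f1' hF hk hp hc

lemma caseK {F : E3 → ℝ} (hF : Nm F) {gA gB gC gD gE gF t1 t2 a p q r s f h : ℝ}
    (hc : CT F ⟨gA, gB - t1, p, gB + t1, gC, q, a, 0, f⟩
      ⟨gD, gE - t2, r, gE + t2, gF, s, 0, a, h⟩) :
    Concl F ⟨gA, gB - t1, p, gB + t1, gC, q, a, 0, f⟩
      ⟨gD, gE - t2, r, gE + t2, gF, s, 0, a, h⟩ := by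
  have cub : ∀ x y : ℝ, x ^ 3 * gD + x ^ 2 * y * (2 * gE - gA) + x * y ^ 2 * (gF - 2 * gB)
      - y ^ 3 * gC = 0 := by
    intro x y
    by_cases h0 : x = 0 ∧ y = 0
    · obtain ⟨rfl, rfl⟩ := h0; ring
    have h1 := hc (-y) x 0 (x, y, 0) (by simp only; ring)
    have h2 := hc 0 0 1 (x, y, 0) (by simp only; ring)
    refine hF.not_self (x := (x, y, (0:ℝ))) ?_ ?_
    · intro h; apply h0
      simpa using h
    · refine ld_congr (hF.add0 (Nm.smul0 (x ^ 2 + y ^ 2) h1) (Nm.smul0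
        (y * (x * (gD * x + (gE - t2) * y) - y * (gA * x + (gB - t1) * y))
          - x * (x * ((gE + t2) * x + gF * y) - y * ((gB + t1) * x + gC * y))) h2)) rfl ?_
      simp only [M3.L_apply, Jm, Prod.smul_mk, Prod.mk_add_mk, smul_eq_mul, Prod.mk.injEq]
      refine ⟨?_, ?_, ?_⟩ <;> ring
  have c1 := cub 1 0
  have c2 := cub 0 1
  have c3 := cub 1 1
  have c4 := cub 1 (-1)
  have hD : gD = 0 := by linarith
  have hC : gC = 0 := by linarith
  have hA : gE = gA / 2 := by linarith
  have hG : gF = 2 * gB := by linarith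
  clear cub c1 c2 c3 c4
  subst hD hC hA hG
  have hn : 1 + a ^ 2 ≠ 0 := by positivity
  obtain ⟨d1, hd1⟩ : ∃ d1, d1 * (1 + a ^ 2) = a * gA + 2 * gB := ⟨_, div_mul_cancel₀ _ hn⟩
  obtain ⟨d2, hd2⟩ : ∃ d2, d2 * (1 + a ^ 2) = 2 * a * gB - gA := ⟨_, div_mul_cancel₀ _ hn⟩
  have z1 : gA - d1 * a + d2 = 0 := mul_left_cancel₀ hn (by linear_combination -a * hd1 + hd2)
  have z2 : 2 * gB - d1 - d2 * a = 0 := mul_left_cancel₀ hn (by linear_combination -a * hd2 - hd1)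
  have hc' := hc.shift d1 d2
  refine Concl.unshift (d1 := d1) (d2 := d2) ?_
  have hN := sh_nm hF d1 d2
  have hA := eqN (A := shA d1 d2 ⟨gA, gB - t1, p, gB + t1, 0, q, a, 0, f⟩)
    (x11 := 0)
    (x12 := -(t1 + (-3 * d1 - d2 * a) / 2))
    (x21 := (t1 + (-3 * d1 - d2 * a) / 2))
    (x22 := 0) (x31 := a) (x32 := 0)
    (by simp only [shA]; linear_combination z1) (by simp only [shA]; linear_combination (1/2) * z2)
    (by simp only [shA]; linear_combination (1/2) * z2)
    (by simp only [shA]; ring) rfl rfl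
  have hB := eqN (A := shB d1 d2 ⟨0, gA / 2 - t2, r, gA / 2 + t2, 2 * gB, s, 0, a, h⟩)
    (x11 := 0)
    (x12 := -(t2 + (-3 * d2 + d1 * a) / 2))
    (x21 := (t2 + (-3 * d2 + d1 * a) / 2))
    (x22 := 0) (x31 := 0) (x32 := a)
    (by simp only [shB]; ring) (by simp only [shB]; linear_combination (1/2) * z1)
    (by simp only [shB]; linear_combination (1/2) * z1)
    (by simp only [shB]; linear_combination z2) rfl rfl
  rw [hA, hB] at hc' ⊢
  exact stage2' hN hc'

theorem coord {F : E3 → ℝ} (hF : Nm F) {A B : M3} (hc : CT F A B) : Concl F A B := by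
  obtain ⟨c, d, hcd, hQ⟩ := angle2 (A.a31 - B.a32) (A.a32 + B.a31)
  have hc' := hc.rot hcd
  refine Concl.unrot hcd ?_
  have hN := ro_nm hF hcd
  have hab : (rc c d (lc c A d B)).a31 = (rc c d (lc (-d) A c B)).a32 := by
    simp only [rc, lc]; linear_combination hQ
  generalize (rc c d (lc c A d B)) = A' at *
  generalize (rc c d (lc (-d) A c B)) = B' at *
  have hA := eqN (A := A') (x11 := A'.a11) (x12 := (A'.a12 + A'.a21) / 2 - (A'.a21 - A'.a12) / 2)
    (x21 := (A'.a12 + A'.a21) / 2 + (A'.a21 - A'.a12) / 2) (x22 := A'.a22) (x31 := A'.a31)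
    (x32 := - -A'.a32) rfl (by ring) (by ring) rfl rfl (by ring)
  have hB := eqN (A := B') (x11 := B'.a11) (x12 := (B'.a12 + B'.a21) / 2 - (B'.a21 - B'.a12) / 2)
    (x21 := (B'.a12 + B'.a21) / 2 + (B'.a21 - B'.a12) / 2) (x22 := B'.a22) (x31 := B'.a31)
    (x32 := A'.a31) rfl (by ring) (by ring) rfl rfl hab.symm
  by_cases hk : B'.a31 = 0 ∧ A'.a32 = 0
  · rw [hk.2, neg_zero, neg_zero] at hA
    rw [hk.1] at hB
    rw [hA, hB] at hc' ⊢
    exact caseK hN hc'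
  · have hk12 : B'.a31 ≠ 0 ∨ -A'.a32 ≠ 0 := by
      by_contra hcon
      push Not at hcon
      exact hk ⟨hcon.1, neg_eq_zero.1 hcon.2⟩
    rw [hA, hB] at hc' ⊢
    exact stage1 hN hk12 hc'

section Assembly
variable {X : Type*} [NormedAddCommGroup X] [NormedSpace ℝ X]

lemma ld_lin {W : Type*} [NormedAddCommGroup W] [NormedSpace ℝ W] {F : X → ℝ} {c : ℝ}
    (T : W →ₗ[ℝ] X) (x v : W) :
    HasLineDerivAt ℝ (fun x => F (T x)) c x v ↔ HasLineDerivAt ℝ F c (T x) (T v) := by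
  have : (fun t : ℝ => F (T (x + t • v))) = fun t : ℝ => F (T x + t • T v) := by
    funext t; rw [map_add, map_smul]
  unfold HasLineDerivAt
  rw [this]

def e1 : E3 := (1, 0, 0)
def e2 : E3 := (0, 1, 0)
def e3 : E3 := (0, 0, 1)

lemma e_sum (x : E3) : x = x.1 • e1 + x.2.1 • e2 + x.2.2 • e3 := by
  obtain ⟨a, b, c⟩ := x
  simp [e1, e2, e3]

def matOf (g : E3 →ₗ[ℝ] E3) : M3 :=
  ⟨(g e1).1, (g e2).1, (g e3).1, (g e1).2.1, (g e2).2.1, (g e3).2.1, (g e1).2.2, (g e2).2.2, (g e3).2.2⟩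

lemma matOf_L (g : E3 →ₗ[ℝ] E3) (x : E3) : (matOf g).L x = g x := by
  conv_rhs => rw [e_sum x, map_add, map_add, map_smul, map_smul, map_smul]
  rw [M3.L_apply]
  simp only [matOf]
  ext <;> simp only [Prod.fst_add, Prod.snd_add, Prod.smul_fst, Prod.smul_snd, smul_eq_mul] <;> ring

lemma trace_zero {F : X → ℝ} (hF : Nm F) (hdim : Module.finrank ℝ X = 3) (M : X →ₗ[ℝ] X)
    (h : ∀ x, HasLineDerivAt ℝ F 0 x (M x)) : LinearMap.trace ℝ X M = 0 := by
  have : FiniteDimensional ℝ X := FiniteDimensional.of_finrank_pos (by omega)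
  let T : E3 ≃ₗ[ℝ] X := LinearEquiv.ofFinrankEq E3 X (by rw [hdim]; simp)
  have hN : Nm (fun x => F ((T : E3 →ₗ[ℝ] X) x)) := hF.comp_inj (T : E3 →ₗ[ℝ] X) (by
    intro x hx; exact T.map_eq_zero_iff.1 hx)
  let G : E3 →ₗ[ℝ] E3 := T.symm.conj M
  have hG : ∀ x, T (G x) = M (T x) := by
    intro x
    simp [G, LinearEquiv.conj_apply]
  have h3 := hN.trace3 (LinearMap.toContinuousLinearMap G) (fun x => by
    rw [ld_lin]
    exact ld_congr (h (T x)) rfl (hG x).symm)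
  have ht : LinearMap.trace ℝ E3 G = LinearMap.trace ℝ X M := LinearMap.trace_conj' M T.symm
  rw [← ht]
  have hs : G = (X1 : E3 →ₗ[ℝ] ℝ).smulRight (G e1) + (X2 : E3 →ₗ[ℝ] ℝ).smulRight (G e2)
      + (X3 : E3 →ₗ[ℝ] ℝ).smulRight (G e3) := by
    refine LinearMap.ext fun x => ?_
    conv_lhs => rw [e_sum x, map_add, map_add, map_smul, map_smul, map_smul]
    rfl
  rw [hs, map_add, map_add, LinearMap.trace_smulRight, LinearMap.trace_smulRight,
    LinearMap.trace_smulRight]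
  exact h3

/-- the case of an adapted frame -/
lemma adapted {F : X → ℝ} (hF : Nm F) (R : Module.Dual ℝ X →ₗ[ℝ] (X →ₗ[ℝ] X))
    (H : ∀ (lam : Module.Dual ℝ X) (x : X), lam x = 0 → HasLineDerivAt ℝ F 0 x (R lam x))
    (T : E3 ≃ₗ[ℝ] X) (u0 : X)
    (hJ : ∀ x : E3, R ((X3 : E3 →ₗ[ℝ] ℝ) ∘ₗ (T.symm : X →ₗ[ℝ] E3)) (T x) = T (Jm.L x) + x.2.2 • u0) :
    ∃ u : X, ∀ (lam : Module.Dual ℝ X) (x : X), HasLineDerivAt ℝ F 0 x (R lam x - lam x • u) := by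
  let ξ1 : Module.Dual ℝ X := (X1 : E3 →ₗ[ℝ] ℝ) ∘ₗ (T.symm : X →ₗ[ℝ] E3)
  let ξ2 : Module.Dual ℝ X := (X2 : E3 →ₗ[ℝ] ℝ) ∘ₗ (T.symm : X →ₗ[ℝ] E3)
  let ξ3 : Module.Dual ℝ X := (X3 : E3 →ₗ[ℝ] ℝ) ∘ₗ (T.symm : X →ₗ[ℝ] E3)
  have x1 : ∀ x, ξ1 (T x) = x.1 := fun x => by simp [ξ1, X1_apply]
  have x2 : ∀ x, ξ2 (T x) = x.2.1 := fun x => by simp [ξ2, X2_apply]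
  have x3 : ∀ x, ξ3 (T x) = x.2.2 := fun x => by simp [ξ3, X3_apply]
  have hJ' : ∀ x : E3, R ξ3 (T x) = T (Jm.L x) + x.2.2 • u0 := hJ
  let A : M3 := matOf (T.symm.conj (R ξ1 - ξ1.smulRight u0))
  let B : M3 := matOf (T.symm.conj (R ξ2 - ξ2.smulRight u0))
  have hA : ∀ x, R ξ1 (T x) = T (A.L x) + x.1 • u0 := fun x => by
    rw [matOf_L]; simp [LinearEquiv.conj_apply, x1]
  have hB : ∀ x, R ξ2 (T x) = T (B.L x) + x.2.1 • u0 := fun x => by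
    rw [matOf_L]; simp [LinearEquiv.conj_apply, x2]
  have key : ∀ (l1 l2 l3 : ℝ) (x : E3), R (l1 • ξ1 + l2 • ξ2 + l3 • ξ3) (T x)
      = T (l1 • A.L x + l2 • B.L x + l3 • Jm.L x) + (l1 * x.1 + l2 * x.2.1 + l3 * x.2.2) • u0 := by
    intro l1 l2 l3 x
    simp only [map_add, map_smul, LinearMap.add_apply, LinearMap.smul_apply, hA, hB, hJ']
    module
  have lamT : ∀ (l1 l2 l3 : ℝ) (x : E3), (l1 • ξ1 + l2 • ξ2 + l3 • ξ3) (T x)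
      = l1 * x.1 + l2 * x.2.1 + l3 * x.2.2 := by
    intro l1 l2 l3 x
    simp only [LinearMap.add_apply, LinearMap.smul_apply, x1, x2, x3, smul_eq_mul]
  have hN : Nm (fun x => F ((T : E3 →ₗ[ℝ] X) x)) := hF.comp_inj (T : E3 →ₗ[ℝ] X) (by
    intro x hx; exact T.map_eq_zero_iff.1 hx)
  have hc : CT (fun x => F ((T : E3 →ₗ[ℝ] X) x)) A B := by
    intro l1 l2 l3 x hx
    rw [ld_lin]
    have := H (l1 • ξ1 + l2 • ξ2 + l3 • ξ3) (T x) (by rw [lamT, hx])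
    rw [key, hx, zero_smul, add_zero] at this
    exact this
  obtain ⟨u, hu⟩ := coord hN hc
  refine ⟨u0 + T u, fun lam y => ?_⟩
  obtain ⟨x, rfl⟩ := T.surjective y
  have hl : lam = lam (T e1) • ξ1 + lam (T e2) • ξ2 + lam (T e3) • ξ3 := by
    refine LinearMap.ext fun z => ?_
    obtain ⟨w, rfl⟩ := T.surjective z
    rw [lamT]
    conv_lhs => rw [e_sum w]
    simp only [map_add, map_smul, smul_eq_mul]
    ring
  have h1 := hu (lam (T e1)) (lam (T e2)) (lam (T e3)) x
  rw [ld_lin] at h1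
  refine ld_congr h1 rfl ?_
  conv_rhs => rw [hl, key, lamT]
  simp only [map_add, map_smul, map_sub, LinearEquiv.coe_coe]
  module

lemma exists_inv (hdim : Module.finrank ℝ X = 3) (R : Module.Dual ℝ X →ₗ[ℝ] (X →ₗ[ℝ] X)) :
    ∃ lam : Module.Dual ℝ X, lam ≠ 0 ∧ ∀ x, lam x = 0 → lam (R lam x) = 0 := by
  have : FiniteDimensional ℝ X := FiniteDimensional.of_finrank_pos (by omega)
  let T : E3 ≃ₗ[ℝ] X := LinearEquiv.ofFinrankEq E3 X (by rw [hdim]; simp)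
  let D : E3 →ₗ[ℝ] Module.Dual ℝ X :=
    (X1 : E3 →ₗ[ℝ] ℝ).smulRight ((X1 : E3 →ₗ[ℝ] ℝ) ∘ₗ (T.symm : X →ₗ[ℝ] E3))
    + (X2 : E3 →ₗ[ℝ] ℝ).smulRight ((X2 : E3 →ₗ[ℝ] ℝ) ∘ₗ (T.symm : X →ₗ[ℝ] E3))
    + (X3 : E3 →ₗ[ℝ] ℝ).smulRight ((X3 : E3 →ₗ[ℝ] ℝ) ∘ₗ (T.symm : X →ₗ[ℝ] E3))
  have hD : ∀ l x : E3, D l (T x) = l.1 * x.1 + l.2.1 * x.2.1 + l.2.2 * x.2.2 := by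
    intro l x
    simp [D, X1_apply, X2_apply, X3_apply]
  let q : E3 → E3 → ℝ := fun v l => D l (R (D l) (T v))
  have qc : ∀ v, Continuous (q v) := by
    intro v
    let bl : E3 →ₗ[ℝ] E3 →ₗ[ℝ] ℝ := LinearMap.mk₂ ℝ (fun l m => D l (R (D m) (T v)))
      (by intros; simp) (by intros; simp) (by intros; simp) (by intros; simp)
    have hq : q v = fun l => l.1 * l.1 * bl e1 e1 + l.1 * l.2.1 * bl e1 e2 + l.1 * l.2.2 * bl e1 e3
        + l.2.1 * l.1 * bl e2 e1 + l.2.1 * l.2.1 * bl e2 e2 + l.2.1 * l.2.2 * bl e2 e3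
        + l.2.2 * l.1 * bl e3 e1 + l.2.2 * l.2.1 * bl e3 e2 + l.2.2 * l.2.2 * bl e3 e3 := by
      funext l
      have : q v l = bl l l := rfl
      rw [this]
      conv_lhs => rw [e_sum l]
      simp only [map_add, map_smul, LinearMap.add_apply, LinearMap.smul_apply, smul_eq_mul]
      ring
    rw [hq]
    fun_prop
  have qs : ∀ v l, q v (-l) = q v l := by
    intro v l
    simp [q]
  obtain ⟨l, hl, c, h1, h2, h3⟩ := hairy (q e1) (q e2) (q e3) (qc _) (qc _) (qc _) (qs _) (qs _) (qs _)
  refine ⟨D l, ?_, ?_⟩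
  · intro h0
    apply hl
    have a1 := hD l e1
    have a2 := hD l e2
    have a3 := hD l e3
    rw [h0] at a1 a2 a3
    simp [e1, e2, e3] at a1 a2 a3
    ext
    · exact a1.symm
    · exact a2.symm
    · exact a3.symm
  · intro y hy
    obtain ⟨x, rfl⟩ := T.surjective y
    rw [hD] at hy
    have : D l (R (D l) (T x)) = x.1 * q e1 l + x.2.1 * q e2 l + x.2.2 * q e3 l := by
      conv_lhs => rw [e_sum x]
      simp only [map_add, map_smul, smul_eq_mul, q]
    rw [this, h1, h2, h3]
    linear_combination c * hy

lemma exists_u {F : X → ℝ} (hF : Nm F) (hdim : Module.finrank ℝ X = 3)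
    (R : Module.Dual ℝ X →ₗ[ℝ] (X →ₗ[ℝ] X))
    (H : ∀ (lam : Module.Dual ℝ X) (x : X), lam x = 0 → HasLineDerivAt ℝ F 0 x (R lam x)) :
    ∃ u : X, ∀ (lam : Module.Dual ℝ X) (x : X), HasLineDerivAt ℝ F 0 x (R lam x - lam x • u) := by
  have : FiniteDimensional ℝ X := FiniteDimensional.of_finrank_pos (by omega)
  obtain ⟨lam, hlam, hinv⟩ := exists_inv hdim R
  have hker : Module.finrank ℝ (LinearMap.ker lam) = 2 := by
    have := Module.Dual.finrank_ker_add_one_of_ne_zero hlam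
    omega
  let b := Module.finBasisOfFinrankEq ℝ (LinearMap.ker lam) hker
  obtain ⟨v3, hv3⟩ : ∃ v3, lam v3 = 1 := by
    obtain ⟨w, hw⟩ : ∃ w, lam w ≠ 0 := by
      by_contra hcon
      push Not at hcon
      exact hlam (LinearMap.ext hcon)
    exact ⟨(lam w)⁻¹ • w, by simp [hw]⟩
  obtain ⟨v1, hv1⟩ : ∃ v1 : X, v1 = b 0 := ⟨_, rfl⟩
  obtain ⟨v2, hv2⟩ : ∃ v2 : X, v2 = b 1 := ⟨_, rfl⟩
  have k1 : lam v1 = 0 := by rw [hv1]; exact (b 0).2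
  have k2 : lam v2 = 0 := by rw [hv2]; exact (b 1).2
  have span : ∀ x, lam x = 0 → ∃ s t : ℝ, x = s • v1 + t • v2 := by
    intro x hx
    have := b.sum_repr ⟨x, hx⟩
    rw [Fin.sum_univ_two] at this
    refine ⟨b.repr ⟨x, hx⟩ 0, b.repr ⟨x, hx⟩ 1, ?_⟩
    have h := congrArg Subtype.val this
    simp only [Submodule.coe_add, Submodule.coe_smul] at h
    rw [hv1, hv2]
    exact h.symm
  have indep : ∀ s t : ℝ, s • v1 + t • v2 = 0 → s = 0 ∧ t = 0 := by
    intro s t hst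
    have hli := b.linearIndependent
    rw [Fintype.linearIndependent_iff] at hli
    have := hli ![s, t] (by
      rw [Fin.sum_univ_two]
      apply Subtype.ext
      rw [hv1, hv2] at hst
      simpa using hst)
    exact ⟨by simpa using this 0, by simpa using this 1⟩
  obtain ⟨α, β, h1⟩ := span _ (hinv v1 k1)
  obtain ⟨γ, δ, h2⟩ := span _ (hinv v2 k2)
  have pl : α + δ = 0 ∧ (0 < α * δ - β * γ ∨ (α = 0 ∧ β = 0 ∧ γ = 0 ∧ δ = 0)) := by
    let S : E2 →ₗ[ℝ] X :=
      (LinearMap.fst ℝ ℝ ℝ).smulRight v1 + (LinearMap.snd ℝ ℝ ℝ).smulRight v2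
    have hS : ∀ s t : ℝ, S (s, t) = s • v1 + t • v2 := fun s t => rfl
    have hN : Nm (fun x => F (S x)) := hF.comp_inj S (by
      rintro ⟨s, t⟩ h0
      rw [hS] at h0
      obtain ⟨h1, h2⟩ := indep s t h0
      rw [h1, h2]; rfl)
    refine hN.planar (fun s t => ?_)
    rw [ld_lin]
    have := H lam (s • v1 + t • v2) (by simp [k1, k2])
    refine ld_congr this rfl ?_
    rw [hS, map_add, map_smul, map_smul, h1, h2]
    module
  obtain ⟨ptr, pdet | ⟨rfl, rfl, rfl, rfl⟩⟩ := pl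
  · obtain ⟨ω, hω⟩ : ∃ ω, ω = Real.sqrt (α * δ - β * γ) := ⟨_, rfl⟩
    have hω0 : ω ≠ 0 := by rw [hω]; exact (Real.sqrt_pos.2 pdet).ne'
    have hω2 : ω ^ 2 = α * δ - β * γ := by rw [hω]; exact Real.sq_sqrt pdet.le
    have hδ : δ = -α := by linarith
    subst hδ
    have hβ : β ≠ 0 := by
      rintro rfl
      nlinarith [sq_nonneg α]
    obtain ⟨w2, hw2⟩ : ∃ w2, w2 = ω⁻¹ • R lam v1 := ⟨_, rfl⟩
    have hRw : R lam w2 = -(ω • v1) := by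
      have e : R lam (R lam v1) = -(ω ^ 2 • v1) := by
        conv_lhs => rw [h1]
        rw [map_add, map_smul, map_smul, h1, h2, hω2]
        module
      rw [hw2, map_smul, e, smul_neg, smul_smul]
      congr 2
      field_simp
    have hRv : R lam v1 = ω • w2 := by
      rw [hw2, smul_smul, mul_inv_cancel₀ hω0, one_smul]
    have kw : lam w2 = 0 := by rw [hw2, map_smul, hinv v1 k1, smul_zero]
    let T0 : E3 →ₗ[ℝ] X := (X1 : E3 →ₗ[ℝ] ℝ).smulRight v1 + (X2 : E3 →ₗ[ℝ] ℝ).smulRight w2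
      + (X3 : E3 →ₗ[ℝ] ℝ).smulRight (ω • v3)
    have hT0 : ∀ x : E3, T0 x = x.1 • v1 + x.2.1 • w2 + x.2.2 • (ω • v3) := fun x => rfl
    have hlT : ∀ x : E3, lam (T0 x) = ω * x.2.2 := by
      intro x
      rw [hT0]
      simp [k1, kw, hv3]
      ring
    have hinj : Function.Injective T0 := by
      rw [injective_iff_map_eq_zero]
      rintro ⟨x, y, z⟩ h0
      have hz : z = 0 := by
        have := hlT (x, y, z)
        rw [h0, map_zero] at this
        simpa [hω0] using this.symm
      subst hz
      have h0' : x • v1 + y • w2 = 0 := by simpa [hT0] using h0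
      rw [hw2, h1] at h0'
      have h0'' : (x + y * ω⁻¹ * α) • v1 + (y * ω⁻¹ * β) • v2 = 0 := by
        rw [← h0']; module
      obtain ⟨i1, i2⟩ := indep _ _ h0''
      have hy : y = 0 := by
        simpa [hω0, hβ] using i2
      subst hy
      have hx : x = 0 := by simpa using i1
      subst hx
      rfl
    let T : E3 ≃ₗ[ℝ] X := LinearEquiv.ofInjectiveOfFinrankEq T0 hinj (by rw [hdim]; simp)
    have hT : ∀ x, T x = T0 x := fun x => rfl
    refine adapted hF R H T (R lam v3) ?_
    intro x
    have hX3 : (X3 : E3 →ₗ[ℝ] ℝ) ∘ₗ (T.symm : X →ₗ[ℝ] E3) = ω⁻¹ • lam := by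
      refine LinearMap.ext fun y => ?_
      obtain ⟨x, rfl⟩ := T.surjective y
      have : (ω⁻¹ • lam) (T x) = x.2.2 := by
        rw [LinearMap.smul_apply, hT, hlT, smul_eq_mul, ← mul_assoc, inv_mul_cancel₀ hω0, one_mul]
      rw [this]
      simp [X3_apply]
    rw [hX3, hT, hT, hT0, hT0, map_smul, LinearMap.smul_apply, map_add, map_add, map_smul, map_smul,
      map_smul, map_smul, hRv, hRw, M3.L_apply]
    simp only [Jm, smul_add, smul_neg]
    match_scalars <;> field_simp <;> ring
  · refine ⟨R lam v3, fun mu x => ?_⟩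
    have hR0 : ∀ x, R lam x = lam x • R lam v3 := by
      intro x
      obtain ⟨s, t, hst⟩ := span (x - lam x • v3) (by simp [hv3])
      have : x = s • v1 + t • v2 + lam x • v3 := by rw [← hst]; abel
      conv_lhs => rw [this]
      rw [map_add, map_add, map_smul, map_smul, map_smul, h1, h2]
      simp
    refine hF.everywhere (LinearMap.toContinuousLinearMap (R mu - mu.smulRight (R lam v3)))
      (Z := fun x => LinearMap.toContinuousLinearMap lam x)
      (fun x => (LinearMap.toContinuousLinearMap lam).analyticAt x) (x0 := v3)
      (by simp [hv3]) (fun x hx => ?_) x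
    have hx' : lam x ≠ 0 := hx
    have := H (mu - (mu x / lam x) • lam) x (by simp [hx'])
    refine ld_congr this rfl ?_
    have e : (R (mu - (mu x / lam x) • lam)) x = R mu x - (mu x / lam x) • R lam x := by
      simp
    rw [e, hR0 x, smul_smul, div_mul_cancel₀ _ hx']
    rfl

end Assembly

/-- **Proposition (`R` is tangent).**  Let `dim X = 3`, let `K ⊂ X` be a convex body with `0`
in its interior, and let `R : X* → Hom(X, X)` be a linear map such that every `R_λ = R(λ)` is
trace-free and such that `R_λ(x)` is tangent to `∂K` at `x` whenever `x ∈ ∂K` and `λ(x) = 0`.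
Then `R_λ(x)` is tangent to `∂K` at `x` for every `λ ∈ X*` and every `x ∈ ∂K`. -/
theorem R_tangent_everywhere
    {X : Type*} [NormedAddCommGroup X] [NormedSpace ℝ X]
    (hdim : Module.finrank ℝ X = 3)
    (K : Set X) (hKcomp : IsCompact K) (hKconv : Convex ℝ K)
    (h0 : (0 : X) ∈ interior K)
    (R : Module.Dual ℝ X →ₗ[ℝ] (X →ₗ[ℝ] X))
    (htr : ∀ lam : Module.Dual ℝ X, LinearMap.trace ℝ X (R lam) = 0)
    (htang : ∀ lam : Module.Dual ℝ X, ∀ x ∈ frontier K, lam x = 0 →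
      IsTangentVec K x (R lam x)) :
    ∀ lam : Module.Dual ℝ X, ∀ x ∈ frontier K, IsTangentVec K x (R lam x) := by
  have hfd : FiniteDimensional ℝ X := FiniteDimensional.of_finrank_pos (by omega)
  have hF := nm_gauge hKcomp hKconv h0
  have hn : K ∈ 𝓝 (0:X) := mem_interior_iff_mem_nhds.1 h0
  have H : ∀ (lam : Module.Dual ℝ X) (x : X), lam x = 0 →
      HasLineDerivAt ℝ (gauge K) 0 x (R lam x) := by
    intro lam x hx
    by_cases hx0 : x = 0
    · subst hx0
      rw [map_zero]
      exact Nm.zero0 0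
    have hp := hF.pos x hx0
    have hy : (gauge K x)⁻¹ • x ∈ frontier K := by
      rw [← gauge_eq_one_iff_mem_frontier hKconv hn, hF.hom _ _ (inv_nonneg.2 hp.le)]
      exact inv_mul_cancel₀ hp.ne'
    have h1 := (tangent_iff hKcomp hKconv h0 hy).1 (htang lam _ hy (by simp [hx]))
    refine ld_congr (hF.ld_scale h1 hp.le) ?_ ?_
    · rw [smul_smul, mul_inv_cancel₀ hp.ne', one_smul]
    · rw [map_smul, smul_smul, mul_inv_cancel₀ hp.ne', one_smul]
  obtain ⟨u, hu⟩ := exists_u hF hdim R H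
  have hlu : ∀ lam : Module.Dual ℝ X, lam u = 0 := by
    intro lam
    have := trace_zero hF hdim (R lam - lam.smulRight u) (fun x => hu lam x)
    rw [map_sub, htr, LinearMap.trace_smulRight] at this
    linarith
  have hu0 : u = 0 := (Module.forall_dual_apply_eq_zero_iff ℝ u).1 hlu
  intro lam x hx
  rw [tangent_iff hKcomp hKconv h0 hx]
  have := hu lam x
  rwa [hu0, smul_zero, sub_zero] at this
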